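/- Let n ≥ 1 and 1 < p < ∞. Each of the symbols ν_1(ξ,τ) := |τ|^{1/2}/(1 + 4π²|ξ|² + iτ), ν_{2,k}(ξ,τ) := ξ_k/(1 + 4π²|ξ|² + iτ), and ν_{3,k}(ξ,τ) := ξ_k·|τ|^{1/2}/(1 + 4π²|ξ|² + iτ) (for k = 1,…,n) is an Lᵖ(ℝ^{n+1})-multiplier; that is, there exists M > 0 (depending only on n, p) such that ‖𝓕⁻¹(ν·𝓕f)‖_{Lᵖ} ≤ M·‖f‖_{Lᵖ} for every Schwartz function f on ℝ^{n+1} and each such symbol ν. -/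

import Mathlib

noncomputable section

open MeasureTheory Real Complex
open scoped ENNReal NNReal Real BigOperators

/-- Euclidean space `ℝⁿ`. -/
abbrev Rn (n : ℕ) : Type := EuclideanSpace ℝ (Fin n)

/-- The space `ℝ^{n+1} = ℝⁿ × ℝ`, points written `(X, t)`. -/
abbrev Rn1 (n : ℕ) : Type := EuclideanSpace ℝ (Fin n) × ℝ

/-- Fourier transform on `ℝ^{n+1}`:
`𝓕f(ξ,τ) = ∫ e^{−2πi(X·ξ + tτ)} f(X,t) dX dt`. -/
def FT1 {n : ℕ} (f : Rn1 n → ℂ) (q : Rn1 n) : ℂ :=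
  ∫ p : Rn1 n,
    Complex.exp (-(2 * (π : ℂ) * Complex.I) *
      (((∑ k, p.1 k * q.1 k) + p.2 * q.2 : ℝ) : ℂ)) * f p

/-- Inverse Fourier transform on `ℝ^{n+1}`. -/
def IFT1 {n : ℕ} (f : Rn1 n → ℂ) (x : Rn1 n) : ℂ :=
  ∫ q : Rn1 n,
    Complex.exp ((2 * (π : ℂ) * Complex.I) *
      (((∑ k, q.1 k * x.1 k) + q.2 * x.2 : ℝ) : ℂ)) * f q

/-- The Fourier multiplier operator `f ↦ 𝓕⁻¹(m · 𝓕 f)` on `ℝ^{n+1}`. -/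
def MOp {n : ℕ} (m : Rn1 n → ℂ) (f : Rn1 n → ℂ) : Rn1 n → ℂ :=
  IFT1 (fun q => m q * FT1 f q)

/-- The symbol `m_α(ξ,τ) = (1 + 4π²|ξ|² + iτ)^{α/2}` (principal branch). -/
def mSym {n : ℕ} (α : ℝ) (q : Rn1 n) : ℂ :=
  (1 + 4 * (π : ℂ) ^ 2 * (‖q.1‖ : ℂ) ^ 2 + Complex.I * (q.2 : ℂ)) ^ ((α : ℂ) / 2)

/-- Partial derivative `∂_{X_k}`. -/
def dX {n : ℕ} (k : Fin n) (f : Rn1 n → ℂ) : Rn1 n → ℂ :=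
  fun x => fderiv ℝ f x (EuclideanSpace.single k 1, 0)

/-- Partial derivative `∂_t`. -/
def dT {n : ℕ} (f : Rn1 n → ℂ) : Rn1 n → ℂ :=
  fun x => fderiv ℝ f x (0, 1)

/-- Iterated spatial derivative `D_X^β` for a multi-index `β`. -/
def dXmulti {n : ℕ} (β : Fin n → ℕ) (f : Rn1 n → ℂ) : Rn1 n → ℂ :=
  (List.finRange n).foldr (fun k g => (dX k)^[β k] g) f

/-- The half time-derivative `D_t^{1/2} f = 𝓕⁻¹(|τ|^{1/2}·𝓕f)`. -/
def halfDt {n : ℕ} (f : Rn1 n → ℂ) : Rn1 n → ℂ :=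
  MOp (fun q => ((|q.2| ^ ((1 : ℝ) / 2) : ℝ) : ℂ)) f

/-- The `Lᵖ(ℝ^{n+1})` norm (as a value in `ℝ≥0∞`), `p` a real exponent. -/
def pNorm {n : ℕ} (p : ℝ) (f : Rn1 n → ℂ) : ℝ≥0∞ :=
  eLpNorm f (ENNReal.ofReal p) volume

/-- Multi-indices `β ∈ ℕⁿ` with `|β| = N`. -/
def multiIdx (n N : ℕ) : Finset (Fin n → ℕ) :=
  (Fintype.piFinset fun _ : Fin n => Finset.range (N + 1)).filter fun β => (∑ k, β k) = N

/-- Convolution on `ℝ^{n+1}`. -/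
def conv1 {n : ℕ} (g f : Rn1 n → ℂ) : Rn1 n → ℂ :=
  fun x => ∫ y : Rn1 n, g (x - y) * f y

/-- A parabolic Littlewood–Paley family on `ℝ^{n+1}`. -/
structure ParabolicLP (n : ℕ) where
  φ : SchwartzMap (Rn1 n) ℂ
  ψ : SchwartzMap (Rn1 n) ℂ
  ft_pos : ∀ q : Rn1 n,
    1 / 2 < ‖q.1‖ + |q.2| ^ ((1 : ℝ) / 2) → ‖q.1‖ + |q.2| ^ ((1 : ℝ) / 2) < 2 →
      0 < (FT1 (⇑φ) q).re ∧ (FT1 (⇑φ) q).im = 0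
  ft_supp : ∀ q : Rn1 n,
    ¬(1 / 2 < ‖q.1‖ + |q.2| ^ ((1 : ℝ) / 2) ∧ ‖q.1‖ + |q.2| ^ ((1 : ℝ) / 2) < 2) →
      FT1 (⇑φ) q = 0
  ft_sum : ∀ q : Rn1 n, q ≠ 0 →
    ∑' i : ℤ, FT1 (⇑φ) (((2 : ℝ) ^ (-i)) • q.1, ((2 : ℝ) ^ (-(2 * i))) * q.2) = 1
  ft_psi : ∀ q : Rn1 n,
    FT1 (⇑ψ) q =
      1 - ∑' i : ℕ,
        FT1 (⇑φ) (((2 : ℝ) ^ (-((i : ℤ) + 1))) • q.1, ((2 : ℝ) ^ (-(2 * ((i : ℤ) + 1)))) * q.2)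

/-- The dilate `φ_i`, whose Fourier transform is `𝓕φ(2^{−i}ξ, 2^{−2i}τ)`. -/
def lpPhi {n : ℕ} (P : ParabolicLP n) (i : ℕ) : Rn1 n → ℂ :=
  fun x => (((2 : ℝ) ^ (i * (n + 2)) : ℝ) : ℂ) *
    P.φ (((2 : ℝ) ^ i) • x.1, ((2 : ℝ) ^ (2 * i)) * x.2)

/-- Parabolic Besov norm `N_{s,p}(f)` on `ℝ^{n+1}`, `1 ≤ p < ∞`. -/
def pBesov {n : ℕ} (P : ParabolicLP n) (s p : ℝ) (f : Rn1 n → ℂ) : ℝ≥0∞ :=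
  eLpNorm (conv1 (⇑P.ψ) f) (ENNReal.ofReal p) volume +
  (∑' i : ℕ,
    (ENNReal.ofReal ((2 : ℝ) ^ (s * ((i : ℝ) + 1))) *
      eLpNorm (conv1 (lpPhi P (i + 1)) f) (ENNReal.ofReal p) volume) ^ p) ^ (1 / p)

/-- Parabolic Besov norm `N_{s,∞}(f)` on `ℝ^{n+1}`. -/
def pBesovInf {n : ℕ} (P : ParabolicLP n) (s : ℝ) (f : Rn1 n → ℂ) : ℝ≥0∞ :=
  max (eLpNorm (conv1 (⇑P.ψ) f) ⊤ volume)
    (⨆ i : ℕ, ENNReal.ofReal ((2 : ℝ) ^ (s * ((i : ℝ) + 1))) *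
      eLpNorm (conv1 (lpPhi P (i + 1)) f) ⊤ volume)

/-- The time interval `(0, T)` for `0 < T ≤ ∞`. -/
def tSet (T : ℝ≥0∞) : Set ℝ := {t : ℝ | 0 < t ∧ ENNReal.ofReal t < T}

/-- Lebesgue measure restricted to the strip `ℝⁿ × (0,T)`. -/
def stripMeasure (n : ℕ) (T : ℝ≥0∞) : Measure (Rn1 n) :=
  volume.restrict {x : Rn1 n | x.2 ∈ tSet T}

/-- The parabolic Sobolev norm `‖g‖_{W^{2i,i}_p(ℝⁿ_T)}`. -/
def wNorm {n : ℕ} (i : ℕ) (p : ℝ) (T : ℝ≥0∞) (g : Rn1 n → ℂ) : ℝ≥0∞ :=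
  ∑ l ∈ Finset.range (i + 1),
    ∑ β ∈ (Fintype.piFinset fun _ : Fin n => Finset.range (2 * i + 1)).filter
        (fun β => (∑ k, β k) + 2 * l ≤ 2 * i),
      eLpNorm (dXmulti β (dT^[l] g)) (ENNReal.ofReal p) (stripMeasure n T)

/-- Time-regularity seminorm `[g]_{t,β,p,T}`. -/
def semT {n : ℕ} (b p : ℝ) (T : ℝ≥0∞) (g : Rn1 n → ℂ) : ℝ≥0∞ :=
  (∫⁻ X : Rn n, ∫⁻ t in tSet T, ∫⁻ s in tSet T,
      ENNReal.ofReal (‖g (X, t) - g (X, s)‖ ^ p / |t - s| ^ (1 + p * b / 2))) ^ (1 / p)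

/-- Space-regularity seminorm `[g]_{x,β,p,T}`. -/
def semX {n : ℕ} (b p : ℝ) (T : ℝ≥0∞) (g : Rn1 n → ℂ) : ℝ≥0∞ :=
  (∫⁻ t in tSet T, ∫⁻ X : Rn n, ∫⁻ Y : Rn n,
      ENNReal.ofReal (‖g (X + Y, t) - 2 * g (X, t) + g (X - Y, t)‖ ^ p /
        ‖Y‖ ^ ((n : ℝ) + p * b))) ^ (1 / p)

/-- The parabolic Besov norm `‖g‖_{B^{α,α/2}_p(ℝⁿ_T)}`, formed with index `i` where
`2i < α < 2i+2`. -/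
def pbNorm {n : ℕ} (i : ℕ) (α p : ℝ) (T : ℝ≥0∞) (g : Rn1 n → ℂ) : ℝ≥0∞ :=
  wNorm i p T g +
  ∑ l ∈ Finset.range (i + 1),
    ∑ β ∈ (Fintype.piFinset fun _ : Fin n => Finset.range (2 * i + 1)).filter
        (fun β => (∑ k, β k) + 2 * l = 2 * i),
      (semT (α - 2 * i) p T (dXmulti β (dT^[l] g)) +
        semX (α - 2 * i) p T (dXmulti β (dT^[l] g)))

/-- Fourier transform on `ℝⁿ`. -/
def FTn {n : ℕ} (f : Rn n → ℂ) (ξ : Rn n) : ℂ :=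
  ∫ x : Rn n, Complex.exp (-(2 * (π : ℂ) * Complex.I) * (((∑ k, x k * ξ k : ℝ)) : ℂ)) * f x

/-- Inverse Fourier transform on `ℝⁿ`. -/
def IFTn {n : ℕ} (f : Rn n → ℂ) (x : Rn n) : ℂ :=
  ∫ ξ : Rn n, Complex.exp ((2 * (π : ℂ) * Complex.I) * (((∑ k, ξ k * x k : ℝ)) : ℂ)) * f ξ

/-- Convolution on `ℝⁿ`. -/
def convn {n : ℕ} (g f : Rn n → ℂ) : Rn n → ℂ := fun x => ∫ y : Rn n, g (x - y) * f y

/-- A Littlewood–Paley family on `ℝⁿ`. -/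
structure LPFamily (n : ℕ) where
  φ : SchwartzMap (Rn n) ℂ
  ψ : SchwartzMap (Rn n) ℂ
  ft_pos : ∀ ξ : Rn n, 1 / 2 < ‖ξ‖ → ‖ξ‖ < 2 →
    0 < (FTn (⇑φ) ξ).re ∧ (FTn (⇑φ) ξ).im = 0
  ft_supp : ∀ ξ : Rn n, ¬(1 / 2 < ‖ξ‖ ∧ ‖ξ‖ < 2) → FTn (⇑φ) ξ = 0
  ft_sum : ∀ ξ : Rn n, ξ ≠ 0 → ∑' i : ℤ, FTn (⇑φ) (((2 : ℝ) ^ (-i)) • ξ) = 1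
  ft_psi : ∀ ξ : Rn n,
    FTn (⇑ψ) ξ = 1 - ∑' i : ℕ, FTn (⇑φ) (((2 : ℝ) ^ (-((i : ℤ) + 1))) • ξ)

/-- The dilate `φ′_i(x) = 2^{in} φ′(2^i x)`. -/
def lpPhin {n : ℕ} (P : LPFamily n) (i : ℕ) : Rn n → ℂ :=
  fun x => (((2 : ℝ) ^ (i * n) : ℝ) : ℂ) * P.φ (((2 : ℝ) ^ i) • x)

/-- Besov norm `B_{s,p}(f)` on `ℝⁿ`, `1 ≤ p < ∞`. -/
def besovN {n : ℕ} (P : LPFamily n) (s p : ℝ) (f : Rn n → ℂ) : ℝ≥0∞ :=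
  eLpNorm (convn (⇑P.ψ) f) (ENNReal.ofReal p) volume +
  (∑' i : ℕ,
    (ENNReal.ofReal ((2 : ℝ) ^ (s * ((i : ℝ) + 1))) *
      eLpNorm (convn (lpPhin P (i + 1)) f) (ENNReal.ofReal p) volume) ^ p) ^ (1 / p)

/-- The heat kernel `Γ(X,t)` on `ℝⁿ` (zero for `t ≤ 0`). -/
def heatKer (n : ℕ) (X : Rn n) (t : ℝ) : ℝ :=
  if 0 < t then (4 * π * t) ^ (-(n : ℝ) / 2) * Real.exp (-‖X‖ ^ 2 / (4 * t)) else 0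

/-- The heat extension `u(X,t) = ∫ Γ(X−Y,t) f(Y) dY`. -/
def heatExt {n : ℕ} (f : Rn n → ℂ) : Rn1 n → ℂ :=
  fun x => ∫ Y : Rn n, (heatKer n (x.1 - Y) x.2 : ℂ) * f Y

/-- The Euclidean inner product on `ℝⁿ × ℝ`. -/
def dotRn1 {n : ℕ} (p q : Rn1 n) : ℝ := (∑ k, p.1 k * q.1 k) + p.2 * q.2

/-- The character `r ↦ e^{2πir}`. -/
def eChar (r : ℝ) : ℂ := Complex.exp ((2 * (π : ℂ) * Complex.I) * (r : ℂ))

lemma continuous_dotRn1 {n : ℕ} : Continuous fun z : Rn1 n × Rn1 n => dotRn1 z.1 z.2 := by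
  unfold dotRn1; fun_prop

@[fun_prop]
lemma continuous_dotRn1_comp {n : ℕ} {α : Type*} [TopologicalSpace α] {f g : α → Rn1 n}
    (hf : Continuous f) (hg : Continuous g) : Continuous fun a => dotRn1 (f a) (g a) :=
  continuous_dotRn1.comp (hf.prodMk hg)

@[fun_prop]
lemma continuous_eChar : Continuous eChar := by unfold eChar; fun_prop

@[simp]
lemma norm_eChar (r : ℝ) : ‖eChar r‖ = 1 := by
  rw [eChar, show (2 * (π : ℂ) * Complex.I) * (r : ℂ) = ((2 * π * r : ℝ) : ℂ) * Complex.I by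
    push_cast; ring]
  exact Complex.norm_exp_ofReal_mul_I _

lemma eChar_add (r s : ℝ) : eChar (r + s) = eChar r * eChar s := by
  rw [eChar, eChar, eChar, ← Complex.exp_add]; push_cast; ring_nf

lemma conj_eChar (r : ℝ) : (starRingEnd ℂ) (eChar r) = eChar (-r) := by
  rw [eChar, eChar, ← Complex.exp_conj]
  simp [Complex.conj_ofNat]

lemma dotRn1_comm {n : ℕ} (p q : Rn1 n) : dotRn1 p q = dotRn1 q p := by
  simp [dotRn1, mul_comm]

lemma dotRn1_sub_left {n : ℕ} (p p' q : Rn1 n) :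
    dotRn1 (p - p') q = dotRn1 p q - dotRn1 p' q := by
  simp only [dotRn1, Prod.fst_sub, Prod.snd_sub, PiLp.sub_apply, sub_mul, Finset.sum_sub_distrib]
  ring

lemma FT1_eq {n : ℕ} (f : Rn1 n → ℂ) (q : Rn1 n) :
    FT1 f q = ∫ p, eChar (-(dotRn1 p q)) * f p := by
  simp only [FT1, eChar, dotRn1, Complex.ofReal_neg, mul_neg, neg_mul]

lemma IFT1_eq {n : ℕ} (f : Rn1 n → ℂ) (x : Rn1 n) :
    IFT1 f x = ∫ q, eChar (dotRn1 q x) * f q := by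
  simp [IFT1, eChar, dotRn1]

lemma integrable_eChar_mul {n : ℕ} {f : Rn1 n → ℂ} (hf : Integrable f) {r : Rn1 n → ℝ}
    (hr : Continuous r) : Integrable fun p => eChar (r p) * f p := by
  refine hf.bdd_mul (c := 1) (by fun_prop) ?_
  exact Filter.Eventually.of_forall fun x => by simp

lemma norm_FT1_le {n : ℕ} (f : Rn1 n → ℂ) (q : Rn1 n) : ‖FT1 f q‖ ≤ ∫ p, ‖f p‖ := by
  rw [FT1_eq]
  refine (norm_integral_le_integral_norm _).trans_eq ?_
  simp

lemma norm_IFT1_le {n : ℕ} (f : Rn1 n → ℂ) (q : Rn1 n) : ‖IFT1 f q‖ ≤ ∫ p, ‖f p‖ := by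
  rw [IFT1_eq]
  refine (norm_integral_le_integral_norm _).trans_eq ?_
  simp

lemma continuous_FT1 {n : ℕ} {f : Rn1 n → ℂ} (hf : Integrable f) : Continuous (FT1 f) := by
  rw [show FT1 f = fun q => ∫ p, eChar (-(dotRn1 p q)) * f p from funext (FT1_eq f)]
  refine continuous_of_dominated (bound := fun p => ‖f p‖) ?_ ?_ hf.norm ?_
  · exact fun q => (integrable_eChar_mul hf (by fun_prop)).1
  · exact fun q => Filter.Eventually.of_forall fun p => by simp
  · exact Filter.Eventually.of_forall fun p => by fun_prop

lemma continuous_IFT1 {n : ℕ} {f : Rn1 n → ℂ} (hf : Integrable f) : Continuous (IFT1 f) := by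
  rw [show IFT1 f = fun q => ∫ p, eChar (dotRn1 p q) * f p from funext (IFT1_eq f)]
  refine continuous_of_dominated (bound := fun p => ‖f p‖) ?_ ?_ hf.norm ?_
  · exact fun q => (integrable_eChar_mul hf (by fun_prop)).1
  · exact fun q => Filter.Eventually.of_forall fun p => by simp
  · exact Filter.Eventually.of_forall fun p => by fun_prop

open FourierTransform in
lemma FT1_eq_fourier {n : ℕ} (f : Rn1 n → ℂ) (q : Rn1 n) :
    FT1 f q = 𝓕 (fun w : WithLp 2 (Rn1 n) => f (WithLp.ofLp w)) (WithLp.toLp 2 q) := by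
  rw [Real.fourier_eq', FT1_eq]
  rw [← (WithLp.volume_preserving_ofLp (U := Rn n) (V := ℝ)).integral_comp
    (WithLp.prodContinuousLinearEquiv 2 ℝ (Rn n) ℝ).toHomeomorph.measurableEmbedding]
  refine integral_congr_ae (Filter.Eventually.of_forall fun w => ?_)
  simp only [smul_eq_mul, eChar, dotRn1, WithLp.prod_inner_apply, PiLp.inner_apply]
  congr 2
  simp [mul_comm]
  ring

open FourierTransform in
lemma IFT1_eq_fourierInv {n : ℕ} (f : Rn1 n → ℂ) (q : Rn1 n) :
    IFT1 f q = 𝓕⁻ (fun w : WithLp 2 (Rn1 n) => f (WithLp.ofLp w)) (WithLp.toLp 2 q) := by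
  rw [Real.fourierInv_eq', IFT1_eq]
  rw [← (WithLp.volume_preserving_ofLp (U := Rn n) (V := ℝ)).integral_comp
    (WithLp.prodContinuousLinearEquiv 2 ℝ (Rn n) ℝ).toHomeomorph.measurableEmbedding]
  refine integral_congr_ae (Filter.Eventually.of_forall fun w => ?_)
  simp only [smul_eq_mul, eChar, dotRn1, WithLp.prod_inner_apply, PiLp.inner_apply]
  congr 2
  simp [mul_comm]
  ring

open FourierTransform SchwartzMap in
/-- A Schwartz function on `ℝⁿ × ℝ`, transported to the Euclidean product. -/
def schwartzWithLp {n : ℕ} (f : SchwartzMap (Rn1 n) ℂ) : SchwartzMap (WithLp 2 (Rn1 n)) ℂ :=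
  compCLMOfContinuousLinearEquiv ℂ (WithLp.prodContinuousLinearEquiv 2 ℝ (Rn n) ℝ) f

open FourierTransform in
lemma integrable_FT1 {n : ℕ} (f : SchwartzMap (Rn1 n) ℂ) : Integrable (FT1 ⇑f) := by
  have h := (𝓕 (schwartzWithLp f)).integrable (μ := volume)
  have h2 := (WithLp.volume_preserving_toLp (U := Rn n) (V := ℝ)).integrable_comp_of_integrable h
  refine h2.congr (Filter.Eventually.of_forall fun q => ?_)
  simp only [Function.comp, FT1_eq_fourier, SchwartzMap.fourier_coe]
  rfl

open FourierTransform in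
lemma IFT1_FT1 {n : ℕ} (f : SchwartzMap (Rn1 n) ℂ) (x : Rn1 n) : IFT1 (FT1 ⇑f) x = f x := by
  rw [IFT1_eq_fourierInv]
  have h : (fun w : WithLp 2 (Rn1 n) => FT1 ⇑f (WithLp.ofLp w)) = 𝓕 ⇑(schwartzWithLp f) := by
    ext w
    rw [FT1_eq_fourier]
    rfl
  rw [h, ← SchwartzMap.fourier_coe, ← SchwartzMap.fourierInv_coe, FourierPair.fourierInv_fourier_eq]
  rfl

lemma integrable_mul_eChar_prod {n : ℕ} {f g : Rn1 n → ℂ} (hf : Integrable f) (hg : Integrable g)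
    {r : Rn1 n × Rn1 n → ℝ} (hr : Continuous r) :
    Integrable (fun z : Rn1 n × Rn1 n => eChar (r z) * (f z.1 * g z.2)) (volume.prod volume) := by
  refine (hf.mul_prod hg).bdd_mul (c := 1) (by fun_prop) ?_
  exact Filter.Eventually.of_forall fun x => by simp

/-- Multiplication formula for the Fourier transform. -/
lemma integral_mul_conj_IFT1 {n : ℕ} {F h : Rn1 n → ℂ} (hF : Integrable F) (hh : Integrable h) :
    ∫ x, F x * (starRingEnd ℂ) (IFT1 h x) = ∫ q, FT1 F q * (starRingEnd ℂ) (h q) := by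
  have hh' : Integrable fun q => (starRingEnd ℂ) (h q) := by
    simpa using (Complex.conjLIE.toContinuousLinearEquiv.integrable_comp_iff (φ := h)).2 hh
  calc ∫ x, F x * (starRingEnd ℂ) (IFT1 h x)
      = ∫ x, ∫ q, eChar (-(dotRn1 x q)) * (F x * (starRingEnd ℂ) (h q)) := by
        refine integral_congr_ae (Filter.Eventually.of_forall fun x => ?_)
        simp only [IFT1_eq]
        rw [← integral_conj, ← integral_const_mul]
        refine integral_congr_ae (Filter.Eventually.of_forall fun q => ?_)
        simp only [map_mul, conj_eChar, dotRn1_comm x q]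
        ring
    _ = ∫ q, ∫ x, eChar (-(dotRn1 x q)) * (F x * (starRingEnd ℂ) (h q)) := by
        apply integral_integral_swap
        exact integrable_mul_eChar_prod (r := fun z => -(dotRn1 z.1 z.2)) hF hh' (by fun_prop)
    _ = _ := by
        refine integral_congr_ae (Filter.Eventually.of_forall fun q => ?_)
        simp only [FT1_eq]
        rw [← integral_mul_const]
        simp only [mul_assoc]

/-- Multiplication by `𝓕 K` on the Fourier side is convolution with `K`. -/
lemma MOp_FT1_eq_conv1 {n : ℕ} {K : Rn1 n → ℂ} (hK : Integrable K) (f : SchwartzMap (Rn1 n) ℂ)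
    (x : Rn1 n) : MOp (FT1 K) ⇑f x = ∫ y, K y * f (x - y) := by
  rw [MOp, IFT1_eq]
  calc ∫ q, eChar (dotRn1 q x) * (FT1 K q * FT1 ⇑f q)
      = ∫ q, ∫ y, eChar (dotRn1 (x - y) q) * (FT1 ⇑f q * K y) := by
        refine integral_congr_ae (Filter.Eventually.of_forall fun q => ?_)
        simp only [FT1_eq K]
        rw [← integral_mul_const, ← integral_const_mul]
        refine integral_congr_ae (Filter.Eventually.of_forall fun y => ?_)
        beta_reduce
        rw [dotRn1_sub_left, sub_eq_add_neg, eChar_add, dotRn1_comm q x]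
        ring
    _ = ∫ y, ∫ q, eChar (dotRn1 (x - y) q) * (FT1 ⇑f q * K y) := by
        apply integral_integral_swap
        exact integrable_mul_eChar_prod (r := fun z => dotRn1 (x - z.2) z.1)
          (integrable_FT1 f) hK (by fun_prop)
    _ = _ := by
        refine integral_congr_ae (Filter.Eventually.of_forall fun y => ?_)
        simp only []
        rw [← IFT1_FT1 f, IFT1_eq, ← integral_const_mul]
        refine integral_congr_ae (Filter.Eventually.of_forall fun q => ?_)
        simp only [dotRn1_comm q]
        ring

lemma integrable_bdd_mul_FT1 {n : ℕ} {m : Rn1 n → ℂ} (hm : AEStronglyMeasurable m) {A : ℝ}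
    (hA : ∀ q, ‖m q‖ ≤ A) (f : SchwartzMap (Rn1 n) ℂ) : Integrable fun q => m q * FT1 ⇑f q :=
  (integrable_FT1 f).bdd_mul hm (Filter.Eventually.of_forall hA)

instance isAddHaarMeasure_volume_Rn1 {n : ℕ} : (volume : Measure (Rn1 n)).IsAddHaarMeasure :=
  inferInstanceAs ((volume : Measure (Rn n)).prod (volume : Measure ℝ)).IsAddHaarMeasure

lemma MOp_FT1_eq {n : ℕ} {K : Rn1 n → ℂ} (hK : Integrable K) (f : SchwartzMap (Rn1 n) ℂ) :
    MOp (FT1 K) ⇑f = conv1 K ⇑f := by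
  ext x
  rw [MOp_FT1_eq_conv1 hK, conv1, ← integral_sub_left_eq_self _ volume x]
  simp

lemma integrable_conv_integrand {n : ℕ} {K f : Rn1 n → ℂ} (hK : Integrable K) (hf : Integrable f) :
    Integrable (fun z : Rn1 n × Rn1 n => K (z.1 - z.2) * f z.2) (volume.prod volume) := by
  have := hf.convolution_integrand (ContinuousLinearMap.mul ℝ ℂ) hK
  refine this.congr (Filter.Eventually.of_forall fun z => ?_)
  simp [mul_comm]

lemma integrable_conv1 {n : ℕ} {K f : Rn1 n → ℂ} (hK : Integrable K) (hf : Integrable f) :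
    Integrable (conv1 K f) :=
  (integrable_conv_integrand hK hf).integral_prod_left

lemma FT1_conv1 {n : ℕ} {K f : Rn1 n → ℂ} (hK : Integrable K) (hf : Integrable f) (q : Rn1 n) :
    FT1 (conv1 K f) q = FT1 K q * FT1 f q := by
  calc FT1 (conv1 K f) q
      = ∫ x, ∫ y, eChar (-(dotRn1 x q)) * (K (x - y) * f y) := by
        simp only [FT1_eq, conv1, integral_const_mul]
    _ = ∫ y, ∫ x, eChar (-(dotRn1 x q)) * (K (x - y) * f y) := by
        apply integral_integral_swap
        refine (integrable_conv_integrand hK hf).bdd_mul (c := 1)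
          (f := fun z : Rn1 n × Rn1 n => eChar (-(dotRn1 z.1 q))) (by fun_prop) ?_
        exact Filter.Eventually.of_forall fun x => by simp
    _ = ∫ y, FT1 K q * (eChar (-(dotRn1 y q)) * f y) := by
        refine integral_congr_ae (Filter.Eventually.of_forall fun y => ?_)
        beta_reduce
        rw [← integral_add_right_eq_self _ y, FT1_eq K, ← integral_mul_const]
        refine integral_congr_ae (Filter.Eventually.of_forall fun x => ?_)
        have : dotRn1 (x + y) q = dotRn1 x q + dotRn1 y q := by
          simp only [dotRn1, Prod.fst_add, Prod.snd_add, PiLp.add_apply, add_mul,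
            Finset.sum_add_distrib]
          ring
        simp only [this, neg_add, eChar_add, add_sub_cancel_right]
        ring
    _ = _ := by rw [integral_const_mul, FT1_eq f]

lemma integral_mul_conj_self {n : ℕ} (F : Rn1 n → ℂ) :
    ∫ x, F x * (starRingEnd ℂ) (F x) = ((∫ x, ‖F x‖ ^ 2 : ℝ) : ℂ) := by
  rw [← integral_complex_ofReal]
  simp [Complex.mul_conj, Complex.normSq_eq_norm_sq]

lemma plancherel_schwartz {n : ℕ} (f : SchwartzMap (Rn1 n) ℂ) :
    ∫ q, ‖FT1 ⇑f q‖ ^ 2 = ∫ x, ‖f x‖ ^ 2 := by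
  have h := integral_mul_conj_IFT1 f.integrable (integrable_FT1 f)
  simp only [IFT1_FT1] at h
  rw [integral_mul_conj_self, integral_mul_conj_self] at h
  exact_mod_cast h.symm

lemma eLpNorm_two_sq {n : ℕ} (F : Rn1 n → ℂ) :
    eLpNorm F 2 volume ^ 2 = ∫⁻ x, ‖F x‖ₑ ^ 2 := by
  have := eLpNorm_nnreal_pow_eq_lintegral (f := F) (μ := volume) (p := 2) (by norm_num)
  simpa using this

lemma eLpNorm_two_sq_eq_ofReal {n : ℕ} {F : Rn1 n → ℂ} (hF : Integrable fun x => ‖F x‖ ^ 2) :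
    eLpNorm F 2 volume ^ 2 = ENNReal.ofReal (∫ x, ‖F x‖ ^ 2) := by
  rw [eLpNorm_two_sq, ofReal_integral_eq_lintegral_ofReal hF
    (Filter.Eventually.of_forall fun x => by positivity)]
  refine lintegral_congr fun x => ?_
  rw [ENNReal.ofReal_pow (norm_nonneg _), ofReal_norm]

lemma integrable_norm_sq_of_bdd {n : ℕ} {F : Rn1 n → ℂ} (hF : Integrable F) {C : ℝ}
    (hC : ∀ x, ‖F x‖ ≤ C) : Integrable fun x => ‖F x‖ ^ 2 := by
  have := hF.norm.bdd_mul (f := fun x => ‖F x‖) (c := C) hF.1.norm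
    (Filter.Eventually.of_forall fun x => by simpa using hC x)
  simpa [sq] using this

lemma eLpNorm_two_conv1_schwartz_le {n : ℕ} {K : Rn1 n → ℂ} (hK : Integrable K) {A : ℝ}
    (hA0 : 0 ≤ A) (hA : ∀ q, ‖FT1 K q‖ ≤ A) (f : SchwartzMap (Rn1 n) ℂ) :
    eLpNorm (conv1 K ⇑f) 2 volume ≤ ENNReal.ofReal A * eLpNorm ⇑f 2 volume := by
  set h : Rn1 n → ℂ := fun q => FT1 K q * FT1 ⇑f q with hh
  have hKc := continuous_FT1 hK
  have hint : Integrable h := integrable_bdd_mul_FT1 hKc.aestronglyMeasurable hA f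
  have hF : conv1 K ⇑f = IFT1 h := (MOp_FT1_eq hK f).symm
  have hFi : Integrable (conv1 K ⇑f) := integrable_conv1 hK f.integrable
  have h1 := integral_mul_conj_IFT1 hFi hint
  rw [← hF] at h1
  have h2 : FT1 (conv1 K ⇑f) = h := funext fun q => FT1_conv1 hK f.integrable q
  rw [h2, integral_mul_conj_self, integral_mul_conj_self] at h1
  have h3 : ∫ x, ‖conv1 K ⇑f x‖ ^ 2 = ∫ q, ‖h q‖ ^ 2 := by exact_mod_cast h1
  have hfb : ∀ x, ‖f x‖ ≤ ∫ p, ‖FT1 ⇑f p‖ := fun x => by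
    rw [← IFT1_FT1 f x]; exact norm_IFT1_le _ _
  have hf2 := integrable_norm_sq_of_bdd f.integrable hfb
  have hFT2 := integrable_norm_sq_of_bdd (integrable_FT1 f) (norm_FT1_le ⇑f)
  have h4 : ∫ q, ‖h q‖ ^ 2 ≤ A ^ 2 * ∫ x, ‖f x‖ ^ 2 := by
    rw [← plancherel_schwartz, ← integral_const_mul]
    refine integral_mono_of_nonneg (Filter.Eventually.of_forall fun x => by positivity)
      (hFT2.const_mul _) (Filter.Eventually.of_forall fun q => ?_)
    simp only [hh, norm_mul, mul_pow]
    gcongr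
    exact hA q
  have hF2 : Integrable fun x => ‖conv1 K ⇑f x‖ ^ 2 :=
    integrable_norm_sq_of_bdd hFi (fun x => by rw [hF]; exact norm_IFT1_le _ _)
  refine (ENNReal.pow_le_pow_left_iff (n := 2) (by norm_num)).1 ?_
  rw [mul_pow, eLpNorm_two_sq_eq_ofReal hF2, eLpNorm_two_sq_eq_ofReal hf2,
    ← ENNReal.ofReal_pow hA0, ← ENNReal.ofReal_mul (by positivity), h3]
  exact ENNReal.ofReal_le_ofReal h4

lemma memLp_sub_left {n : ℕ} {K : Rn1 n → ℂ} {p : ℝ≥0∞} (hK : MemLp K p) (x : Rn1 n) :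
    MemLp (fun y => K (x - y)) p :=
  hK.comp_measurePreserving (Measure.measurePreserving_sub_left volume x)

lemma integrable_conv_memLp {n : ℕ} {K g : Rn1 n → ℂ} (hK : MemLp K 2) (hg : MemLp g 2)
    (x : Rn1 n) : Integrable fun y => K (x - y) * g y :=
  (memLp_sub_left hK x).integrable_mul hg

lemma enorm_conv1_le {n : ℕ} {K g : Rn1 n → ℂ} (hK : MemLp K 2) (hg : MemLp g 2)
    (x : Rn1 n) : ‖conv1 K g x‖ₑ ≤ eLpNorm K 2 volume * eLpNorm g 2 volume := by
  have h1 : ‖conv1 K g x‖ₑ ≤ ∫⁻ y, ‖K (x - y) * g y‖ₑ := enorm_integral_le_lintegral_enorm _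
  rw [← eLpNorm_one_eq_lintegral_enorm] at h1
  refine h1.trans ?_
  have h2 : eLpNorm (fun y => K (x - y) * g y) 1 volume ≤
      eLpNorm (fun y => K (x - y)) 2 volume * eLpNorm g 2 volume := by
    have := eLpNorm_smul_le_mul_eLpNorm (p := 2) (q := 2) (r := 1) (μ := (volume : Measure (Rn1 n)))
      hg.1 (memLp_sub_left hK x).1
    exact this
  refine h2.trans_eq ?_
  congr 1
  exact eLpNorm_comp_measurePreserving hK.1 (Measure.measurePreserving_sub_left volume x)

lemma exists_schwartz_seq {n : ℕ} {p : ℝ≥0∞} (hp : 1 ≤ p) (hp' : p ≠ ⊤) {g : Rn1 n → ℂ}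
    (hg : MemLp g p) : ∃ f : ℕ → SchwartzMap (Rn1 n) ℂ,
      Filter.Tendsto (fun j => eLpNorm (fun x => g x - f j x) p volume) Filter.atTop (nhds 0) := by
  have : Fact (1 ≤ p) := ⟨hp⟩
  have hd := SchwartzMap.denseRange_toLpCLM (E := Rn1 n) (F := ℂ) (p := p) (μ := volume) hp'
  have h : ∀ j : ℕ, ∃ f : SchwartzMap (Rn1 n) ℂ,
      eLpNorm (fun x => g x - f x) p volume ≤ ENNReal.ofReal (1 / ((j : ℝ) + 1)) := by
    intro j
    obtain ⟨f, hf⟩ := hd.exists_dist_lt (hg.toLp g) (ε := 1 / ((j : ℝ) + 1)) (by positivity)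
    refine ⟨f, ?_⟩
    have h2 : edist (hg.toLp g) ((f.memLp p volume).toLp ⇑f) ≤ ENNReal.ofReal (1 / ((j : ℝ) + 1)) := by
      rw [edist_dist]
      exact ENNReal.ofReal_le_ofReal hf.le
    rwa [Lp.edist_toLp_toLp] at h2
  choose f hf using h
  refine ⟨f, tendsto_of_tendsto_of_tendsto_of_le_of_le tendsto_const_nhds ?_ (fun _ => zero_le) hf⟩
  rw [← ENNReal.ofReal_zero]
  exact ENNReal.tendsto_ofReal tendsto_one_div_add_atTop_nhds_zero_nat

lemma conv1_sub {n : ℕ} {K g h : Rn1 n → ℂ} (hK : MemLp K 2) (hg : MemLp g 2) (hh : MemLp h 2)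
    (x : Rn1 n) : conv1 K (fun y => g y - h y) x = conv1 K g x - conv1 K h x := by
  simp only [conv1, mul_sub]
  exact integral_sub (integrable_conv_memLp hK hg x) (integrable_conv_memLp hK hh x)

lemma tendsto_of_enorm_sub {F : ℕ → ℂ} {z : ℂ}
    (h : Filter.Tendsto (fun j => ‖z - F j‖ₑ) Filter.atTop (nhds 0)) :
    Filter.Tendsto F Filter.atTop (nhds z) := by
  rw [tendsto_iff_edist_tendsto_0]
  simpa [edist_eq_enorm_sub, enorm_sub_rev] using h

/-- `L²` bound for convolution with an integrable, square-integrable kernel. -/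
theorem eLpNorm_two_conv1_le {n : ℕ} {K : Rn1 n → ℂ} (hK : Integrable K) (hK2 : MemLp K 2) {A : ℝ}
    (hA0 : 0 ≤ A) (hA : ∀ q, ‖FT1 K q‖ ≤ A) {g : Rn1 n → ℂ} (hg : MemLp g 2) :
    eLpNorm (conv1 K g) 2 volume ≤ ENNReal.ofReal A * eLpNorm g 2 volume := by
  obtain ⟨f, hf⟩ := exists_schwartz_seq (by norm_num) (by norm_num) hg
  have hpt : ∀ x, Filter.Tendsto (fun j => conv1 K (f j) x) Filter.atTop (nhds (conv1 K g x)) := by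
    intro x
    refine tendsto_of_enorm_sub ?_
    have h2 : Filter.Tendsto (fun j => eLpNorm K 2 volume * eLpNorm (fun x => g x - f j x) 2 volume)
        Filter.atTop (nhds 0) := by
      simpa using ENNReal.Tendsto.const_mul hf (Or.inr hK2.2.ne)
    refine tendsto_of_tendsto_of_tendsto_of_le_of_le tendsto_const_nhds h2 (fun _ => zero_le) ?_
    intro j
    beta_reduce
    rw [← conv1_sub hK2 hg ((f j).memLp 2 volume)]
    exact enorm_conv1_le hK2 (hg.sub ((f j).memLp 2 volume)) x
  have h1 := Lp.eLpNorm_lim_le_liminf_eLpNorm (p := 2) (μ := volume)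
    (f := fun j => conv1 K (f j)) (fun j => (integrable_conv1 hK (f j).integrable).1)
    (conv1 K g) (Filter.Eventually.of_forall hpt)
  refine h1.trans ?_
  have h3 : ∀ j, eLpNorm (conv1 K (f j)) 2 volume ≤ ENNReal.ofReal A *
      (eLpNorm g 2 volume + eLpNorm (fun x => g x - f j x) 2 volume) := by
    intro j
    refine (eLpNorm_two_conv1_schwartz_le hK hA0 hA (f j)).trans ?_
    gcongr
    have : ⇑(f j) = g - (fun x => g x - f j x) := by ext x; simp
    calc eLpNorm ⇑(f j) 2 volume = eLpNorm (g - (fun x => g x - f j x)) 2 volume := by rw [← this]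
      _ ≤ _ := eLpNorm_sub_le hg.1 (hg.sub ((f j).memLp 2 volume)).1 (by norm_num)
  have h4 : Filter.Tendsto (fun j => ENNReal.ofReal A *
      (eLpNorm g 2 volume + eLpNorm (fun x => g x - f j x) 2 volume)) Filter.atTop
      (nhds (ENNReal.ofReal A * (eLpNorm g 2 volume + 0))) :=
    ENNReal.Tendsto.const_mul (tendsto_const_nhds.add hf) (Or.inr ENNReal.ofReal_ne_top)
  rw [add_zero] at h4
  rw [← h4.liminf_eq]
  exact Filter.liminf_le_liminf (Filter.Eventually.of_forall h3)

/-- Index of the parabolic dyadic cell of generation `j` containing `z`. -/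
def parabolicIndex {n : ℕ} (j : ℤ) (z : Rn1 n) : (Fin n → ℤ) × ℤ :=
  (fun k => ⌊z.1 k / 2 ^ j⌋, ⌊z.2 / 4 ^ j⌋)

/-- Volume of a parabolic dyadic cell of generation `j`. -/
def cellVol (n : ℕ) (j : ℤ) : ℝ≥0∞ := ENNReal.ofReal (2 ^ j) ^ n * ENNReal.ofReal (4 ^ j)

/-- An enlargement of the parabolic dyadic cell of generation `j` containing `x`. -/
def cellStar {n : ℕ} (j : ℤ) (x : Rn1 n) : Set (Rn1 n) :=
  {z | ‖z.1 - x.1‖ ≤ 2 * ((n + 1) * 2 ^ j) ∧ |z.2 - x.2| ≤ 2 * ((n + 1) * 2 ^ j) ^ 2}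

lemma measurable_parabolicIndex {n : ℕ} (j : ℤ) : Measurable (parabolicIndex (n := n) j) := by
  unfold parabolicIndex
  refine Measurable.prodMk ?_ ?_
  · refine measurable_pi_lambda _ fun k => Int.measurable_floor.comp ?_
    fun_prop
  · exact Int.measurable_floor.comp (by fun_prop)

lemma measurableSet_cell {n : ℕ} (j : ℤ) (i : (Fin n → ℤ) × ℤ) :
    MeasurableSet (parabolicIndex (n := n) j ⁻¹' {i}) :=
  measurable_parabolicIndex j (measurableSet_singleton i)

lemma parabolicIndex_succ {n : ℕ} {j : ℤ} {x y : Rn1 n}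
    (h : parabolicIndex j x = parabolicIndex j y) :
    parabolicIndex (j + 1) x = parabolicIndex (j + 1) y := by
  simp only [parabolicIndex, Prod.mk.injEq, funext_iff] at h ⊢
  have h2 : ∀ a : ℝ, ⌊a / 2 ^ (j + 1)⌋ = ⌊a / 2 ^ j⌋ / 2 := fun a => by
    rw [zpow_add₀ (by norm_num), zpow_one, ← div_div]
    exact Int.floor_div_natCast (a / 2 ^ j) 2
  have h4 : ∀ a : ℝ, ⌊a / 4 ^ (j + 1)⌋ = ⌊a / 4 ^ j⌋ / 4 := fun a => by
    rw [zpow_add₀ (by norm_num), zpow_one, ← div_div]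
    exact Int.floor_div_natCast (a / 4 ^ j) 4
  exact ⟨fun k => by rw [h2, h2, h.1 k], by rw [h4, h4, h.2]⟩

lemma parabolicIndex_mono {n : ℕ} {i j : ℤ} (hij : i ≤ j) {x y : Rn1 n}
    (h : parabolicIndex i x = parabolicIndex i y) : parabolicIndex j x = parabolicIndex j y := by
  induction j, hij using Int.leInduction with
  | base => exact h
  | succ k _ ih => exact parabolicIndex_succ ih

lemma floor_div_eq_iff {a c : ℝ} (hc : 0 < c) (m : ℤ) :
    ⌊a / c⌋ = m ↔ a ∈ Set.Ico (m * c) ((m + 1) * c) := by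
  rw [Int.floor_eq_iff, le_div_iff₀ hc, div_lt_iff₀ hc, Set.mem_Ico]

lemma volume_cell {n : ℕ} (j : ℤ) (i : (Fin n → ℤ) × ℤ) :
    volume (parabolicIndex (n := n) j ⁻¹' {i}) = cellVol n j := by
  have hS : parabolicIndex (n := n) j ⁻¹' {i} =
      (WithLp.ofLp ⁻¹' (Set.univ.pi fun k => Set.Ico (i.1 k * 2 ^ j : ℝ) ((i.1 k + 1) * 2 ^ j))) ×ˢ
        Set.Ico (i.2 * 4 ^ j : ℝ) ((i.2 + 1) * 4 ^ j) := by
    ext z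
    simp only [parabolicIndex, Set.mem_preimage, Set.mem_singleton_iff, Prod.ext_iff, funext_iff,
      Set.mem_prod, Set.mem_pi, Set.mem_univ, true_imp_iff]
    rw [floor_div_eq_iff (by positivity)]
    simp only [floor_div_eq_iff (show (0 : ℝ) < 2 ^ j by positivity)]
  rw [hS, Measure.volume_eq_prod, Measure.prod_prod,
    (PiLp.volume_preserving_ofLp (Fin n)).measure_preimage
      (MeasurableSet.univ_pi fun k => measurableSet_Ico).nullMeasurableSet, volume_pi_pi]
  simp only [Real.volume_Ico, cellVol]
  congr 1
  · rw [Finset.prod_congr rfl (g := fun _ => ENNReal.ofReal (2 ^ j))]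
    · simp
    · intro k _; congr 1; ring
  · congr 1; ring

lemma cellVol_succ (n : ℕ) (j : ℤ) : cellVol n (j + 1) = (2 ^ n * 4) * cellVol n j := by
  rw [cellVol, cellVol, zpow_add₀ (by norm_num), zpow_add₀ (by norm_num), zpow_one, zpow_one,
    ENNReal.ofReal_mul (by positivity), ENNReal.ofReal_mul (by positivity), mul_pow]
  simp only [ENNReal.ofReal_ofNat]
  ring

lemma cellVol_ne_zero (n : ℕ) (j : ℤ) : cellVol n j ≠ 0 := by
  have h1 : (0 : ℝ) < 2 ^ j := by positivity
  have h2 : (0 : ℝ) < 4 ^ j := by positivity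
  simp [cellVol, h1, h2]

lemma cellVol_ne_top (n : ℕ) (j : ℤ) : cellVol n j ≠ ⊤ := by
  simp [cellVol, ENNReal.mul_eq_top]

lemma exists_lt_cellVol (n : ℕ) {c : ℝ≥0∞} (hc : c ≠ ⊤) : ∃ N : ℤ, ∀ j ≥ N, c < cellVol n j := by
  obtain ⟨m, hm⟩ := pow_unbounded_of_one_lt c.toReal (show (1 : ℝ) < 4 by norm_num)
  refine ⟨m, fun j hj => ?_⟩
  have hj0 : 0 ≤ j := le_trans (by positivity) hj
  calc c < ENNReal.ofReal (4 ^ m) := (ENNReal.lt_ofReal_iff_toReal_lt hc).2 hm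
    _ ≤ ENNReal.ofReal (4 ^ j) := by
        apply ENNReal.ofReal_le_ofReal
        rw [← zpow_natCast]
        exact zpow_le_zpow_right₀ (by norm_num) hj
    _ ≤ cellVol n j := by
        rw [cellVol]
        refine le_mul_of_one_le_left (zero_le) (one_le_pow₀ ?_)
        rw [← ENNReal.ofReal_one]
        exact ENNReal.ofReal_le_ofReal (one_le_zpow₀ (by norm_num) hj0)

lemma abs_sub_le_of_floor_eq {a b c : ℝ} (hc : 0 < c) (h : ⌊a / c⌋ = ⌊b / c⌋) : |a - b| ≤ c := by
  have h1 := Int.abs_sub_lt_one_of_floor_eq_floor h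
  rw [← sub_div, abs_div, abs_of_pos hc, div_lt_one hc] at h1
  exact h1.le

lemma norm_le_of_coord_le {n : ℕ} {w : Rn n} {r : ℝ} (hr : 0 ≤ r) (h : ∀ k, |w k| ≤ r) :
    ‖w‖ ≤ (n + 1) * r := by
  rw [EuclideanSpace.norm_eq]
  refine Real.sqrt_le_iff.2 ⟨by positivity, ?_⟩
  calc ∑ k, ‖w k‖ ^ 2 ≤ ∑ _k : Fin n, r ^ 2 :=
        Finset.sum_le_sum fun k _ => by rw [Real.norm_eq_abs]; gcongr; exact h k
    _ = n * r ^ 2 := by simp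
    _ ≤ ((n + 1) * r) ^ 2 := by
        rw [mul_pow]; gcongr; nlinarith [(Nat.cast_nonneg n : (0 : ℝ) ≤ n)]

lemma cell_subset {n : ℕ} {j : ℤ} {x y : Rn1 n} (h : parabolicIndex j y = parabolicIndex j x) :
    ‖(y - x).1‖ ≤ (n + 1) * 2 ^ j ∧ |(y - x).2| ≤ ((n + 1) * 2 ^ j) ^ 2 := by
  simp only [parabolicIndex, Prod.mk.injEq, funext_iff] at h
  refine ⟨norm_le_of_coord_le (by positivity) fun k => ?_, ?_⟩
  · exact abs_sub_le_of_floor_eq (by positivity) (h.1 k)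
  · refine (abs_sub_le_of_floor_eq (by positivity) h.2).trans ?_
    rw [mul_pow, ← zpow_natCast, ← zpow_natCast, ← zpow_mul, mul_comm j, zpow_mul]
    norm_num
    refine le_mul_of_one_le_left (by positivity) (one_le_pow₀ ?_)
    linarith [(Nat.cast_nonneg n : (0 : ℝ) ≤ n)]

lemma exists_cell_subset {n : ℕ} (x : Rn1 n) {U : Set (Rn1 n)} (hU : U ∈ nhds x) :
    ∃ j : ℤ, ∀ y, parabolicIndex j y = parabolicIndex j x → y ∈ U := by
  obtain ⟨ε, hε, hεU⟩ := Metric.mem_nhds_iff.1 hU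
  set a : ℝ := n + 1 with ha
  have ha0 : 0 < a := by positivity
  obtain ⟨m, hm⟩ := exists_pow_lt_of_lt_one (show 0 < min (min ε 1 / a) 1 by positivity)
    (show (1 / 2 : ℝ) < 1 by norm_num)
  refine ⟨-(m : ℤ), fun y hy => hεU ?_⟩
  obtain ⟨h1, h2⟩ := cell_subset hy
  have h3 : a * 2 ^ (-(m : ℤ)) < min ε 1 := by
    have : (2 : ℝ) ^ (-(m : ℤ)) = (1 / 2) ^ m := by simp
    rw [this]
    have := hm.trans_le (min_le_left _ _)
    rw [lt_div_iff₀ ha0] at this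
    linarith
  have h4 : 0 < a * 2 ^ (-(m : ℤ)) := by positivity
  rw [Metric.mem_ball, dist_eq_norm, Prod.norm_def]
  refine max_lt (h1.trans_lt (h3.trans_le (min_le_left _ _))) ?_
  rw [Real.norm_eq_abs]
  refine h2.trans_lt ?_
  have h5 := h3.trans_le (min_le_left _ _)
  have h6 := h3.trans_le (min_le_right _ _)
  nlinarith

lemma measurableSet_cellStar {n : ℕ} (j : ℤ) (x : Rn1 n) : MeasurableSet (cellStar j x) := by
  have h1 : Continuous fun z : Rn1 n => ‖z.1 - x.1‖ := by fun_prop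
  have h2 : Continuous fun z : Rn1 n => |z.2 - x.2| := by fun_prop
  exact ((isClosed_le h1 continuous_const).inter (isClosed_le h2 continuous_const)).measurableSet

lemma exists_volume_cellStar_le (n : ℕ) : ∃ D : ℝ≥0∞, D ≠ ⊤ ∧
    ∀ (j : ℤ) (x : Rn1 n), volume (cellStar j x) ≤ D * cellVol n j := by
  refine ⟨ENNReal.ofReal (2 * (n + 1)) ^ n * volume (Metric.ball (0 : Rn n) 1) *
    ENNReal.ofReal (4 * (n + 1) ^ 2), ?_, fun j x => ?_⟩
  · refine ENNReal.mul_ne_top (ENNReal.mul_ne_top (ENNReal.pow_ne_top ENNReal.ofReal_ne_top)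
      measure_ball_lt_top.ne) ENNReal.ofReal_ne_top
  · have hS : cellStar j x = Metric.closedBall x.1 (2 * ((n + 1) * 2 ^ j)) ×ˢ
        Metric.closedBall x.2 (2 * ((n + 1) * 2 ^ j) ^ 2) := by
      ext z
      simp [cellStar, dist_eq_norm]
    rw [hS, Measure.volume_eq_prod, Measure.prod_prod, Measure.addHaar_closedBall _ _ (by positivity),
      Real.volume_closedBall, finrank_euclideanSpace_fin, cellVol,
      ENNReal.ofReal_pow (by positivity)]
    have e1 : ENNReal.ofReal (2 * ((n + 1) * 2 ^ j)) =
        ENNReal.ofReal (2 * (n + 1)) * ENNReal.ofReal (2 ^ j) := by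
      rw [← ENNReal.ofReal_mul (by positivity)]; congr 1; ring
    have e2 : ENNReal.ofReal (2 * (2 * ((n + 1) * 2 ^ j) ^ 2)) =
        ENNReal.ofReal (4 * (n + 1) ^ 2) * ENNReal.ofReal (4 ^ j) := by
      rw [← ENNReal.ofReal_mul (by positivity)]; congr 1
      rw [mul_pow, ← zpow_natCast ((2 : ℝ) ^ j), ← zpow_mul, mul_comm j, zpow_mul]
      norm_num
      ring
    rw [e1, e2, mul_pow]
    apply le_of_eq
    ring

lemma exists_dyadic_maximal_cells {n : ℕ} {f : Rn1 n → ℂ} (hfc : Continuous f) (hf : Integrable f)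
    {l : ℝ≥0∞} (hl0 : l ≠ 0) (hl : l ≠ ⊤) :
    ∃ S : ℤ × ((Fin n → ℤ) × ℤ) → Set (Rn1 n),
      (∀ q, S q = ∅ ∨ ∃ x, S q = parabolicIndex q.1 ⁻¹' {parabolicIndex q.1 x}) ∧
      Pairwise (Function.onFun Disjoint S) ∧
      (∀ q, l * volume (S q) ≤ ∫⁻ y in S q, ‖f y‖ₑ) ∧
      (∀ q, ∫⁻ y in S q, ‖f y‖ₑ ≤ 2 ^ n * 4 * l * volume (S q)) ∧
      ∀ z ∉ ⋃ q, S q, ‖f z‖ₑ ≤ l := by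
  classical
  set Big : ℤ → Rn1 n → Prop := fun j z =>
    l * cellVol n j < ∫⁻ y in parabolicIndex j ⁻¹' {parabolicIndex j z}, ‖f y‖ₑ with hBig
  have hBigc : ∀ j x y, parabolicIndex j x = parabolicIndex j y → (Big j x ↔ Big j y) := by
    intro j x y h; simp only [hBig, h]
  set Mx : ℤ → Rn1 n → Prop := fun j z => Big j z ∧ ∀ j' > j, ¬ Big j' z with hMx
  have hMxc : ∀ j x y, parabolicIndex j x = parabolicIndex j y → Mx j x → Mx j y := by
    intro j x y h hx
    refine ⟨(hBigc j x y h).1 hx.1, fun j' hj' hb => hx.2 j' hj' ?_⟩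
    exact (hBigc j' x y (parabolicIndex_mono (le_of_lt hj') h)).2 hb
  set S : ℤ × ((Fin n → ℤ) × ℤ) → Set (Rn1 n) :=
    fun q => {z | parabolicIndex q.1 z = q.2 ∧ Mx q.1 z} with hS
  have hSx : ∀ q, ∀ x ∈ S q, S q = parabolicIndex q.1 ⁻¹' {parabolicIndex q.1 x} := by
    rintro q x ⟨hx1, hx2⟩
    ext z
    simp only [hS, Set.mem_ofPred_eq, Set.mem_preimage, Set.mem_singleton_iff, hx1]
    exact ⟨fun h => h.1, fun h => ⟨h, hMxc q.1 x z (by rw [h, hx1]) hx2⟩⟩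
  refine ⟨S, fun q => ?_, ?_, fun q => ?_, fun q => ?_, fun z hz => ?_⟩
  · rcases (S q).eq_empty_or_nonempty with h | ⟨x, hx⟩
    · exact Or.inl h
    · exact Or.inr ⟨x, hSx q x hx⟩
  · intro q q' hqq
    refine Set.disjoint_left.2 fun z hz hz' => hqq ?_
    have : q.1 = q'.1 := by
      rcases lt_trichotomy q.1 q'.1 with h | h | h
      · exact absurd hz'.2.1 (hz.2.2 _ h)
      · exact h
      · exact absurd hz.2.1 (hz'.2.2 _ h)
    exact Prod.ext this (by rw [← hz.1, ← hz'.1, this])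
  · rcases (S q).eq_empty_or_nonempty with h | ⟨x, hx⟩
    · simp [h]
    · rw [hSx q x hx, volume_cell]
      exact hx.2.1.le
  · rcases (S q).eq_empty_or_nonempty with h | ⟨x, hx⟩
    · simp [h]
    · rw [hSx q x hx, volume_cell]
      have h1 := not_lt.1 (hx.2.2 (q.1 + 1) (by simp))
      rw [cellVol_succ] at h1
      refine (lintegral_mono_set fun y hy => ?_).trans (h1.trans (le_of_eq (by ring)))
      exact parabolicIndex_succ hy
  · by_contra! hlt
    obtain ⟨l', hl1, hl2⟩ := exists_between hlt
    have hU : {y | l' < ‖f y‖ₑ} ∈ nhds z :=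
      (isOpen_lt continuous_const hfc.enorm).mem_nhds hl2
    obtain ⟨j, hj⟩ := exists_cell_subset z hU
    have hBj : Big j z := by
      calc l * cellVol n j < l' * cellVol n j :=
            (ENNReal.mul_lt_mul_iff_left (cellVol_ne_zero n j) (cellVol_ne_top n j)).2 hl1
        _ = ∫⁻ _y in parabolicIndex j ⁻¹' {parabolicIndex j z}, l' := by
            rw [setLIntegral_const, volume_cell]
        _ ≤ _ := setLIntegral_mono' (measurableSet_cell j _) fun y hy => (hj y hy).le
    have hfin : (∫⁻ y, ‖f y‖ₑ) / l ≠ ⊤ := ENNReal.div_ne_top hf.2.ne hl0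
    obtain ⟨N, hN⟩ := exists_lt_cellVol n hfin
    have hbdd : ∀ j, Big j z → j ≤ N := by
      intro j hb
      by_contra! hjN
      have h1 := hN j hjN.le
      rw [ENNReal.div_lt_iff (Or.inl hl0) (Or.inl hl), mul_comm] at h1
      exact absurd (hb.trans_le (setLIntegral_le_lintegral _ _)) (not_lt.2 h1.le)
    obtain ⟨m, hm1, hm2⟩ := Int.exists_greatest_of_bdd ⟨N, hbdd⟩ ⟨j, hBj⟩
    refine hz (Set.mem_iUnion.2 ⟨(m, parabolicIndex m z), rfl, hm1, fun j' hj' hb => ?_⟩)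
    exact absurd (hm2 j' hb) (not_le.2 hj')

lemma norm_setAverage_mul_le {α : Type*} [MeasurableSpace α] {μ : Measure α} {s : Set α} {f : α → ℂ}
    (hs : μ s ≠ ⊤) : ‖(⨍ y in s, f y ∂μ)‖ₑ * μ s ≤ ∫⁻ y in s, ‖f y‖ₑ ∂μ := by
  rw [setAverage_eq, enorm_smul]
  by_cases h0 : μ s = 0
  · simp [h0]
  have h1 : ‖(μ.real s)⁻¹‖ₑ = (μ s)⁻¹ := by
    rw [Real.enorm_eq_ofReal (by positivity), ENNReal.ofReal_inv_of_pos, ofReal_measureReal hs]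
    exact ENNReal.toReal_pos h0 hs
  rw [h1, mul_comm, ← mul_assoc, ENNReal.mul_inv_cancel h0 hs, one_mul]
  exact enorm_integral_le_lintegral_enorm _

/-- The Calderón–Zygmund decomposition `f = g + b` at height `l`: the good part is `g`. -/
lemma exists_calderonZygmund {n : ℕ} {f : Rn1 n → ℂ} (hfc : Continuous f) (hf : Integrable f)
    {l : ℝ≥0∞} (hl0 : l ≠ 0) (hl : l ≠ ⊤) :
    ∃ (S : ℤ × ((Fin n → ℤ) × ℤ) → Set (Rn1 n)) (g : Rn1 n → ℂ),
      (∀ q, S q = ∅ ∨ ∃ x, S q = parabolicIndex q.1 ⁻¹' {parabolicIndex q.1 x}) ∧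
      (∀ q, MeasurableSet (S q)) ∧
      Pairwise (Function.onFun Disjoint S) ∧
      (∀ q, l * volume (S q) ≤ ∫⁻ y in S q, ‖f y‖ₑ) ∧
      Measurable g ∧ (∀ z ∉ ⋃ q, S q, g z = f z ∧ ‖f z‖ₑ ≤ l) ∧
      (∀ z, ‖g z‖ₑ ≤ 2 ^ n * 4 * l) ∧
      (∀ q, ∫ y in S q, (f y - g y) = 0) ∧
      (∀ q, ∫⁻ y in S q, ‖f y - g y‖ₑ ≤ 2 * ∫⁻ y in S q, ‖f y‖ₑ) ∧
      (∀ q, ∫⁻ y in S q, ‖g y‖ₑ ≤ ∫⁻ y in S q, ‖f y‖ₑ) := by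
  classical
  obtain ⟨S, hS1, hS2, hS3, hS4, hS5⟩ := exists_dyadic_maximal_cells hfc hf hl0 hl
  have hSm : ∀ q, MeasurableSet (S q) := fun q => by
    rcases hS1 q with h | ⟨x, h⟩
    · rw [h]; exact MeasurableSet.empty
    · rw [h]; exact measurableSet_cell _ _
  have hSfin : ∀ q, volume (S q) ≠ ⊤ := fun q => by
    rcases hS1 q with h | ⟨x, h⟩
    · simp [h]
    · rw [h, volume_cell]; exact cellVol_ne_top _ _
  obtain ⟨g, hgm, hg⟩ := exists_measurable_piecewise
    (ι := Option (ℤ × ((Fin n → ℤ) × ℤ)))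
    (fun o => o.elim (⋃ q, S q)ᶜ S)
    (by rintro (_ | q); exacts [(MeasurableSet.iUnion hSm).compl, hSm q])
    (fun o => o.elim f fun q _ => ⨍ y in S q, f y)
    (by rintro (_ | q); exacts [hfc.measurable, measurable_const])
    (by
      rintro (_ | q) (_ | q') hqq z ⟨hz, hz'⟩
      · rfl
      · exact absurd (Set.mem_iUnion.2 ⟨q', hz'⟩) hz
      · exact absurd (Set.mem_iUnion.2 ⟨q, hz⟩) hz'
      · exact absurd hz' (Set.disjoint_left.1 (hS2 fun h => hqq (by rw [h])) hz))
  have hgS : ∀ q, ∀ z ∈ S q, g z = ⨍ y in S q, f y := fun q z hz => hg (some q) hz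
  have hgo : ∀ z ∉ ⋃ q, S q, g z = f z := fun z hz => hg none hz
  have hgint : ∀ q, ∫⁻ y in S q, ‖g y‖ₑ ≤ ∫⁻ y in S q, ‖f y‖ₑ := fun q => by
    rw [setLIntegral_congr_fun (hSm q) (fun z hz => by rw [hgS q z hz]), setLIntegral_const]
    exact norm_setAverage_mul_le (hSfin q)
  refine ⟨S, g, hS1, hSm, hS2, hS3, hgm, fun z hz => ⟨hgo z hz, hS5 z hz⟩, fun z => ?_, fun q => ?_,
    fun q => ?_, hgint⟩
  · by_cases hz : z ∈ ⋃ q, S q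
    · obtain ⟨q, hq⟩ := Set.mem_iUnion.1 hz
      rw [hgS q z hq]
      have h0 : volume (S q) ≠ 0 := by
        rcases hS1 q with h | ⟨x, h⟩
        · simp [h] at hq
        · rw [h, volume_cell]; exact cellVol_ne_zero _ _
      exact (ENNReal.mul_le_mul_iff_left h0 (hSfin q)).1
        ((norm_setAverage_mul_le (hSfin q)).trans (hS4 q))
    · rw [hgo z hz]
      refine (hS5 z hz).trans (le_mul_of_one_le_left zero_le ?_)
      calc (1 : ℝ≥0∞) = 1 ^ n * 1 := by simp
        _ ≤ 2 ^ n * 4 := by gcongr <;> norm_num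
  · rw [setIntegral_congr_fun (hSm q) (g := fun y => f y - ⨍ y in S q, f y)
      (fun z hz => by simp only [hgS q z hz])]
    exact setAverage_sub_setAverage (hSfin q) f
  · calc ∫⁻ y in S q, ‖f y - g y‖ₑ ≤ ∫⁻ y in S q, (‖f y‖ₑ + ‖g y‖ₑ) :=
          lintegral_mono fun y => enorm_sub_le
      _ = (∫⁻ y in S q, ‖f y‖ₑ) + ∫⁻ y in S q, ‖g y‖ₑ :=
          lintegral_add_left hfc.enorm.measurable _
      _ ≤ 2 * ∫⁻ y in S q, ‖f y‖ₑ := by rw [two_mul]; exact add_le_add le_rfl (hgint q)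

/-- Hörmander's integral regularity condition for the parabolic scaling. -/
def HormanderBound {n : ℕ} (K : Rn1 n → ℂ) (B : ℝ≥0∞) : Prop :=
  ∀ R > 0, ∀ w : Rn1 n, ‖w.1‖ ≤ R → |w.2| ≤ R ^ 2 →
    ∫⁻ z in {z : Rn1 n | ‖z.1‖ ≤ 2 * R ∧ |z.2| ≤ 2 * R ^ 2}ᶜ, ‖K (z - w) - K z‖ₑ ≤ B

lemma HormanderBound.lintegral_cellStar_compl_le {n : ℕ} {K : Rn1 n → ℂ} {B : ℝ≥0∞}
    (hB : HormanderBound K B) {j : ℤ} {c y : Rn1 n} (hy : parabolicIndex j y = parabolicIndex j c) :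
    ∫⁻ x in (cellStar j c)ᶜ, ‖K (x - y) - K (x - c)‖ₑ ≤ B := by
  obtain ⟨h1, h2⟩ := cell_subset hy
  have h := hB ((n + 1) * 2 ^ j) (by positivity) (y - c) h1 h2
  refine le_trans (le_of_eq ?_) h
  have hm := measurePreserving_sub_right (volume : Measure (Rn1 n)) c
  have he := (Homeomorph.subRight c).measurableEmbedding
  have := hm.setLIntegral_comp_preimage_emb he (fun z => ‖K (z - (y - c)) - K z‖ₑ)
    {z : Rn1 n | ‖z.1‖ ≤ 2 * ((n + 1) * 2 ^ j) ∧ |z.2| ≤ 2 * ((n + 1) * 2 ^ j) ^ 2}ᶜ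
  rw [← this]
  simp only [sub_sub_sub_cancel_right]
  rfl

lemma HormanderBound.lintegral_cell_le {n : ℕ} {K b : Rn1 n → ℂ} {B : ℝ≥0∞}
    (hB : HormanderBound K B) (hK : Measurable K) (hb : Measurable b) (hbi : Integrable b)
    (hKb : ∀ x, Integrable fun y => K (x - y) * b y) (j : ℤ) (c : Rn1 n)
    (h0 : ∫ y in parabolicIndex j ⁻¹' {parabolicIndex j c}, b y = 0) :
    ∫⁻ x in (cellStar j c)ᶜ, ‖∫ y in parabolicIndex j ⁻¹' {parabolicIndex j c}, K (x - y) * b y‖ₑ ≤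
      B * ∫⁻ y in parabolicIndex j ⁻¹' {parabolicIndex j c}, ‖b y‖ₑ := by
  set S := parabolicIndex (n := n) j ⁻¹' {parabolicIndex j c} with hS
  have hSm : MeasurableSet S := measurableSet_cell j _
  have h1 : ∀ x, ‖∫ y in S, K (x - y) * b y‖ₑ ≤
      ∫⁻ y in S, ‖K (x - y) - K (x - c)‖ₑ * ‖b y‖ₑ := fun x => by
    have : ∫ y in S, K (x - y) * b y = ∫ y in S, (K (x - y) - K (x - c)) * b y := by
      simp only [sub_mul]
      rw [integral_sub (hKb x).integrableOn (hbi.integrableOn.const_mul _), integral_const_mul, h0,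
        mul_zero, sub_zero]
    rw [this]
    refine (enorm_integral_le_lintegral_enorm _).trans (le_of_eq ?_)
    simp only [enorm_mul]
  calc ∫⁻ x in (cellStar j c)ᶜ, ‖∫ y in S, K (x - y) * b y‖ₑ
      ≤ ∫⁻ x in (cellStar j c)ᶜ, ∫⁻ y in S, ‖K (x - y) - K (x - c)‖ₑ * ‖b y‖ₑ :=
        lintegral_mono h1
    _ = ∫⁻ y in S, ∫⁻ x in (cellStar j c)ᶜ, ‖K (x - y) - K (x - c)‖ₑ * ‖b y‖ₑ := by
        refine lintegral_lintegral_swap (Measurable.aemeasurable ?_)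
        simp only [Function.uncurry_def]
        fun_prop
    _ = ∫⁻ y in S, (∫⁻ x in (cellStar j c)ᶜ, ‖K (x - y) - K (x - c)‖ₑ) * ‖b y‖ₑ := by
        refine lintegral_congr fun y => ?_
        rw [lintegral_mul_const]
        fun_prop
    _ ≤ ∫⁻ y in S, B * ‖b y‖ₑ :=
        setLIntegral_mono' hSm fun y hy =>
          mul_le_mul_left (hB.lintegral_cellStar_compl_le (by simpa [hS] using hy)) _
    _ = B * ∫⁻ y in S, ‖b y‖ₑ := lintegral_const_mul _ (by fun_prop)

/-- Estimate of the bad part away from the enlarged cells. -/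
lemma HormanderBound.exists_lintegral_bad_le {n : ℕ} {K b : Rn1 n → ℂ} {B : ℝ≥0∞}
    (hB : HormanderBound K B) (hK : Measurable K) (hb : Measurable b) (hbi : Integrable b)
    (hKb : ∀ x, Integrable fun y => K (x - y) * b y) {D : ℝ≥0∞}
    (hD : ∀ (j : ℤ) (x : Rn1 n), volume (cellStar j x) ≤ D * cellVol n j)
    {S : ℤ × ((Fin n → ℤ) × ℤ) → Set (Rn1 n)}
    (hS : ∀ q, S q = ∅ ∨ ∃ x, S q = parabolicIndex q.1 ⁻¹' {parabolicIndex q.1 x})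
    (hSm : ∀ q, MeasurableSet (S q))
    (hSd : Pairwise (Function.onFun Disjoint S)) (h0 : ∀ q, ∫ y in S q, b y = 0)
    (hoff : ∀ z ∉ ⋃ q, S q, b z = 0) :
    ∃ E : Set (Rn1 n), MeasurableSet E ∧ volume E ≤ D * volume (⋃ q, S q) ∧
      ∫⁻ x in Eᶜ, ‖conv1 K b x‖ₑ ≤ B * ∫⁻ y in ⋃ q, S q, ‖b y‖ₑ := by
  have hex : ∀ q, ∃ E : Set (Rn1 n), MeasurableSet E ∧ volume E ≤ D * volume (S q) ∧
      ∫⁻ x in Eᶜ, ‖∫ y in S q, K (x - y) * b y‖ₑ ≤ B * ∫⁻ y in S q, ‖b y‖ₑ := fun q => by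
    rcases hS q with h | ⟨c, h⟩
    · exact ⟨∅, MeasurableSet.empty, by simp, by simp [h]⟩
    · refine ⟨cellStar q.1 c, measurableSet_cellStar _ _, ?_, ?_⟩
      · rw [h, volume_cell]; exact hD _ _
      · rw [h]
        exact hB.lintegral_cell_le hK hb hbi hKb q.1 c (by rw [← h]; exact h0 q)
  choose E hE1 hE2 hE3 using hex
  refine ⟨⋃ q, E q, MeasurableSet.iUnion hE1, ?_, ?_⟩
  · calc volume (⋃ q, E q) ≤ ∑' q, volume (E q) := measure_iUnion_le _
      _ ≤ ∑' q, D * volume (S q) := ENNReal.tsum_le_tsum hE2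
      _ = D * volume (⋃ q, S q) := by rw [ENNReal.tsum_mul_left, measure_iUnion hSd hSm]
  · have hpt : ∀ x, ‖conv1 K b x‖ₑ ≤ ∑' q, ‖∫ y in S q, K (x - y) * b y‖ₑ := fun x => by
      have : conv1 K b x = ∑' q, ∫ y in S q, K (x - y) * b y := by
        rw [← integral_iUnion hSm hSd (hKb x).integrableOn]
        exact (setIntegral_eq_integral_of_forall_compl_eq_zero fun z hz => by
          rw [hoff z hz, mul_zero]).symm
      rw [this]
      exact enorm_tsum_le_tsum_enorm
    calc ∫⁻ x in (⋃ q, E q)ᶜ, ‖conv1 K b x‖ₑ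
        ≤ ∫⁻ x in (⋃ q, E q)ᶜ, ∑' q, ‖∫ y in S q, K (x - y) * b y‖ₑ := lintegral_mono hpt
      _ = ∑' q, ∫⁻ x in (⋃ q, E q)ᶜ, ‖∫ y in S q, K (x - y) * b y‖ₑ := by
          refine lintegral_tsum fun q => ?_
          have : StronglyMeasurable fun x => ∫ y in S q, K (x - y) * b y := by
            apply StronglyMeasurable.integral_prod_right
            apply Measurable.stronglyMeasurable
            simp only [Function.uncurry_def]
            fun_prop
          exact this.enorm.aemeasurable
      _ ≤ ∑' q, B * ∫⁻ y in S q, ‖b y‖ₑ := ENNReal.tsum_le_tsum fun q =>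
          (lintegral_mono_set (Set.compl_subset_compl.2 (Set.subset_iUnion E q))).trans (hE3 q)
      _ = B * ∫⁻ y in ⋃ q, S q, ‖b y‖ₑ := by
          rw [ENNReal.tsum_mul_left, lintegral_iUnion hSm hSd]

/-- The Calderón–Zygmund distributional estimate, keeping track of the part of `f` responsible for
each term. -/
theorem exists_meas_conv1_le (n : ℕ) {A : ℝ} (hA : 0 ≤ A) {B : ℝ≥0∞} (hB : B ≠ ⊤) :
    ∃ C : ℝ≥0∞, C ≠ ⊤ ∧ ∀ K : Rn1 n → ℂ, Measurable K → Integrable K → MemLp K 2 →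
      (∀ q, ‖FT1 K q‖ ≤ A) → HormanderBound K B →
      ∀ f : Rn1 n → ℂ, Continuous f → Integrable f → MemLp f 2 →
      ∀ l : ℝ≥0∞, l ≠ 0 → l ≠ ⊤ →
        volume {x | 2 * l ≤ ‖conv1 K f x‖ₑ} ≤
          C * (l⁻¹ * ∫⁻ x in {x | l / 2 < ‖f x‖ₑ}, ‖f x‖ₑ) +
          ENNReal.ofReal A ^ 2 * (l⁻¹ ^ 2 * ∫⁻ x in {x | ‖f x‖ₑ ≤ l}, ‖f x‖ₑ ^ 2) := by
  obtain ⟨D, hD, hDs⟩ := exists_volume_cellStar_le n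
  set P : ℝ≥0∞ := 2 ^ n * 4 with hP
  have hPt : P ≠ ⊤ := ENNReal.mul_ne_top (ENNReal.pow_ne_top (by simp)) (by simp)
  refine ⟨2 * (ENNReal.ofReal A ^ 2 * P ^ 2) + 2 * D + 4 * B, ?_, ?_⟩
  · have : ENNReal.ofReal A ≠ ⊤ := ENNReal.ofReal_ne_top
    finiteness
  intro K hKm hK hK2 hKA hKB f hfc hf hf2 l hl0 hl
  obtain ⟨S, g, hS, hSm, hSd, hSl, hgm, hgo, hgb, h0, hb1, hg1⟩ :=
    exists_calderonZygmund hfc hf hl0 hl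
  set Ω := ⋃ q, S q with hΩ
  have hΩm : MeasurableSet Ω := MeasurableSet.iUnion hSm
  set I := ∫⁻ x in {x | l / 2 < ‖f x‖ₑ}, ‖f x‖ₑ with hI
  set J := ∫⁻ x in {x | ‖f x‖ₑ ≤ l}, ‖f x‖ₑ ^ 2 with hJ
  have hlΩ : l * volume Ω ≤ ∫⁻ x in Ω, ‖f x‖ₑ := by
    rw [hΩ, measure_iUnion hSd hSm, lintegral_iUnion hSm hSd, ← ENNReal.tsum_mul_left]
    exact ENNReal.tsum_le_tsum hSl
  have hfΩ : ∫⁻ x in Ω, ‖f x‖ₑ ≤ l / 2 * volume Ω + I := by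
    have hm : MeasurableSet {x | l / 2 < ‖f x‖ₑ} :=
      measurableSet_lt measurable_const hfc.enorm.measurable
    calc ∫⁻ x in Ω, ‖f x‖ₑ
        ≤ ∫⁻ x in Ω, (l / 2 + {x | l / 2 < ‖f x‖ₑ}.indicator (fun x => ‖f x‖ₑ) x) := by
          refine lintegral_mono fun x => ?_
          by_cases hx : x ∈ {x | l / 2 < ‖f x‖ₑ}
          · rw [Set.indicator_of_mem hx]; exact le_add_self
          · rw [Set.indicator_of_notMem hx, add_zero]; exact not_lt.1 hx
      _ = l / 2 * volume Ω + ∫⁻ x in Ω, {x | l / 2 < ‖f x‖ₑ}.indicator (fun x => ‖f x‖ₑ) x := by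
          rw [lintegral_add_left measurable_const, setLIntegral_const]
      _ ≤ l / 2 * volume Ω + I := by
          gcongr
          refine (setLIntegral_le_lintegral _ _).trans ?_
          rw [lintegral_indicator hm]
  have hΩt : volume Ω ≠ ⊤ := by
    intro h
    rw [h, ENNReal.mul_top hl0] at hlΩ
    exact absurd (hlΩ.trans (setLIntegral_le_lintegral _ _)) (not_le.2 hf.2)
  have hl2 : l / 2 * volume Ω ≤ I := by
    have h1 := hlΩ.trans hfΩ
    nth_rewrite 1 [← ENNReal.add_halves l] at h1
    rw [add_mul] at h1
    refine (ENNReal.add_le_add_iff_left ?_).1 h1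
    exact ENNReal.mul_ne_top (ENNReal.div_ne_top hl (by norm_num)) hΩt
  have hfΩ2 : ∫⁻ x in Ω, ‖f x‖ₑ ≤ 2 * I := hfΩ.trans (by rw [two_mul]; gcongr)
  have hΩv : volume Ω ≤ 2 * (l⁻¹ * I) := by
    have h1 := hlΩ.trans hfΩ2
    calc volume Ω = l⁻¹ * (l * volume Ω) := by
          rw [← mul_assoc, ENNReal.inv_mul_cancel hl0 hl, one_mul]
      _ ≤ l⁻¹ * (2 * I) := by gcongr
      _ = _ := by ring
  have hJt : J ≠ ⊤ := by
    have h2 := hf2.2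
    have h3 : ∫⁻ x, ‖f x‖ₑ ^ 2 < ⊤ := by
      rw [← eLpNorm_two_sq]; exact ENNReal.pow_lt_top h2
    exact ((setLIntegral_le_lintegral _ _).trans_lt h3).ne
  have hg2 : ∫⁻ x, ‖g x‖ₑ ^ 2 ≤ (P * l) ^ 2 * volume Ω + J := by
    rw [← lintegral_add_compl _ hΩm]
    refine add_le_add ?_ ?_
    · rw [← setLIntegral_const]
      exact lintegral_mono fun x => pow_le_pow_left' (hgb x) 2
    · calc ∫⁻ x in Ωᶜ, ‖g x‖ₑ ^ 2 = ∫⁻ x in Ωᶜ, ‖f x‖ₑ ^ 2 :=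
            setLIntegral_congr_fun hΩm.compl fun x hx => by rw [(hgo x hx).1]
        _ ≤ J := lintegral_mono_set fun x hx => (hgo x hx).2
  have hgL2 : MemLp g 2 := by
    refine ⟨hgm.aestronglyMeasurable, ?_⟩
    have : eLpNorm g 2 volume ^ 2 < ⊤ := by
      rw [eLpNorm_two_sq]
      refine hg2.trans_lt ?_
      finiteness
    by_contra h
    rw [not_lt, top_le_iff] at h
    simp [h] at this
  have hgi : Integrable g := by
    refine ⟨hgm.aestronglyMeasurable, ?_⟩
    rw [HasFiniteIntegral]
    refine lt_of_le_of_lt ?_ hf.2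
    rw [← lintegral_add_compl _ hΩm, ← lintegral_add_compl (fun x => ‖f x‖ₑ) hΩm]
    refine add_le_add ?_ (le_of_eq ?_)
    · rw [hΩ, lintegral_iUnion hSm hSd, lintegral_iUnion hSm hSd]
      exact ENNReal.tsum_le_tsum hg1
    · exact setLIntegral_congr_fun hΩm.compl fun x hx => by simp only [(hgo x hx).1]
  have hbm : Measurable fun x => f x - g x := hfc.measurable.sub hgm
  have hbL2 : MemLp (fun x => f x - g x) 2 := hf2.sub hgL2
  obtain ⟨E, hEm, hEv, hEb⟩ := hKB.exists_lintegral_bad_le hKm hbm (hf.sub hgi)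
    (fun x => integrable_conv_memLp hK2 hbL2 x) hDs hS hSm hSd h0
    (fun z hz => by simp [(hgo z hz).1])
  have hbΩ : ∫⁻ y in ⋃ q, S q, ‖f y - g y‖ₑ ≤ 2 * (2 * I) := by
    refine le_trans ?_ (mul_le_mul_right hfΩ2 2)
    rw [hΩ, lintegral_iUnion hSm hSd, lintegral_iUnion hSm hSd, ← ENNReal.tsum_mul_left]
    exact ENNReal.tsum_le_tsum hb1
  have hsplit : ∀ x, conv1 K f x = conv1 K g x + conv1 K (fun x => f x - g x) x := fun x => by
    have := conv1_sub hK2 hf2 hgL2 x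
    rw [this]; ring
  have hsub : {x | 2 * l ≤ ‖conv1 K f x‖ₑ} ⊆ {x | l ≤ ‖conv1 K g x‖ₑ} ∪
      (E ∪ {x | l ≤ ‖Eᶜ.indicator (conv1 K (fun x => f x - g x)) x‖ₑ}) := by
    intro x hx
    by_contra hn
    simp only [Set.mem_union, Set.mem_ofPred_eq, not_or, not_le] at hn
    obtain ⟨h1, h2, h3⟩ := hn
    rw [Set.indicator_of_mem (show x ∈ Eᶜ from h2)] at h3
    have h4 : ‖conv1 K f x‖ₑ < 2 * l := by
      rw [hsplit x, two_mul]
      exact (enorm_add_le _ _).trans_lt (ENNReal.add_lt_add h1 h3)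
    exact absurd hx (not_le.2 h4)
  have hm1 : volume {x | l ≤ ‖conv1 K g x‖ₑ} ≤
      l⁻¹ ^ 2 * (ENNReal.ofReal A ^ 2 * ((P * l) ^ 2 * volume Ω + J)) := by
    have h1 := eLpNorm_two_conv1_le hK hK2 hA hKA hgL2
    have h2 : ∫⁻ x, ‖conv1 K g x‖ₑ ^ 2 ≤ ENNReal.ofReal A ^ 2 * ((P * l) ^ 2 * volume Ω + J) := by
      rw [← eLpNorm_two_sq]
      refine (pow_le_pow_left' h1 2).trans ?_
      rw [mul_pow, eLpNorm_two_sq]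
      gcongr
    have h3 := mul_meas_ge_le_lintegral₀ (μ := volume)
      (f := fun x => ‖conv1 K g x‖ₑ ^ 2)
      ((integrable_conv1 hK hgi).1.enorm.pow_const 2) (l ^ 2)
    have h4 : {x | l ≤ ‖conv1 K g x‖ₑ} = {x | l ^ 2 ≤ ‖conv1 K g x‖ₑ ^ 2} := by
      ext x
      exact (ENNReal.pow_le_pow_left_iff two_ne_zero).symm
    calc volume {x | l ≤ ‖conv1 K g x‖ₑ}
        = l⁻¹ ^ 2 * (l ^ 2 * volume {x | l ^ 2 ≤ ‖conv1 K g x‖ₑ ^ 2}) := by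
          rw [h4, ← mul_assoc, ← mul_pow, ENNReal.inv_mul_cancel hl0 hl, one_pow, one_mul]
      _ ≤ _ := mul_le_mul_right (h3.trans h2) _
  have hm2 : volume {x | l ≤ ‖Eᶜ.indicator (conv1 K (fun x => f x - g x)) x‖ₑ} ≤
      l⁻¹ * (B * (2 * (2 * I))) := by
    have h3 := mul_meas_ge_le_lintegral₀ (μ := volume)
      (f := fun x => ‖Eᶜ.indicator (conv1 K (fun x => f x - g x)) x‖ₑ)
      ((integrable_conv1 hK (hf.sub hgi)).1.indicator hEm.compl).enorm l
    have h4 : ∫⁻ x, ‖Eᶜ.indicator (conv1 K (fun x => f x - g x)) x‖ₑ ≤ B * (2 * (2 * I)) := by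
      simp only [enorm_indicator_eq_indicator_enorm]
      rw [lintegral_indicator hEm.compl]
      exact hEb.trans (mul_le_mul_right hbΩ B)
    calc volume {x | l ≤ ‖Eᶜ.indicator (conv1 K (fun x => f x - g x)) x‖ₑ}
        = l⁻¹ * (l * volume {x | l ≤ ‖Eᶜ.indicator (conv1 K (fun x => f x - g x)) x‖ₑ}) := by
          rw [← mul_assoc, ENNReal.inv_mul_cancel hl0 hl, one_mul]
      _ ≤ _ := mul_le_mul_right (h3.trans h4) _
  calc volume {x | 2 * l ≤ ‖conv1 K f x‖ₑ}
      ≤ l⁻¹ ^ 2 * (ENNReal.ofReal A ^ 2 * ((P * l) ^ 2 * volume Ω + J)) +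
        (D * volume Ω + l⁻¹ * (B * (2 * (2 * I)))) :=
        (measure_mono hsub).trans ((measure_union_le _ _).trans (add_le_add hm1
          ((measure_union_le _ _).trans (add_le_add hEv hm2))))
    _ = ((l⁻¹ * l) ^ 2 * (ENNReal.ofReal A ^ 2 * P ^ 2) + D) * volume Ω + 4 * B * (l⁻¹ * I) +
        ENNReal.ofReal A ^ 2 * (l⁻¹ ^ 2 * J) := by ring
    _ ≤ (ENNReal.ofReal A ^ 2 * P ^ 2 + D) * (2 * (l⁻¹ * I)) + 4 * B * (l⁻¹ * I) +
        ENNReal.ofReal A ^ 2 * (l⁻¹ ^ 2 * J) := by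
        rw [ENNReal.inv_mul_cancel hl0 hl, one_pow, one_mul]
        gcongr
    _ = _ := by ring

lemma lintegral_Ioc_rpow {r b : ℝ} (hr : -1 < r) (hb : 0 ≤ b) :
    ∫⁻ t in Set.Ioc 0 b, ENNReal.ofReal (t ^ r) = ENNReal.ofReal (b ^ (r + 1) / (r + 1)) := by
  have hi : IntegrableOn (fun t : ℝ => t ^ r) (Set.Ioc 0 b) :=
    (intervalIntegrable_iff_integrableOn_Ioc_of_le hb).1
      (intervalIntegral.intervalIntegrable_rpow' hr)
  rw [← ofReal_integral_eq_lintegral_ofReal hi, ← intervalIntegral.integral_of_le hb,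
    integral_rpow (Or.inl hr), Real.zero_rpow (by linarith), sub_zero]
  filter_upwards [ae_restrict_mem measurableSet_Ioc] with t ht
  exact Real.rpow_nonneg ht.1.le _

lemma lintegral_Ioi_rpow {r a : ℝ} (hr : r < -1) (ha : 0 < a) :
    ∫⁻ t in Set.Ioi a, ENNReal.ofReal (t ^ r) = ENNReal.ofReal (a ^ (r + 1) / (-(r + 1))) := by
  rw [← ofReal_integral_eq_lintegral_ofReal (integrableOn_Ioi_rpow_of_lt hr ha),
    integral_Ioi_rpow_of_lt hr ha, div_neg, neg_div]
  filter_upwards [ae_restrict_mem measurableSet_Ioi] with t ht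
  exact Real.rpow_nonneg (ha.trans ht).le _

lemma lintegral_Ici_rpow {r a : ℝ} (hr : r < -1) (ha : 0 < a) :
    ∫⁻ t in Set.Ici a, ENNReal.ofReal (t ^ r) = ENNReal.ofReal (a ^ (r + 1) / (-(r + 1))) := by
  rw [setLIntegral_congr Ioi_ae_eq_Ici.symm, lintegral_Ioi_rpow hr ha]

lemma lintegral_layer_high_le {p : ℝ} (hp : 1 < p) {a : ℝ} (ha : 0 ≤ a) :
    ∫⁻ t in Set.Ioi (0 : ℝ), (ENNReal.ofReal t)⁻¹ * ENNReal.ofReal (t ^ (p - 1)) *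
      {t : ℝ | ENNReal.ofReal t / 2 < ENNReal.ofReal a}.indicator (fun _ => ENNReal.ofReal a) t ≤
      ENNReal.ofReal (2 ^ (p - 1) / (p - 1)) * ENNReal.ofReal (a ^ p) := by
  calc _ ≤ ∫⁻ t in Set.Ioi (0 : ℝ), (Set.Ioc 0 (2 * a)).indicator
          (fun t => ENNReal.ofReal a * ENNReal.ofReal (t ^ (p - 2))) t := by
        refine setLIntegral_mono' measurableSet_Ioi fun t (ht : 0 < t) => ?_
        by_cases h : ENNReal.ofReal t / 2 < ENNReal.ofReal a
        · have h2 : t ∈ Set.Ioc 0 (2 * a) := by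
            refine ⟨ht, ?_⟩
            have : ENNReal.ofReal (t / 2) < ENNReal.ofReal a := by
              rwa [ENNReal.ofReal_div_of_pos (by norm_num), ENNReal.ofReal_ofNat]
            have := (ENNReal.ofReal_lt_ofReal_iff_of_nonneg (by positivity)).1 this
            linarith
          rw [Set.indicator_of_mem (by exact h), Set.indicator_of_mem h2,
            ← ENNReal.ofReal_inv_of_pos ht, ← ENNReal.ofReal_mul (by positivity), mul_comm]
          apply le_of_eq
          congr 2
          rw [show p - 1 = (p - 2) + 1 by ring, Real.rpow_add_one ht.ne']
          field_simp
        · rw [Set.indicator_of_notMem (by exact h), mul_zero]; exact zero_le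
    _ ≤ ∫⁻ t in Set.Ioc 0 (2 * a), ENNReal.ofReal a * ENNReal.ofReal (t ^ (p - 2)) := by
        refine (setLIntegral_le_lintegral _ _).trans ?_
        rw [lintegral_indicator measurableSet_Ioc]
    _ = ENNReal.ofReal a * ENNReal.ofReal ((2 * a) ^ (p - 1) / (p - 1)) := by
        rw [lintegral_const_mul' _ _ ENNReal.ofReal_ne_top, lintegral_Ioc_rpow (by linarith)
          (by positivity)]
        congr 3 <;> ring_nf
    _ = _ := by
        have hp1 : 0 < p - 1 := by linarith
        rw [← ENNReal.ofReal_mul ha, ← ENNReal.ofReal_mul (by positivity)]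
        congr 1
        rcases ha.eq_or_lt with rfl | ha
        · rw [Real.zero_rpow (by linarith)]; simp
        · rw [Real.mul_rpow (by norm_num) ha.le]
          conv_rhs => rw [show p = (p - 1) + 1 by ring, Real.rpow_add_one ha.ne']
          ring_nf

lemma lintegral_layer_low_le {p : ℝ} (hp : p < 2) {a : ℝ} (ha : 0 ≤ a) :
    ∫⁻ t in Set.Ioi (0 : ℝ), (ENNReal.ofReal t)⁻¹ ^ 2 * ENNReal.ofReal (t ^ (p - 1)) *
      {t : ℝ | ENNReal.ofReal a ≤ ENNReal.ofReal t}.indicator (fun _ => ENNReal.ofReal a ^ 2) t ≤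
      ENNReal.ofReal (1 / (2 - p)) * ENNReal.ofReal (a ^ p) := by
  rcases ha.eq_or_lt with rfl | ha
  · simp [Set.indicator]
  calc _ ≤ ∫⁻ t in Set.Ioi (0 : ℝ), (Set.Ici a).indicator
          (fun t => ENNReal.ofReal a ^ 2 * ENNReal.ofReal (t ^ (p - 3))) t := by
        refine setLIntegral_mono' measurableSet_Ioi fun t (ht : 0 < t) => ?_
        by_cases h : ENNReal.ofReal a ≤ ENNReal.ofReal t
        · have h2 : t ∈ Set.Ici a := (ENNReal.ofReal_le_ofReal_iff ht.le).1 h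
          rw [Set.indicator_of_mem (by exact h), Set.indicator_of_mem h2,
            ← ENNReal.ofReal_inv_of_pos ht, ← ENNReal.ofReal_pow (by positivity),
            ← ENNReal.ofReal_mul (by positivity), mul_comm]
          apply le_of_eq
          congr 2
          rw [show p - 1 = (p - 3) + (2 : ℕ) by push_cast; ring, Real.rpow_add_natCast ht.ne']
          field_simp
        · rw [Set.indicator_of_notMem (by exact h), mul_zero]; exact zero_le
    _ ≤ ∫⁻ t in Set.Ici a, ENNReal.ofReal a ^ 2 * ENNReal.ofReal (t ^ (p - 3)) := by
        refine (setLIntegral_le_lintegral _ _).trans ?_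
        rw [lintegral_indicator measurableSet_Ici]
    _ = ENNReal.ofReal a ^ 2 * ENNReal.ofReal (a ^ (p - 2) / (2 - p)) := by
        rw [lintegral_const_mul' _ _ (by finiteness), lintegral_Ici_rpow (by linarith) ha]
        congr 3 <;> ring_nf
    _ = _ := by
        have hp1 : 0 < 2 - p := by linarith
        rw [← ENNReal.ofReal_pow ha.le, ← ENNReal.ofReal_mul (by positivity),
          ← ENNReal.ofReal_mul (by positivity)]
        congr 1
        conv_rhs => rw [show p = (p - 2) + (2 : ℕ) by push_cast; ring, Real.rpow_add_natCast ha.ne']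
        push_cast
        ring_nf

/-- `Lᵖ` bounds for `1 < p < 2`, with constants depending only on the Fourier bound and the
Hörmander constant of the kernel. -/
theorem exists_eLpNorm_conv1_le_of_lt_two (n : ℕ) {A : ℝ} (hA : 0 ≤ A) {B : ℝ≥0∞} (hB : B ≠ ⊤)
    {p : ℝ} (hp : 1 < p) (hp2 : p < 2) :
    ∃ C : ℝ≥0∞, C ≠ ⊤ ∧ ∀ K : Rn1 n → ℂ, Measurable K → Integrable K → MemLp K 2 →
      (∀ q, ‖FT1 K q‖ ≤ A) → HormanderBound K B →
      ∀ f : Rn1 n → ℂ, Continuous f → Integrable f → MemLp f 2 →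
        eLpNorm (conv1 K f) (ENNReal.ofReal p) volume ≤ C * eLpNorm f (ENNReal.ofReal p) volume := by
  obtain ⟨C, hC, hmain⟩ := exists_meas_conv1_le n hA hB
  have hp0 : 0 < p := by linarith
  set M : ℝ≥0∞ := ENNReal.ofReal (2 ^ p) * (ENNReal.ofReal p *
    (C * ENNReal.ofReal (2 ^ (p - 1) / (p - 1)) +
      ENNReal.ofReal A ^ 2 * ENNReal.ofReal (1 / (2 - p)))) with hM
  refine ⟨M ^ (1 / p), ENNReal.rpow_ne_top_of_nonneg (by positivity) (by finiteness), ?_⟩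
  intro K hKm hK hK2 hKA hKB f hfc hf hf2
  have key : ∫⁻ x, ‖conv1 K f x‖ₑ ^ p ≤ M * ∫⁻ x, ‖f x‖ₑ ^ p := by
    have hfn : ∀ x, ‖f x‖ₑ = ENNReal.ofReal ‖f x‖ := fun x => (ofReal_norm _).symm
    have hF : AEMeasurable (fun x => ‖conv1 K f x‖ / 2) :=
      ((integrable_conv1 hK hf).1.norm.aemeasurable).div_const 2
    have h1 := lintegral_rpow_eq_lintegral_meas_le_mul volume
      (Filter.Eventually.of_forall fun x => by positivity) hF hp0
    have h2 : ∀ x, ‖conv1 K f x‖ₑ ^ p =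
        ENNReal.ofReal (2 ^ p) * ENNReal.ofReal ((‖conv1 K f x‖ / 2) ^ p) := fun x => by
      rw [← ENNReal.ofReal_mul (by positivity), ← Real.mul_rpow (by norm_num) (by positivity),
        mul_div_cancel₀ _ (by norm_num), ← ofReal_norm,
        ENNReal.ofReal_rpow_of_nonneg (by positivity) hp0.le]
    simp only [h2]
    rw [lintegral_const_mul' _ _ ENNReal.ofReal_ne_top, h1, hM, mul_assoc, mul_assoc]
    gcongr
    have hfp : ∀ x, ENNReal.ofReal (‖f x‖ ^ p) = ENNReal.ofReal ‖f x‖ ^ p := fun x => by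
      rw [ENNReal.ofReal_rpow_of_nonneg (by positivity) hp0.le]
    have hfm : Measurable f := hfc.measurable
    have hmf : Measurable fun x => ‖f x‖ₑ := hfc.enorm.measurable
    calc ∫⁻ t in Set.Ioi (0 : ℝ), volume {x | t ≤ ‖conv1 K f x‖ / 2} * ENNReal.ofReal (t ^ (p - 1))
        ≤ ∫⁻ t in Set.Ioi (0 : ℝ), ((∫⁻ x, C * ((ENNReal.ofReal t)⁻¹ * ENNReal.ofReal (t ^ (p - 1)) *
            {t : ℝ | ENNReal.ofReal t / 2 < ‖f x‖ₑ}.indicator (fun _ => ‖f x‖ₑ) t)) +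
            ∫⁻ x, ENNReal.ofReal A ^ 2 *
              ((ENNReal.ofReal t)⁻¹ ^ 2 * ENNReal.ofReal (t ^ (p - 1)) *
              {t : ℝ | ‖f x‖ₑ ≤ ENNReal.ofReal t}.indicator (fun _ => ‖f x‖ₑ ^ 2) t)) := by
          refine setLIntegral_mono' measurableSet_Ioi fun t (ht : 0 < t) => ?_
          have ht0 : ENNReal.ofReal t ≠ 0 := by simpa using ht
          have h3 := hmain K hKm hK hK2 hKA hKB f hfc hf hf2 (ENNReal.ofReal t) ht0
            ENNReal.ofReal_ne_top
          have h4 : {x | t ≤ ‖conv1 K f x‖ / 2} = {x | 2 * ENNReal.ofReal t ≤ ‖conv1 K f x‖ₑ} := by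
            ext x
            simp only [Set.mem_ofPred_eq]
            rw [← ENNReal.ofReal_ofNat, ← ENNReal.ofReal_mul (by norm_num), ← ofReal_norm,
              ENNReal.ofReal_le_ofReal_iff (norm_nonneg _), le_div_iff₀ (by norm_num), mul_comm]
          rw [h4]
          refine (mul_le_mul_left h3 _).trans (le_of_eq ?_)
          have hti : (ENNReal.ofReal t)⁻¹ ≠ ⊤ := ENNReal.inv_ne_top.2 ht0
          rw [add_mul, lintegral_const_mul' _ _ hC, lintegral_const_mul' _ _ (by finiteness),
            lintegral_const_mul' _ _ (by finiteness), lintegral_const_mul' _ _ (by finiteness),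
            ← lintegral_indicator (measurableSet_lt measurable_const hmf),
            ← lintegral_indicator (measurableSet_le hmf measurable_const)]
          have e1 : ∀ x, {x | ENNReal.ofReal t / 2 < ‖f x‖ₑ}.indicator (fun x => ‖f x‖ₑ) x =
            {t : ℝ | ENNReal.ofReal t / 2 < ‖f x‖ₑ}.indicator (fun _ => ‖f x‖ₑ) t := fun x => rfl
          have e2 : ∀ x, {x | ‖f x‖ₑ ≤ ENNReal.ofReal t}.indicator (fun x => ‖f x‖ₑ ^ 2) x =
            {t : ℝ | ‖f x‖ₑ ≤ ENNReal.ofReal t}.indicator (fun _ => ‖f x‖ₑ ^ 2) t := fun x => rfl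
          simp only [e1, e2]
          ring
      _ = (∫⁻ t in Set.Ioi (0 : ℝ), ∫⁻ x, C * ((ENNReal.ofReal t)⁻¹ * ENNReal.ofReal (t ^ (p - 1)) *
            {t : ℝ | ENNReal.ofReal t / 2 < ‖f x‖ₑ}.indicator (fun _ => ‖f x‖ₑ) t)) +
            ∫⁻ t in Set.Ioi (0 : ℝ), ∫⁻ x, ENNReal.ofReal A ^ 2 *
              ((ENNReal.ofReal t)⁻¹ ^ 2 * ENNReal.ofReal (t ^ (p - 1)) *
              {t : ℝ | ‖f x‖ₑ ≤ ENNReal.ofReal t}.indicator (fun _ => ‖f x‖ₑ ^ 2) t) := by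
          refine lintegral_add_left (Measurable.lintegral_prod_right ?_) _
          refine Measurable.const_mul (Measurable.mul (by fun_prop) ?_) _
          exact Measurable.indicator (by fun_prop : Measurable fun z : ℝ × Rn1 n => ‖f z.2‖ₑ)
            (measurableSet_lt (by fun_prop) (by fun_prop))
      _ = (∫⁻ x, ∫⁻ t in Set.Ioi (0 : ℝ), C * ((ENNReal.ofReal t)⁻¹ * ENNReal.ofReal (t ^ (p - 1)) *
            {t : ℝ | ENNReal.ofReal t / 2 < ‖f x‖ₑ}.indicator (fun _ => ‖f x‖ₑ) t)) +
            ∫⁻ x, ∫⁻ t in Set.Ioi (0 : ℝ), ENNReal.ofReal A ^ 2 *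
              ((ENNReal.ofReal t)⁻¹ ^ 2 * ENNReal.ofReal (t ^ (p - 1)) *
              {t : ℝ | ‖f x‖ₑ ≤ ENNReal.ofReal t}.indicator (fun _ => ‖f x‖ₑ ^ 2) t) := by
          congr 1
          · refine lintegral_lintegral_swap (Measurable.aemeasurable ?_)
            refine Measurable.const_mul (Measurable.mul (by fun_prop) ?_) _
            exact Measurable.indicator (by fun_prop : Measurable fun z : ℝ × Rn1 n => ‖f z.2‖ₑ)
              (measurableSet_lt (by fun_prop) (by fun_prop))
          · refine lintegral_lintegral_swap (Measurable.aemeasurable ?_)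
            refine Measurable.const_mul (Measurable.mul (by fun_prop) ?_) _
            exact Measurable.indicator (by fun_prop : Measurable fun z : ℝ × Rn1 n => ‖f z.2‖ₑ ^ 2)
              (measurableSet_le (by fun_prop) (by fun_prop))
      _ ≤ (∫⁻ x, C * (ENNReal.ofReal (2 ^ (p - 1) / (p - 1)) * ‖f x‖ₑ ^ p)) +
            ∫⁻ x, ENNReal.ofReal A ^ 2 * (ENNReal.ofReal (1 / (2 - p)) * ‖f x‖ₑ ^ p) := by
          refine add_le_add (lintegral_mono fun x => ?_) (lintegral_mono fun x => ?_)
          · rw [lintegral_const_mul' _ _ hC]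
            refine mul_le_mul_right ?_ _
            rw [hfn, ← hfp]
            exact lintegral_layer_high_le hp (norm_nonneg _)
          · rw [lintegral_const_mul' _ _ (by finiteness)]
            refine mul_le_mul_right ?_ _
            rw [hfn, ← hfp]
            exact lintegral_layer_low_le hp2 (norm_nonneg _)
      _ = _ := by
          rw [lintegral_const_mul' _ _ hC, lintegral_const_mul' _ _ (by finiteness),
            lintegral_const_mul' _ _ (by finiteness), lintegral_const_mul' _ _ (by finiteness)]
          ring
  have hpn : ENNReal.ofReal p ≠ 0 := by simpa using hp0
  rw [eLpNorm_eq_lintegral_rpow_enorm_toReal hpn ENNReal.ofReal_ne_top,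
    eLpNorm_eq_lintegral_rpow_enorm_toReal hpn ENNReal.ofReal_ne_top, ENNReal.toReal_ofReal hp0.le,
    ← ENNReal.mul_rpow_of_nonneg _ _ (by positivity)]
  exact ENNReal.rpow_le_rpow key (by positivity)

lemma conv1_comm {n : ℕ} (K f : Rn1 n → ℂ) (x : Rn1 n) : conv1 K f x = ∫ y, K y * f (x - y) := by
  have := integral_sub_left_eq_self (fun y => K y * f (x - y)) (volume : Measure (Rn1 n)) x
  simp only [sub_sub_cancel] at this
  exact this

lemma continuous_conv1 {n : ℕ} {K f : Rn1 n → ℂ} (hK : Integrable K) (hf : Continuous f) {M : ℝ}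
    (hM : ∀ x, ‖f x‖ ≤ M) : Continuous (conv1 K f) := by
  have : conv1 K f = fun x => ∫ y, K y * f (x - y) := funext (conv1_comm K f)
  rw [this]
  refine continuous_of_dominated (bound := fun y => ‖K y‖ * M) (fun x => ?_) (fun x => ?_)
    (hK.norm.mul_const M) ?_
  · exact hK.1.mul (by fun_prop : Continuous fun y => f (x - y)).aestronglyMeasurable
  · refine Filter.Eventually.of_forall fun y => ?_
    rw [norm_mul]
    gcongr
    exact hM _
  · exact Filter.Eventually.of_forall fun y => by fun_prop

lemma norm_conv1_le {n : ℕ} {K f : Rn1 n → ℂ} (hK : Integrable K) {M : ℝ}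
    (hM : ∀ x, ‖f x‖ ≤ M) (x : Rn1 n) : ‖conv1 K f x‖ ≤ (∫ y, ‖K y‖) * M := by
  rw [conv1_comm, ← integral_mul_const]
  refine norm_integral_le_of_norm_le (hK.norm.mul_const M) (Filter.Eventually.of_forall fun y => ?_)
  rw [norm_mul]
  gcongr
  exact hM _

lemma integral_conv1_mul {n : ℕ} {K f g : Rn1 n → ℂ} (hK : Integrable K) (hf : Integrable f)
    (hgc : Continuous g) {M : ℝ} (hM : ∀ x, ‖g x‖ ≤ M) :
    ∫ x, conv1 K f x * g x = ∫ y, f y * conv1 K (fun z => g (-z)) (-y) := by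
  have h1 : ∀ y, conv1 K (fun z => g (-z)) (-y) = ∫ x, K (x - y) * g x := fun y => by
    rw [conv1, ← integral_neg_eq_self]
    refine integral_congr_ae (Filter.Eventually.of_forall fun x => ?_)
    simp only [neg_neg]
    congr 2; abel
  simp only [h1]
  simp only [conv1, ← integral_const_mul, ← integral_mul_const]
  rw [integral_integral_swap]
  · refine integral_congr_ae (Filter.Eventually.of_forall fun y => ?_)
    refine integral_congr_ae (Filter.Eventually.of_forall fun x => ?_)
    simp only; ring
  · have := (integrable_conv_integrand hK hf).bdd_mul (f := fun z => g z.1) (c := M)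
      (by fun_prop : Continuous fun z : Rn1 n × Rn1 n => g z.1).aestronglyMeasurable
      (Filter.Eventually.of_forall fun z => hM _)
    refine this.congr (Filter.Eventually.of_forall fun z => ?_)
    simp only [Function.uncurry]; ring

theorem eLpNorm_conv1_le_of_dual {n : ℕ} {K : Rn1 n → ℂ} (hK : Integrable K) {p q : ℝ}
    (hpq : p.HolderConjugate q) (hp : 2 < p) {C : ℝ≥0∞}
    (hC : ∀ g : Rn1 n → ℂ, Continuous g → Integrable g → MemLp g 2 →
      eLpNorm (conv1 K g) (ENNReal.ofReal q) volume ≤ C * eLpNorm g (ENNReal.ofReal q) volume)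
    {f : Rn1 n → ℂ} (hfc : Continuous f) (hf : Integrable f) {M : ℝ} (hM : ∀ x, ‖f x‖ ≤ M) :
    eLpNorm (conv1 K f) (ENNReal.ofReal p) volume ≤ C * eLpNorm f (ENNReal.ofReal p) volume := by
  have hp0 : 0 < p := by linarith
  have hq0 : 0 < q := hpq.symm.pos
  set h := conv1 K f with hh
  set N := (∫ y, ‖K y‖) * M with hN
  have hhc : Continuous h := continuous_conv1 hK hfc hM
  have hhb : ∀ x, ‖h x‖ ≤ N := norm_conv1_le hK hM
  have hhi : Integrable h := integrable_conv1 hK hf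
  set g : Rn1 n → ℂ := fun x => ((‖h x‖ ^ (p - 2) : ℝ) : ℂ) * (starRingEnd ℂ) (h x) with hg
  have hgc : Continuous g := by
    refine Continuous.mul (continuous_ofReal.comp ?_) (continuous_conj.comp hhc)
    exact hhc.norm.rpow_const fun x => Or.inr (by linarith)
  have hgn : ∀ x, ‖g x‖ = ‖h x‖ ^ (p - 1) := fun x => by
    rw [hg]
    simp only [norm_mul, RCLike.norm_conj, Complex.norm_real, Real.norm_eq_abs]
    rw [abs_of_nonneg (by positivity), show p - 1 = p - 2 + 1 by ring,
      Real.rpow_add_one' (norm_nonneg _) (by linarith)]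
  have hgb : ∀ x, ‖g x‖ ≤ N ^ (p - 1) := fun x => by
    rw [hgn]; exact Real.rpow_le_rpow (norm_nonneg _) (hhb x) (by linarith)
  have hgi : Integrable g := by
    have := hhi.norm.bdd_mul (f := fun x => ‖h x‖ ^ (p - 2)) (c := N ^ (p - 2))
      ((hhc.norm.rpow_const fun x => Or.inr (by linarith)).aestronglyMeasurable)
      (Filter.Eventually.of_forall fun x => by
        rw [Real.norm_eq_abs, abs_of_nonneg (by positivity)]
        exact Real.rpow_le_rpow (norm_nonneg _) (hhb x) (by linarith))
    refine this.mono' hgc.aestronglyMeasurable (Filter.Eventually.of_forall fun x => ?_)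
    rw [hgn, show p - 1 = p - 2 + 1 by ring, Real.rpow_add_one' (norm_nonneg _) (by linarith)]
  have hg2 : MemLp g 2 := (memLp_two_iff_integrable_sq_norm hgi.1).2 (integrable_norm_sq_of_bdd hgi hgb)
  set S : Rn1 n → ℂ := fun z => g (-z) with hS
  have hS1 := hC S (by fun_prop) hgi.comp_neg
    (hg2.comp_measurePreserving (Measure.measurePreserving_neg volume))
  have hhp : Integrable fun x => ‖h x‖ ^ p := by
    have := hhi.norm.bdd_mul (f := fun x => ‖h x‖ ^ (p - 1)) (c := N ^ (p - 1))
      ((hhc.norm.rpow_const fun x => Or.inr (by linarith)).aestronglyMeasurable)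
      (Filter.Eventually.of_forall fun x => by
        rw [Real.norm_eq_abs, abs_of_nonneg (by positivity)]
        exact Real.rpow_le_rpow (norm_nonneg _) (hhb x) (by linarith))
    refine this.congr (Filter.Eventually.of_forall fun x => ?_)
    simp only
    rw [← Real.rpow_add_one' (norm_nonneg _) (by linarith)]
    congr 1; ring
  set I := ∫⁻ x, ‖h x‖ₑ ^ p with hI
  have hIeq : I = ENNReal.ofReal (∫ x, ‖h x‖ ^ p) := by
    rw [ofReal_integral_eq_lintegral_ofReal hhp (Filter.Eventually.of_forall fun x => by positivity)]
    refine lintegral_congr fun x => ?_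
    rw [← ofReal_norm, ENNReal.ofReal_rpow_of_nonneg (norm_nonneg _) hp0.le]
  have hIt : I ≠ ⊤ := by rw [hIeq]; exact ENNReal.ofReal_ne_top
  have hprod : ∫ x, h x * g x = ((∫ x, ‖h x‖ ^ p : ℝ) : ℂ) := by
    rw [← integral_complex_ofReal]
    refine integral_congr_ae (Filter.Eventually.of_forall fun x => ?_)
    simp only [hg]
    rw [mul_left_comm, Complex.mul_conj, Complex.normSq_eq_norm_sq, ← Complex.ofReal_mul]
    congr 1
    rw [← Real.rpow_natCast, ← Real.rpow_add' (norm_nonneg _) (by norm_num; linarith)]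
    congr 1; norm_num
  have hpn : ENNReal.ofReal p ≠ 0 := by simpa using hp0
  have hqn : ENNReal.ofReal q ≠ 0 := by simpa using hq0
  have hgI : eLpNorm g (ENNReal.ofReal q) volume = I ^ (1 / q) := by
    rw [eLpNorm_eq_lintegral_rpow_enorm_toReal hqn ENNReal.ofReal_ne_top,
      ENNReal.toReal_ofReal hq0.le]
    congr 1
    refine lintegral_congr fun x => ?_
    rw [← ofReal_norm, hgn, ← ofReal_norm,
      ENNReal.ofReal_rpow_of_nonneg (by positivity) hq0.le,
      ENNReal.ofReal_rpow_of_nonneg (by positivity) hp0.le, ← Real.rpow_mul (norm_nonneg _),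
      hpq.sub_one_mul_conj]
  have hnegq : ∀ F : Rn1 n → ℂ, AEStronglyMeasurable F →
      eLpNorm (fun x => F (-x)) (ENNReal.ofReal q) volume =
      eLpNorm F (ENNReal.ofReal q) volume := fun F hF =>
    eLpNorm_comp_measurePreserving hF (Measure.measurePreserving_neg volume)
  have hle : I ≤ eLpNorm f (ENNReal.ofReal p) volume * (C * I ^ (1 / q)) := by
    calc I = ‖∫ x, h x * g x‖ₑ := by
          rw [hprod, hIeq, ← ofReal_norm, Complex.norm_real, Real.norm_of_nonneg]
          exact integral_nonneg fun x => by positivity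
      _ = ‖∫ y, f y * conv1 K S (-y)‖ₑ := by rw [hh, integral_conv1_mul hK hf hgc hgb]
      _ ≤ ∫⁻ y, ‖f y‖ₑ * ‖conv1 K S (-y)‖ₑ := by
          refine (enorm_integral_le_lintegral_enorm _).trans (le_of_eq ?_)
          simp only [enorm_mul]
      _ ≤ eLpNorm f (ENNReal.ofReal p) volume *
          eLpNorm (fun y => conv1 K S (-y)) (ENNReal.ofReal q) volume := by
          have := ENNReal.lintegral_mul_le_Lp_mul_Lq volume hpq (f := fun y => ‖f y‖ₑ)
            (g := fun y => ‖conv1 K S (-y)‖ₑ) hf.1.enorm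
            (integrable_conv1 hK hgi.comp_neg).comp_neg.1.enorm
          rwa [eLpNorm_eq_lintegral_rpow_enorm_toReal hpn ENNReal.ofReal_ne_top,
            eLpNorm_eq_lintegral_rpow_enorm_toReal hqn ENNReal.ofReal_ne_top,
            ENNReal.toReal_ofReal hp0.le, ENNReal.toReal_ofReal hq0.le]
      _ ≤ eLpNorm f (ENNReal.ofReal p) volume * (C * I ^ (1 / q)) := by
          gcongr
          rw [hnegq _ (integrable_conv1 hK hgi.comp_neg).1]
          refine hS1.trans (le_of_eq ?_)
          rw [hnegq _ hgi.1, hgI]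
  have hhI : eLpNorm h (ENNReal.ofReal p) volume = I ^ (1 / p) := by
    rw [eLpNorm_eq_lintegral_rpow_enorm_toReal hpn ENNReal.ofReal_ne_top,
      ENNReal.toReal_ofReal hp0.le]
  rw [hhI]
  by_cases hI0 : I = 0
  · rw [hI0, ENNReal.zero_rpow_of_pos (by positivity)]; exact zero_le
  have hIq0 : I ^ (1 / q) ≠ 0 := by
    rw [Ne, ENNReal.rpow_eq_zero_iff_of_pos (by positivity)]; exact hI0
  have hIqt : I ^ (1 / q) ≠ ⊤ := ENNReal.rpow_ne_top_of_nonneg (by positivity) hIt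
  refine (ENNReal.mul_le_mul_iff_left hIq0 hIqt).1 ?_
  rw [← ENNReal.rpow_add _ _ hI0 hIt, one_div, one_div, hpq.inv_add_inv_eq_one, ENNReal.rpow_one,
    ← one_div]
  refine hle.trans (le_of_eq (by ring))

/-- Singular integral theorem: `Lᵖ` bounds for `1 < p < ∞`. -/
theorem exists_eLpNorm_conv1_le (n : ℕ) {A : ℝ} (hA : 0 ≤ A) {B : ℝ≥0∞} (hB : B ≠ ⊤)
    {p : ℝ} (hp : 1 < p) :
    ∃ C : ℝ≥0∞, C ≠ ⊤ ∧ ∀ K : Rn1 n → ℂ, Measurable K → Integrable K → MemLp K 2 →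
      (∀ q, ‖FT1 K q‖ ≤ A) → HormanderBound K B → ∀ f : SchwartzMap (Rn1 n) ℂ,
        eLpNorm (conv1 K f) (ENNReal.ofReal p) volume ≤ C * eLpNorm f (ENNReal.ofReal p) volume := by
  rcases lt_trichotomy p 2 with h2 | rfl | h2
  · obtain ⟨C, hC, h⟩ := exists_eLpNorm_conv1_le_of_lt_two n hA hB hp h2
    exact ⟨C, hC, fun K hKm hK hK2 hKA hKB f =>
      h K hKm hK hK2 hKA hKB f f.continuous f.integrable (f.memLp 2)⟩
  · refine ⟨ENNReal.ofReal A, ENNReal.ofReal_ne_top, fun K hKm hK hK2 hKA hKB f => ?_⟩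
    rw [ENNReal.ofReal_ofNat]
    exact eLpNorm_two_conv1_le hK hK2 hA hKA (f.memLp 2)
  · have hpq : p.HolderConjugate (p.conjExponent) := Real.HolderConjugate.conjExponent hp
    have hq2 : p.conjExponent < 2 := by
      rw [Real.conjExponent, div_lt_iff₀ (by linarith)]; linarith
    obtain ⟨C, hC, h⟩ := exists_eLpNorm_conv1_le_of_lt_two n hA hB hpq.symm.lt hq2
    refine ⟨C, hC, fun K hKm hK hK2 hKA hKB f => ?_⟩
    exact eLpNorm_conv1_le_of_dual hK hpq h2 (fun g hgc hg hg2 => h K hKm hK hK2 hKA hKB g hgc hg hg2)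
      f.continuous f.integrable 
      fun x => f.toBoundedContinuousFunction.norm_coe_le_norm x

/-- Transfer of uniform kernel bounds to a pointwise limit of the symbols. -/
theorem eLpNorm_MOp_le_of_tendsto {n : ℕ} {K : ℕ → Rn1 n → ℂ} (hK : ∀ j, Integrable (K j)) {A : ℝ}
    (hA : ∀ j q, ‖FT1 (K j) q‖ ≤ A) {m : Rn1 n → ℂ}
    (hm : ∀ q, Filter.Tendsto (fun j => FT1 (K j) q) Filter.atTop (nhds (m q)))
    (f : SchwartzMap (Rn1 n) ℂ) {p C : ℝ≥0∞}
    (hC : ∀ j, eLpNorm (conv1 (K j) f) p volume ≤ C * eLpNorm f p volume) :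
    eLpNorm (MOp m f) p volume ≤ C * eLpNorm f p volume := by
  have hlim : ∀ x, Filter.Tendsto (fun j => conv1 (K j) f x) Filter.atTop (nhds (MOp m f x)) := by
    intro x
    simp only [← MOp_FT1_eq (hK _), MOp, IFT1_eq]
    refine tendsto_integral_of_dominated_convergence (fun q => A * ‖FT1 f q‖) (fun j => ?_)
      ((integrable_FT1 f).norm.const_mul A) (fun j => ?_) (Filter.Eventually.of_forall fun q => ?_)
    · refine Continuous.aestronglyMeasurable ?_
      refine Continuous.mul ?_ ((continuous_FT1 (hK j)).mul (continuous_FT1 f.integrable))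
      exact continuous_eChar.comp (continuous_dotRn1_comp continuous_id continuous_const)
    · refine Filter.Eventually.of_forall fun q => ?_
      rw [norm_mul, norm_eChar, one_mul, norm_mul]
      gcongr
      exact hA j q
    · exact ((hm q).mul_const _).const_mul _
  refine (Lp.eLpNorm_lim_le_liminf_eLpNorm (fun j => (integrable_conv1 (hK j) f.integrable).1) _
    (Filter.Eventually.of_forall hlim)).trans ?_
  refine Filter.liminf_le_of_frequently_le' (Filter.Frequently.of_forall hC)

/-- The parabolic dilation `(x,t) ↦ (x/r, t/r²)`. -/
def parDil {n : ℕ} (r : ℝ) (z : Rn1 n) : Rn1 n := (r⁻¹ • z.1, (r ^ 2)⁻¹ * z.2)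

@[fun_prop]
lemma measurable_parDil {n : ℕ} {α : Type*} [MeasurableSpace α] {r : α → ℝ} {z : α → Rn1 n}
    (hr : Measurable r) (hz : Measurable z) : Measurable fun a => parDil (r a) (z a) := by
  unfold parDil; fun_prop

lemma parDil_sub {n : ℕ} (r : ℝ) (z w : Rn1 n) : parDil r (z - w) = parDil r z - parDil r w := by
  simp [parDil, smul_sub, mul_sub]

lemma map_parDil {n : ℕ} {r : ℝ} (hr : 0 < r) :
    Measure.map (parDil r) (volume : Measure (Rn1 n)) = ENNReal.ofReal (r ^ (n + 2)) • volume := by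
  let L : Rn1 n →ₗ[ℝ] Rn1 n := LinearMap.prodMap (r⁻¹ • LinearMap.id) ((r ^ 2)⁻¹ • LinearMap.id)
  have hdet : LinearMap.det L = (r ^ (n + 2))⁻¹ := by
    simp only [L, LinearMap.det_prodMap, LinearMap.det_smul, LinearMap.det_id, mul_one,
      finrank_euclideanSpace, Fintype.card_fin, Module.finrank_self, pow_one]
    rw [pow_add, mul_inv, inv_pow]
  have hL : (L : Rn1 n → Rn1 n) = parDil r := by ext z <;> simp [L, parDil]
  have h := Measure.map_linearMap_addHaar_eq_smul_addHaar (volume : Measure (Rn1 n)) (f := L)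
    (by rw [hdet]; positivity)
  rw [← hL, h, hdet, inv_inv, abs_of_pos (by positivity)]

lemma lintegral_comp_parDil {n : ℕ} {r : ℝ} (hr : 0 < r) {f : Rn1 n → ℝ≥0∞} (hf : Measurable f) :
    ∫⁻ z, f (parDil r z) = ENNReal.ofReal (r ^ (n + 2)) * ∫⁻ z, f z := by
  rw [← lintegral_map hf (by fun_prop), map_parDil hr, lintegral_smul_measure, smul_eq_mul]

lemma integral_comp_parDil {n : ℕ} {r : ℝ} (hr : 0 < r) {f : Rn1 n → ℂ} (hf : Measurable f) :
    ∫ z, f (parDil r z) = (r ^ (n + 2) : ℝ) * ∫ z, f z := by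
  rw [← integral_map (by fun_prop) hf.aestronglyMeasurable, map_parDil hr, integral_smul_measure,
    ENNReal.toReal_ofReal (by positivity), Complex.real_smul]

lemma integrable_comp_parDil {n : ℕ} {r : ℝ} (hr : 0 < r) {f : Rn1 n → ℂ}
    (hfi : Integrable f) : Integrable fun z => f (parDil r z) := by
  have : Integrable f (Measure.map (parDil r) volume) := by
    rw [map_parDil hr]; exact hfi.smul_measure (by finiteness)
  exact this.comp_measurable (by fun_prop)

lemma dotRn1_parDil {n : ℕ} {r : ℝ} (hr : 0 < r) (z q : Rn1 n) :
    dotRn1 z q = dotRn1 (parDil r z) (parDil r⁻¹ q) := by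
  simp only [dotRn1, parDil, PiLp.smul_apply, smul_eq_mul, inv_inv, inv_pow]
  congr 1
  · refine Finset.sum_congr rfl fun k _ => ?_
    field_simp
  · field_simp

lemma FT1_comp_parDil {n : ℕ} {r : ℝ} (hr : 0 < r) {f : Rn1 n → ℂ} (hf : Measurable f) (q : Rn1 n) :
    FT1 (fun z => f (parDil r z)) q = (r ^ (n + 2) : ℝ) * FT1 f (parDil r⁻¹ q) := by
  rw [FT1_eq, FT1_eq, ← integral_comp_parDil hr]
  · simp only [← dotRn1_parDil hr]
  · refine Measurable.mul (Continuous.measurable ?_) hf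
    exact continuous_eChar.comp (continuous_dotRn1_comp continuous_id continuous_const).neg

/-- Profiles whose parabolic dilates superpose to Calderón–Zygmund kernels. -/
structure KernelProfile {n : ℕ} (k : Rn1 n → ℂ) (C : ℝ≥0∞) : Prop where
  measurable : Measurable k
  integrable : Integrable k
  bounded : ∃ M, ∀ z, ‖k z‖ ≤ M
  modulus : ∀ ρ : ℝ, 0 < ρ → ∀ w : Rn1 n, ‖w.1‖ ≤ ρ → |w.2| ≤ ρ ^ 2 →
    ∫⁻ z, ‖k (z - w) - k z‖ₑ ≤ C * ENNReal.ofReal ρ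
  tail : ∀ ρ : ℝ, 0 < ρ →
    ∫⁻ z in {z : Rn1 n | ‖z.1‖ ≤ ρ ∧ |z.2| ≤ ρ ^ 2}ᶜ, ‖k z‖ₑ ≤ C * ENNReal.ofReal ρ⁻¹

/-- The parabolic box of radius `ρ` is measurable. -/
lemma measurableSet_parBox {n : ℕ} (a b : ℝ) :
    MeasurableSet {z : Rn1 n | ‖z.1‖ ≤ a ∧ |z.2| ≤ b} := by
  exact ((isClosed_le (f := fun z : Rn1 n => ‖z.1‖) (g := fun _ => a) (by fun_prop)
    (by fun_prop)).inter (isClosed_le (f := fun z : Rn1 n => |z.2|) (g := fun _ => b) (by fun_prop)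
    (by fun_prop))).measurableSet

lemma KernelProfile.lintegral_sub_le {n : ℕ} {k : Rn1 n → ℂ} {C : ℝ≥0∞} (hk : KernelProfile k C)
    {ρ : ℝ} (hρ : 0 < ρ) {w : Rn1 n} (hw1 : ‖w.1‖ ≤ ρ) (hw2 : |w.2| ≤ ρ ^ 2) :
    ∫⁻ z in {z : Rn1 n | ‖z.1‖ ≤ 2 * ρ ∧ |z.2| ≤ 2 * ρ ^ 2}ᶜ, ‖k (z - w) - k z‖ₑ
      ≤ 2 * C * ENNReal.ofReal ρ⁻¹ := by
  have hm := hk.measurable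
  set E := {z : Rn1 n | ‖z.1‖ ≤ 2 * ρ ∧ |z.2| ≤ 2 * ρ ^ 2}ᶜ with hE
  set F := {z : Rn1 n | ‖z.1‖ ≤ ρ ∧ |z.2| ≤ ρ ^ 2}ᶜ with hF
  have hEm : MeasurableSet E := (measurableSet_parBox _ _).compl
  have hFm : MeasurableSet F := (measurableSet_parBox _ _).compl
  have h1 : ∀ z ∈ E, z ∈ F := by
    intro z hz hzF
    refine hz ⟨hzF.1.trans (by linarith), hzF.2.trans (by nlinarith)⟩
  have h2 : ∀ z ∈ E, z - w ∈ F := by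
    intro z hz hzF
    refine hz ⟨?_, ?_⟩
    · have h := norm_add_le (z.1 - w.1) w.1
      rw [sub_add_cancel] at h
      have := hzF.1; simp only [Prod.fst_sub] at this; linarith
    · have h := abs_add_le (z.2 - w.2) w.2
      rw [sub_add_cancel] at h
      have := hzF.2; simp only [Prod.snd_sub] at this; linarith
  calc ∫⁻ z in E, ‖k (z - w) - k z‖ₑ ≤ ∫⁻ z in E, (‖k (z - w)‖ₑ + ‖k z‖ₑ) :=
        lintegral_mono fun z => enorm_sub_le
    _ = (∫⁻ z in E, ‖k (z - w)‖ₑ) + ∫⁻ z in E, ‖k z‖ₑ := lintegral_add_right _ (by fun_prop)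
    _ ≤ C * ENNReal.ofReal ρ⁻¹ + C * ENNReal.ofReal ρ⁻¹ := by
        refine add_le_add (le_trans ?_ (hk.tail ρ hρ)) (le_trans ?_ (hk.tail ρ hρ))
        · rw [← lintegral_indicator hEm, ← lintegral_indicator hFm,
            ← lintegral_sub_right_eq_self (fun z => F.indicator (fun z => ‖k z‖ₑ) z) w]
          refine lintegral_mono fun z => ?_
          by_cases hz : z ∈ E
          · rw [Set.indicator_of_mem hz, Set.indicator_of_mem (h2 z hz)]
          · rw [Set.indicator_of_notMem hz]; exact zero_le
        · exact lintegral_mono_set h1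
    _ = 2 * C * ENNReal.ofReal ρ⁻¹ := by ring

/-- Superposition of the `L¹`-normalised parabolic dilates of `k`, weighted by `c(r) dr/r`. -/
def supKer {n : ℕ} (c : ℝ → ℂ) (k : Rn1 n → ℂ) (a b : ℝ) (z : Rn1 n) : ℂ :=
  ∫ r in Set.Ioc a b, c r * (r⁻¹ * (r ^ (n + 2))⁻¹ : ℝ) * k (parDil r z)

section supKer

variable {n : ℕ} {c : ℝ → ℂ} {k : Rn1 n → ℂ} {a b : ℝ}

lemma norm_supKer_weight_le {M : ℝ} (ha : 0 < a) (hcM : ∀ r, ‖c r‖ ≤ M) {r : ℝ}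
    (hr : r ∈ Set.Ioc a b) (m : ℕ) :
    ‖c r * (r⁻¹ * (r ^ m)⁻¹ : ℝ)‖ ≤ M * (a⁻¹ * (a ^ m)⁻¹) := by
  have hr0 : 0 < r := ha.trans hr.1
  rw [norm_mul, Complex.norm_real, Real.norm_of_nonneg (by positivity)]
  have : 0 ≤ M := (norm_nonneg _).trans (hcM r)
  have := hr.1.le
  gcongr
  exact hcM r

lemma measurable_supKer_integrand (hc : Measurable c) (hk : Measurable k) :
    Measurable fun x : Rn1 n × ℝ =>
      c x.2 * (x.2⁻¹ * (x.2 ^ (n + 2))⁻¹ : ℝ) * k (parDil x.2 x.1) := by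
  refine Measurable.mul (by fun_prop) (hk.comp (by fun_prop))

lemma measurable_supKer (hc : Measurable c) (hk : Measurable k) : Measurable (supKer c k a b) := by
  unfold supKer
  exact ((measurable_supKer_integrand hc hk).stronglyMeasurable.integral_prod_right
    (ν := volume.restrict (Set.Ioc a b))).measurable

lemma integrable_supKer_integrand {M : ℝ} (ha : 0 < a) (hc : Measurable c) (hcM : ∀ r, ‖c r‖ ≤ M)
    (hk : Measurable k) (hki : Integrable k) :
    Integrable (fun x : Rn1 n × ℝ =>
      c x.2 * (x.2⁻¹ * (x.2 ^ (n + 2))⁻¹ : ℝ) * k (parDil x.2 x.1))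
      (volume.prod (volume.restrict (Set.Ioc a b))) := by
  refine (integrable_prod_iff' (measurable_supKer_integrand hc hk).aestronglyMeasurable).2 ⟨?_, ?_⟩
  · filter_upwards [ae_restrict_mem measurableSet_Ioc] with r hr
    exact (integrable_comp_parDil (ha.trans hr.1) hki).const_mul _
  · have hfin : IntegrableOn (fun _ : ℝ => M * a⁻¹ * ∫ z, ‖k z‖) (Set.Ioc a b) :=
      integrableOn_const (by simp)
    refine hfin.mono' ?_ ?_
    · exact (((measurable_supKer_integrand hc hk).norm.comp measurable_swap).stronglyMeasurable
        |>.integral_prod_right' (ν := volume)).aestronglyMeasurable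
    · filter_upwards [ae_restrict_mem measurableSet_Ioc] with r hr
      have hr0 := ha.trans hr.1
      rw [Real.norm_of_nonneg (integral_nonneg fun _ => norm_nonneg _)]
      have h := integral_comp_parDil hr0 (f := fun z => ((‖k z‖ : ℝ) : ℂ)) (by fun_prop)
      simp only [integral_complex_ofReal] at h
      norm_cast at h
      simp only [norm_mul, Complex.norm_real]
      rw [integral_const_mul, h, Real.norm_of_nonneg (by positivity : (0:ℝ) ≤ r⁻¹),
        Real.norm_of_nonneg (by positivity : (0:ℝ) ≤ (r ^ (n + 2))⁻¹)]
      have h0 : 0 ≤ ∫ z, ‖k z‖ := integral_nonneg fun _ => norm_nonneg _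
      have hM : 0 ≤ M := (norm_nonneg _).trans (hcM r)
      calc ‖c r‖ * (r⁻¹ * (r ^ (n + 2))⁻¹) * (r ^ (n + 2) * ∫ z, ‖k z‖)
          = ‖c r‖ * r⁻¹ * ∫ z, ‖k z‖ := by field_simp
        _ ≤ M * a⁻¹ * ∫ z, ‖k z‖ := by
          have := hr.1.le
          gcongr
          exact hcM r

lemma integrable_supKer {M : ℝ} (ha : 0 < a) (hc : Measurable c) (hcM : ∀ r, ‖c r‖ ≤ M)
    (hk : Measurable k) (hki : Integrable k) : Integrable (supKer c k a b) :=
  (integrable_supKer_integrand ha hc hcM hk hki).integral_prod_left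

lemma norm_supKer_le {M M' : ℝ} (ha : 0 < a) (hab : a ≤ b) (hcM : ∀ r, ‖c r‖ ≤ M)
    (hk : ∀ z, ‖k z‖ ≤ M') (z : Rn1 n) :
    ‖supKer c k a b z‖ ≤ M * (a⁻¹ * (a ^ (n + 2))⁻¹) * M' * (b - a) := by
  have h := norm_setIntegral_le_of_norm_le_const (μ := volume) (s := Set.Ioc a b)
    (f := fun r => c r * (r⁻¹ * (r ^ (n + 2))⁻¹ : ℝ) * k (parDil r z))
    (C := M * (a⁻¹ * (a ^ (n + 2))⁻¹) * M') (by simp) (fun r hr => ?_)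
  · rwa [Measure.real, Real.volume_Ioc, ENNReal.toReal_ofReal (by linarith)] at h
  · have h0 : 0 ≤ M := (norm_nonneg _).trans (hcM r)
    rw [norm_mul]
    exact mul_le_mul (norm_supKer_weight_le ha hcM hr _) (hk _) (norm_nonneg _) (by positivity)

lemma FT1_supKer {M : ℝ} (ha : 0 < a) (hc : Measurable c) (hcM : ∀ r, ‖c r‖ ≤ M)
    (hk : Measurable k) (hki : Integrable k) (q : Rn1 n) :
    FT1 (supKer c k a b) q =
      ∫ r in Set.Ioc a b, c r * (r⁻¹ : ℝ) * FT1 k (parDil r⁻¹ q) := by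
  have hi := integrable_supKer_integrand (b := b) ha hc hcM hk hki
  have hi' : Integrable (fun x : Rn1 n × ℝ => eChar (-(dotRn1 x.1 q)) *
      (c x.2 * (x.2⁻¹ * (x.2 ^ (n + 2))⁻¹ : ℝ) * k (parDil x.2 x.1)))
      (volume.prod (volume.restrict (Set.Ioc a b))) := by
    refine hi.bdd_mul (c := 1) ?_ (Filter.Eventually.of_forall fun x => by simp)
    exact (continuous_eChar.comp
      (continuous_dotRn1_comp continuous_fst continuous_const).neg).aestronglyMeasurable
  rw [FT1_eq]
  simp only [supKer, ← integral_const_mul]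
  rw [integral_integral_swap hi']
  refine setIntegral_congr_fun measurableSet_Ioc fun r hr => ?_
  have hr0 : 0 < r := ha.trans hr.1
  have h := FT1_comp_parDil hr0 hk q
  rw [FT1_eq] at h
  simp only [mul_left_comm (eChar _)]
  rw [integral_const_mul, h, Complex.ofReal_mul, Complex.ofReal_inv (r ^ (n + 2))]
  have : ((r ^ (n + 2) : ℝ) : ℂ) ≠ 0 := by exact_mod_cast (pow_pos hr0 _).ne'
  field_simp

lemma lintegral_inv_mul_min_le {R : ℝ} (hR : 0 < R) :
    ∫⁻ r in Set.Ioi 0, ENNReal.ofReal (r⁻¹ * min (R * r⁻¹) (R⁻¹ * r)) ≤ 2 := by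
  rw [← Set.Ioc_union_Ioi_eq_Ioi hR.le]
  refine (lintegral_union_le _ _ _).trans ?_
  have h1 : ∫⁻ r in Set.Ioc 0 R, ENNReal.ofReal (r⁻¹ * min (R * r⁻¹) (R⁻¹ * r)) ≤ 1 := by
    calc _ ≤ ∫⁻ r in Set.Ioc 0 R, ENNReal.ofReal R⁻¹ := by
          refine setLIntegral_mono (by fun_prop) fun r hr => ENNReal.ofReal_le_ofReal ?_
          have : 0 < r := hr.1
          calc r⁻¹ * min (R * r⁻¹) (R⁻¹ * r) ≤ r⁻¹ * (R⁻¹ * r) := by gcongr; exact min_le_right _ _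
            _ = R⁻¹ := by field_simp
      _ = 1 := by
          rw [setLIntegral_const, Real.volume_Ioc, sub_zero, ← ENNReal.ofReal_mul (by positivity),
            inv_mul_cancel₀ hR.ne', ENNReal.ofReal_one]
  have h2 : ∫⁻ r in Set.Ioi R, ENNReal.ofReal (r⁻¹ * min (R * r⁻¹) (R⁻¹ * r)) ≤ 1 := by
    calc _ ≤ ∫⁻ r in Set.Ioi R, ENNReal.ofReal R * ENNReal.ofReal (r ^ (-2 : ℝ)) := by
          refine setLIntegral_mono (by fun_prop) fun r hr => ?_
          have : 0 < r := hR.trans hr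
          rw [← ENNReal.ofReal_mul hR.le]
          refine ENNReal.ofReal_le_ofReal ?_
          calc r⁻¹ * min (R * r⁻¹) (R⁻¹ * r) ≤ r⁻¹ * (R * r⁻¹) := by gcongr; exact min_le_left _ _
            _ = R * r ^ (-2 : ℝ) := by
              rw [Real.rpow_neg this.le, Real.rpow_two]; field_simp
      _ = 1 := by
          rw [lintegral_const_mul _ (by fun_prop), lintegral_Ioi_rpow (by norm_num) hR,
            ← ENNReal.ofReal_mul hR.le, ← ENNReal.ofReal_one]
          congr 1
          norm_num
          rw [Real.rpow_neg_one]; field_simp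
  exact (add_le_add h1 h2).trans (by norm_num)

lemma KernelProfile.lintegral_dilate_le {C : ℝ≥0∞} (hk : KernelProfile k C) {R r : ℝ} (hR : 0 < R)
    (hr : 0 < r) {w : Rn1 n} (hw1 : ‖w.1‖ ≤ R) (hw2 : |w.2| ≤ R ^ 2) :
    ∫⁻ z in {z : Rn1 n | ‖z.1‖ ≤ 2 * R ∧ |z.2| ≤ 2 * R ^ 2}ᶜ,
        ‖k (parDil r (z - w)) - k (parDil r z)‖ₑ ≤
      ENNReal.ofReal (r ^ (n + 2)) * (2 * C * ENNReal.ofReal (min (R * r⁻¹) (R⁻¹ * r))) := by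
  have hm := hk.measurable
  set ρ := R * r⁻¹ with hρ
  have hρ0 : 0 < ρ := by positivity
  set E := {z : Rn1 n | ‖z.1‖ ≤ 2 * R ∧ |z.2| ≤ 2 * R ^ 2}ᶜ
  set F := {z : Rn1 n | ‖z.1‖ ≤ 2 * ρ ∧ |z.2| ≤ 2 * ρ ^ 2}ᶜ
  have hEm : MeasurableSet E := (measurableSet_parBox _ _).compl
  have hFm : MeasurableSet F := (measurableSet_parBox _ _).compl
  have hEF : ∀ z ∈ E, parDil r z ∈ F := by
    intro z hz hzF
    refine hz ⟨?_, ?_⟩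
    · have h := hzF.1
      simp only [parDil, norm_smul, Real.norm_eq_abs, abs_inv, abs_of_pos hr, hρ] at h
      rw [← mul_assoc, mul_comm r⁻¹] at h
      exact le_of_mul_le_mul_right h (by positivity)
    · have h := hzF.2
      simp only [parDil, abs_mul, abs_inv, abs_of_pos (pow_pos hr 2), hρ] at h
      rw [mul_pow, ← mul_assoc, mul_comm (r ^ 2)⁻¹, inv_pow] at h
      exact le_of_mul_le_mul_right h (by positivity)
  have hw1' : ‖(parDil r w).1‖ ≤ ρ := by
    simp only [parDil, norm_smul, Real.norm_eq_abs, abs_inv, abs_of_pos hr, hρ]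
    rw [mul_comm]; gcongr
  have hw2' : |(parDil r w).2| ≤ ρ ^ 2 := by
    simp only [parDil, abs_mul, abs_inv, abs_of_pos (pow_pos hr 2), hρ]
    rw [mul_comm, mul_pow, inv_pow]; gcongr
  calc _ ≤ ∫⁻ z, F.indicator (fun z => ‖k (z - parDil r w) - k z‖ₑ) (parDil r z) := by
        rw [← lintegral_indicator hEm]
        refine lintegral_mono fun z => ?_
        by_cases hz : z ∈ E
        · rw [Set.indicator_of_mem hz, Set.indicator_of_mem (hEF z hz), parDil_sub]
        · rw [Set.indicator_of_notMem hz]; exact zero_le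
    _ = ENNReal.ofReal (r ^ (n + 2)) * ∫⁻ z in F, ‖k (z - parDil r w) - k z‖ₑ := by
        rw [lintegral_comp_parDil hr (Measurable.indicator (by fun_prop) hFm),
          lintegral_indicator hFm]
    _ ≤ _ := by
        gcongr
        rcases min_choice ρ (R⁻¹ * r) with h | h <;> rw [h]
        · refine (setLIntegral_le_lintegral _ _).trans ((hk.modulus ρ hρ0 _ hw1' hw2').trans ?_)
          gcongr
          exact le_mul_of_one_le_left zero_le (by norm_num)
        · refine (hk.lintegral_sub_le hρ0 hw1' hw2').trans_eq ?_
          rw [hρ, mul_inv, inv_inv]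

lemma KernelProfile.hormanderBound_supKer {C : ℝ≥0∞} (hk : KernelProfile k C) {M : ℝ} (ha : 0 < a)
    (hc : Measurable c) (hcM : ∀ r, ‖c r‖ ≤ M) (hM : 0 ≤ M) :
    HormanderBound (supKer c k a b) (4 * ENNReal.ofReal M * C) := by
  intro R hR w hw1 hw2
  have hm := hk.measurable
  have hmeas : ∀ w : Rn1 n, Measurable fun x : Rn1 n × ℝ => k (parDil x.2 (x.1 - w)) := fun w =>
    hm.comp (by fun_prop)
  have hmeas' : Measurable fun x : Rn1 n × ℝ => k (parDil x.2 x.1) := hm.comp (by fun_prop)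
  have hint := (integrable_supKer_integrand (b := b) ha hc hcM hm hk.integrable)
  obtain ⟨M', hM'⟩ := hk.bounded
  have hint' : ∀ z, IntegrableOn (fun r : ℝ => c r * (r⁻¹ * (r ^ (n + 2))⁻¹ : ℝ) * k (parDil r z))
      (Set.Ioc a b) := fun z => by
    refine Measure.integrableOn_of_bounded (M := M * (a⁻¹ * (a ^ (n + 2))⁻¹) * M') (by simp)
      (by exact ((measurable_supKer_integrand hc hm).comp (by fun_prop : Measurable fun r : ℝ =>
        (z, r))).aestronglyMeasurable) ?_
    filter_upwards [ae_restrict_mem measurableSet_Ioc] with r hr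
    rw [norm_mul]
    exact mul_le_mul (norm_supKer_weight_le ha hcM hr _) (hM' _) (norm_nonneg _) (by positivity)
  set E := {z : Rn1 n | ‖z.1‖ ≤ 2 * R ∧ |z.2| ≤ 2 * R ^ 2}ᶜ
  calc ∫⁻ z in E, ‖supKer c k a b (z - w) - supKer c k a b z‖ₑ
      ≤ ∫⁻ z in E, ∫⁻ r in Set.Ioc a b, ENNReal.ofReal (M * (r⁻¹ * (r ^ (n + 2))⁻¹)) *
          ‖k (parDil r (z - w)) - k (parDil r z)‖ₑ := by
        refine lintegral_mono fun z => ?_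
        simp only [supKer]
        rw [← integral_sub (hint' _) (hint' _)]
        refine (enorm_integral_le_lintegral_enorm _).trans
          (setLIntegral_mono' measurableSet_Ioc fun r hr => ?_)
        have hr0 : 0 < r := ha.trans hr.1
        rw [← mul_sub, enorm_mul]
        gcongr
        rw [← ofReal_norm, norm_mul, Complex.norm_real, Real.norm_of_nonneg (by positivity)]
        exact ENNReal.ofReal_le_ofReal (by gcongr; exact hcM r)
    _ = ∫⁻ r in Set.Ioc a b, ∫⁻ z in E, ENNReal.ofReal (M * (r⁻¹ * (r ^ (n + 2))⁻¹)) *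
          ‖k (parDil r (z - w)) - k (parDil r z)‖ₑ := by
        refine lintegral_lintegral_swap (Measurable.aemeasurable ?_)
        exact Measurable.mul (by fun_prop) ((hmeas w).sub hmeas').enorm
    _ ≤ ∫⁻ r in Set.Ioc a b, 2 * ENNReal.ofReal M * C *
          ENNReal.ofReal (r⁻¹ * min (R * r⁻¹) (R⁻¹ * r)) := by
        refine setLIntegral_mono' measurableSet_Ioc fun r hr => ?_
        have hr0 : 0 < r := ha.trans hr.1
        rw [lintegral_const_mul' _ _ (by finiteness)]
        refine (mul_le_mul_right (hk.lintegral_dilate_le hR hr0 hw1 hw2) _).trans_eq ?_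
        rw [ENNReal.ofReal_mul hM, ENNReal.ofReal_mul (by positivity : 0 ≤ r⁻¹),
          ENNReal.ofReal_mul (by positivity : 0 ≤ r⁻¹)]
        have h1 : ENNReal.ofReal (r ^ (n + 2))⁻¹ * ENNReal.ofReal (r ^ (n + 2)) = 1 := by
          rw [← ENNReal.ofReal_mul (by positivity), inv_mul_cancel₀ (by positivity),
            ENNReal.ofReal_one]
        calc _ = (ENNReal.ofReal (r ^ (n + 2))⁻¹ * ENNReal.ofReal (r ^ (n + 2))) *
              (2 * ENNReal.ofReal M * C * (ENNReal.ofReal r⁻¹ *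
                ENNReal.ofReal (min (R * r⁻¹) (R⁻¹ * r)))) := by ring
          _ = _ := by rw [h1, one_mul]
    _ ≤ ∫⁻ r in Set.Ioi 0, 2 * ENNReal.ofReal M * C *
          ENNReal.ofReal (r⁻¹ * min (R * r⁻¹) (R⁻¹ * r)) :=
        lintegral_mono_set fun r hr => ha.trans hr.1
    _ = 2 * ENNReal.ofReal M * C *
          ∫⁻ r in Set.Ioi 0, ENNReal.ofReal (r⁻¹ * min (R * r⁻¹) (R⁻¹ * r)) :=
        lintegral_const_mul _ (by fun_prop)
    _ ≤ 2 * ENNReal.ofReal M * C * 2 := by gcongr; exact lintegral_inv_mul_min_le hR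
    _ = 4 * ENNReal.ofReal M * C := by ring

end supKer

/-- Multipliers given by a superposition of parabolic dilates of a profile. -/
theorem exists_eLpNorm_MOp_le_of_profile {n : ℕ} {c : ℝ → ℂ} {k : Rn1 n → ℂ} {C : ℝ≥0∞}
    (hC : C ≠ ⊤) (hk : KernelProfile k C) (hc : Measurable c) {M : ℝ} (hM : ∀ r, ‖c r‖ ≤ M) {A : ℝ}
    (hi : ∀ q, IntegrableOn (fun r : ℝ => c r * (r⁻¹ : ℝ) * FT1 k (parDil r⁻¹ q)) (Set.Ioi 0))
    (hA : ∀ q, ∫ r in Set.Ioi (0:ℝ), ‖c r * (r⁻¹ : ℝ) * FT1 k (parDil r⁻¹ q)‖ ≤ A)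
    {p : ℝ} (hp : 1 < p) :
    ∃ C' ≠ ⊤, ∀ f : SchwartzMap (Rn1 n) ℂ,
      eLpNorm (MOp (fun q => ∫ r in Set.Ioi (0:ℝ), c r * (r⁻¹ : ℝ) * FT1 k (parDil r⁻¹ q)) f)
        (ENNReal.ofReal p) volume ≤ C' * eLpNorm f (ENNReal.ofReal p) volume := by
  have hM0 : 0 ≤ M := (norm_nonneg _).trans (hM 0)
  have hA0 : 0 ≤ A := (integral_nonneg fun _ => norm_nonneg _).trans (hA 0)
  obtain ⟨C', hC', h⟩ := exists_eLpNorm_conv1_le n hA0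
    (B := 4 * ENNReal.ofReal M * C) (by finiteness) hp
  refine ⟨C', hC', fun f => ?_⟩
  let a : ℕ → ℝ := fun j => ((j : ℝ) + 1)⁻¹
  let b : ℕ → ℝ := fun j => (j : ℝ) + 1
  have ha : ∀ j, 0 < a j := fun j => by positivity
  have hab : ∀ j, a j ≤ b j := fun j => by
    have : (1:ℝ) ≤ (j : ℝ) + 1 := by linarith [(Nat.cast_nonneg j : (0:ℝ) ≤ j)]
    exact (inv_le_one_of_one_le₀ this).trans this
  have hK := fun j => integrable_supKer (b := b j) (ha j) hc hM hk.measurable hk.integrable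
  have hFT := fun j q => FT1_supKer (b := b j) (ha j) hc hM hk.measurable hk.integrable q
  have hKA : ∀ j q, ‖FT1 (supKer c k (a j) (b j)) q‖ ≤ A := fun j q => by
    rw [hFT]
    refine (norm_integral_le_integral_norm _).trans (le_trans ?_ (hA q))
    exact setIntegral_mono_set (hi q).norm (Filter.Eventually.of_forall fun _ => norm_nonneg _)
      (Filter.Eventually.of_forall fun r hr => (ha j).trans hr.1)
  have hU : ⋃ j, Set.Ioc (a j) (b j) = Set.Ioi 0 := by
    ext r
    simp only [Set.mem_iUnion, Set.mem_Ioc, Set.mem_Ioi]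
    refine ⟨fun ⟨j, hj⟩ => (ha j).trans hj.1, fun hr => ?_⟩
    obtain ⟨j, hj⟩ := exists_nat_gt (max r r⁻¹)
    refine ⟨j, ?_, ?_⟩
    · rw [inv_lt_comm₀ (by positivity) hr]
      linarith [le_max_right r r⁻¹]
    · linarith [le_max_left r r⁻¹]
  have hmono : Monotone fun j => Set.Ioc (a j) (b j) := by
    intro i j hij
    have : (i : ℝ) ≤ j := by exact_mod_cast hij
    refine Set.Ioc_subset_Ioc ?_ ?_
    · simp only [a]; gcongr
    · simp only [b]; gcongr
  refine eLpNorm_MOp_le_of_tendsto hK hKA (fun q => ?_) f fun j => ?_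
  · simp only [hFT]
    have := tendsto_setIntegral_of_monotone (μ := volume)
      (f := fun r : ℝ => c r * (r⁻¹ : ℝ) * FT1 k (parDil r⁻¹ q))
      (fun j => measurableSet_Ioc (a := a j) (b := b j)) hmono (by rw [hU]; exact hi q)
    rwa [hU] at this
  · obtain ⟨M', hM'⟩ := hk.bounded
    have hb := norm_supKer_le (c := c) (ha j) (hab j) hM hM'
    refine h _ (measurable_supKer hc hk.measurable) (hK j) ?_ (hKA j)
      (hk.hormanderBound_supKer (ha j) hc hM hM0) f
    exact (memLp_two_iff_integrable_sq_norm (hK j).1).2 (integrable_norm_sq_of_bdd (hK j) hb)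

section FourierSymbols

open scoped FourierTransform

lemma lintegral_enorm_sub_le_fderiv {E : Type*} [NormedAddCommGroup E] [NormedSpace ℝ E]
    [MeasurableSpace E] [BorelSpace E] [SecondCountableTopology E] {μ : Measure E} [SFinite μ]
    [μ.IsAddRightInvariant] {F : E → ℂ} (hF : ContDiff ℝ 1 F) (y : E) :
    ∫⁻ x, ‖F (x - y) - F x‖ₑ ∂μ ≤ (∫⁻ x, ‖fderiv ℝ F x‖ₑ ∂μ) * ‖y‖ₑ := by
  have hc : Continuous (fderiv ℝ F) := hF.continuous_fderiv (by norm_num)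
  have hpt : ∀ x, ‖F (x - y) - F x‖ₑ ≤ ∫⁻ s in Set.Ioc (0:ℝ) 1, ‖fderiv ℝ F (x - s • y)‖ₑ * ‖y‖ₑ := by
    intro x
    have hd : ∀ s ∈ Set.uIcc (0:ℝ) 1, HasDerivAt (fun s : ℝ => F (x - s • y))
        (fderiv ℝ F (x - s • y) (-y)) s := by
      intro s _
      have h1 : HasFDerivAt F (fderiv ℝ F (x - s • y)) (x - s • y) :=
        (hF.differentiable (by norm_num) _).hasFDerivAt
      have h2 : HasDerivAt (fun s : ℝ => x - s • y) (-y) s := by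
        simpa using ((hasDerivAt_id s).smul_const y).const_sub x
      exact h1.comp_hasDerivAt s h2
    have h := intervalIntegral.integral_eq_sub_of_hasDerivAt hd
      (Continuous.intervalIntegrable (by fun_prop) _ _)
    simp only [one_smul, zero_smul, sub_zero] at h
    rw [← h, intervalIntegral.integral_of_le zero_le_one]
    refine (enorm_integral_le_lintegral_enorm _).trans (lintegral_mono fun s => ?_)
    rw [← enorm_neg y]
    exact ContinuousLinearMap.le_opENorm _ _
  calc _ ≤ ∫⁻ x, (∫⁻ s in Set.Ioc (0:ℝ) 1, ‖fderiv ℝ F (x - s • y)‖ₑ * ‖y‖ₑ) ∂μ := lintegral_mono hpt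
    _ = ∫⁻ s in Set.Ioc (0:ℝ) 1, (∫⁻ x, ‖fderiv ℝ F (x - s • y)‖ₑ * ‖y‖ₑ ∂μ) := by
      refine lintegral_lintegral_swap (Continuous.aemeasurable ?_)
      refine ENNReal.continuous_mul_const (by finiteness) |>.comp ?_
      fun_prop
    _ = ∫⁻ s in Set.Ioc (0:ℝ) 1, (∫⁻ x, ‖fderiv ℝ F x‖ₑ ∂μ) * ‖y‖ₑ := by
      refine lintegral_congr fun s => ?_
      rw [lintegral_mul_const' _ _ (by finiteness),
        lintegral_sub_right_eq_self (fun x => ‖fderiv ℝ F x‖ₑ)]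
    _ = _ := by simp

/-- Spatial factors of a kernel profile. -/
structure SpaceProfile {n : ℕ} (Φ : Rn n → ℂ) (C : ℝ≥0∞) : Prop where
  measurable : Measurable Φ
  bounded : ∃ M, ∀ x, ‖Φ x‖ ≤ M
  mass : ∫⁻ x, ‖Φ x‖ₑ ≤ C
  moment : ∫⁻ x, ‖x‖ₑ * ‖Φ x‖ₑ ≤ C
  modulus : ∀ y, ∫⁻ x, ‖Φ (x - y) - Φ x‖ₑ ≤ C * ‖y‖ₑ

/-- Temporal factors of a kernel profile. -/
structure TimeProfile (Ψ : ℝ → ℂ) (C : ℝ≥0∞) : Prop where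
  measurable : Measurable Ψ
  bounded : ∃ M, ∀ t, ‖Ψ t‖ ≤ M
  mass : ∫⁻ t, ‖Ψ t‖ₑ ≤ C
  tail : ∀ ρ : ℝ, 0 < ρ → ∫⁻ t in {t : ℝ | |t| ≤ ρ ^ 2}ᶜ, ‖Ψ t‖ₑ ≤ C * ENNReal.ofReal ρ⁻¹
  modulus : ∀ ρ : ℝ, 0 < ρ → ∀ u : ℝ, |u| ≤ ρ ^ 2 → ∫⁻ t, ‖Ψ (t - u) - Ψ t‖ₑ ≤ C * ENNReal.ofReal ρ

lemma SpaceProfile.tail {n : ℕ} {Φ : Rn n → ℂ} {C : ℝ≥0∞} (h : SpaceProfile Φ C) {ρ : ℝ}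
    (hρ : 0 < ρ) : ∫⁻ x in {x : Rn n | ‖x‖ ≤ ρ}ᶜ, ‖Φ x‖ₑ ≤ C * ENNReal.ofReal ρ⁻¹ := by
  have hm := h.measurable
  have hms : MeasurableSet {x : Rn n | ‖x‖ ≤ ρ}ᶜ :=
    (isClosed_le (by fun_prop) (by fun_prop)).measurableSet.compl
  calc _ ≤ ∫⁻ x in {x : Rn n | ‖x‖ ≤ ρ}ᶜ, (‖x‖ₑ * ‖Φ x‖ₑ) * ENNReal.ofReal ρ⁻¹ := by
        refine setLIntegral_mono' hms fun x hx => ?_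
        have hx' : ρ ≤ ‖x‖ := by
          simp only [Set.mem_compl_iff, Set.mem_ofPred_eq, not_le] at hx
          exact hx.le
        have h1 : 1 ≤ ‖x‖ₑ * ENNReal.ofReal ρ⁻¹ := by
          rw [← ofReal_norm, ← ENNReal.ofReal_mul (norm_nonneg _), ← ENNReal.ofReal_one]
          refine ENNReal.ofReal_le_ofReal ?_
          rw [← div_eq_mul_inv, one_le_div hρ]; exact hx'
        calc ‖Φ x‖ₑ ≤ ‖Φ x‖ₑ * (‖x‖ₑ * ENNReal.ofReal ρ⁻¹) := le_mul_of_one_le_right zero_le h1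
          _ = _ := by ring
    _ ≤ ∫⁻ x, (‖x‖ₑ * ‖Φ x‖ₑ) * ENNReal.ofReal ρ⁻¹ := setLIntegral_le_lintegral _ _
    _ = (∫⁻ x, ‖x‖ₑ * ‖Φ x‖ₑ) * ENNReal.ofReal ρ⁻¹ := lintegral_mul_const' _ _ (by finiteness)
    _ ≤ _ := by gcongr; exact h.moment

lemma SpaceProfile.integrable {n : ℕ} {Φ : Rn n → ℂ} {C : ℝ≥0∞} (h : SpaceProfile Φ C)
    (hC : C ≠ ⊤) : Integrable Φ :=
  ⟨h.measurable.aestronglyMeasurable, h.mass.trans_lt hC.lt_top⟩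

lemma TimeProfile.integrable {Ψ : ℝ → ℂ} {C : ℝ≥0∞} (h : TimeProfile Ψ C) (hC : C ≠ ⊤) :
    Integrable Ψ :=
  ⟨h.measurable.aestronglyMeasurable, h.mass.trans_lt hC.lt_top⟩

lemma KernelProfile.of_tensor {n : ℕ} {Φ : Rn n → ℂ} {Ψ : ℝ → ℂ} {C D : ℝ≥0∞}
    (hΦ : SpaceProfile Φ C) (hC : C ≠ ⊤) (hΨ : TimeProfile Ψ D) (hD : D ≠ ⊤) :
    KernelProfile (fun z : Rn1 n => Φ z.1 * Ψ z.2) (2 * C * D) where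
  measurable := (hΦ.measurable.comp measurable_fst).mul (hΨ.measurable.comp measurable_snd)
  integrable := (hΦ.integrable hC).mul_prod (hΨ.integrable hD)
  bounded := by
    obtain ⟨M, hM⟩ := hΦ.bounded
    obtain ⟨M', hM'⟩ := hΨ.bounded
    refine ⟨M * M', fun z => ?_⟩
    rw [norm_mul]
    exact mul_le_mul (hM _) (hM' _) (norm_nonneg _) ((norm_nonneg _).trans (hM z.1))
  modulus := by
    intro ρ hρ w hw1 hw2
    have h1 := hΦ.measurable
    have h2 := hΨ.measurable
    calc _ ≤ ∫⁻ z : Rn1 n, (‖Φ (z.1 - w.1) - Φ z.1‖ₑ * ‖Ψ (z.2 - w.2)‖ₑ +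
          ‖Φ z.1‖ₑ * ‖Ψ (z.2 - w.2) - Ψ z.2‖ₑ) := by
          refine lintegral_mono fun z => ?_
          rw [← enorm_mul, ← enorm_mul]
          refine le_trans (le_of_eq ?_) (enorm_add_le _ _)
          congr 1
          simp only [Prod.fst_sub, Prod.snd_sub]; ring
      _ = (∫⁻ x, ‖Φ (x - w.1) - Φ x‖ₑ) * (∫⁻ t, ‖Ψ (t - w.2)‖ₑ) +
          (∫⁻ x, ‖Φ x‖ₑ) * ∫⁻ t, ‖Ψ (t - w.2) - Ψ t‖ₑ := by
          rw [lintegral_add_left (by fun_prop), Measure.volume_eq_prod]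
          rw [lintegral_prod_mul (f := fun x => ‖Φ (x - w.1) - Φ x‖ₑ)
            (g := fun t => ‖Ψ (t - w.2)‖ₑ) (by fun_prop) (by fun_prop),
            lintegral_prod_mul (f := fun x => ‖Φ x‖ₑ) (g := fun t => ‖Ψ (t - w.2) - Ψ t‖ₑ)
            (by fun_prop) (by fun_prop)]
      _ ≤ (C * ENNReal.ofReal ρ) * D + C * (D * ENNReal.ofReal ρ) := by
          gcongr
          · refine (hΦ.modulus _).trans ?_
            gcongr
            rw [← ofReal_norm]
            exact ENNReal.ofReal_le_ofReal hw1
          · rw [lintegral_sub_right_eq_self (fun t => ‖Ψ t‖ₑ)]; exact hΨ.mass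
          · exact hΦ.mass
          · exact hΨ.modulus ρ hρ _ hw2
      _ = _ := by ring
  tail := by
    intro ρ hρ
    have h1 := hΦ.measurable
    have h2 := hΨ.measurable
    have hsub : {z : Rn1 n | ‖z.1‖ ≤ ρ ∧ |z.2| ≤ ρ ^ 2}ᶜ ⊆
        ({x : Rn n | ‖x‖ ≤ ρ}ᶜ ×ˢ Set.univ) ∪ (Set.univ ×ˢ {t : ℝ | |t| ≤ ρ ^ 2}ᶜ) := by
      intro z hz
      by_cases h : ‖z.1‖ ≤ ρ
      · exact Or.inr ⟨trivial, fun h' => hz ⟨h, h'⟩⟩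
      · exact Or.inl ⟨h, trivial⟩
    calc _ ≤ _ := lintegral_mono_set hsub
      _ ≤ _ := lintegral_union_le _ _ _
      _ = (∫⁻ x in {x : Rn n | ‖x‖ ≤ ρ}ᶜ, ‖Φ x‖ₑ) * (∫⁻ t, ‖Ψ t‖ₑ) +
          (∫⁻ x, ‖Φ x‖ₑ) * ∫⁻ t in {t : ℝ | |t| ≤ ρ ^ 2}ᶜ, ‖Ψ t‖ₑ := by
          simp only [Measure.volume_eq_prod, enorm_mul, ← Measure.prod_restrict,
            Measure.restrict_univ]
          rw [lintegral_prod_mul (f := fun x => ‖Φ x‖ₑ) (g := fun t => ‖Ψ t‖ₑ) (by fun_prop)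
            (by fun_prop), lintegral_prod_mul (f := fun x => ‖Φ x‖ₑ) (g := fun t => ‖Ψ t‖ₑ)
            (by fun_prop) (by fun_prop)]
      _ ≤ (C * ENNReal.ofReal ρ⁻¹) * D + C * (D * ENNReal.ofReal ρ⁻¹) := by
          gcongr
          · exact hΦ.tail hρ
          · exact hΨ.mass
          · exact hΦ.mass
          · exact hΨ.tail ρ hρ
      _ = _ := by ring

lemma FT1_tensor {n : ℕ} (Φ : Rn n → ℂ) (Ψ : ℝ → ℂ) (q : Rn1 n) :
    FT1 (fun z : Rn1 n => Φ z.1 * Ψ z.2) q = 𝓕 Φ q.1 * 𝓕 Ψ q.2 := by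
  rw [Real.fourier_eq', Real.fourier_eq', ← integral_prod_mul, ← Measure.volume_eq_prod, FT1]
  refine integral_congr_ae (Filter.Eventually.of_forall fun z => ?_)
  simp only [smul_eq_mul]
  rw [mul_mul_mul_comm, ← Complex.exp_add]
  congr 2
  simp only [PiLp.inner_apply, RCLike.inner_apply, conj_trivial]
  push_cast
  simp only [mul_comm (Complex.ofReal (z.1.ofLp _))]
  ring

section Gaussian

variable {n : ℕ}

lemma norm_cexp_neg_mul_norm_sq (b : ℂ) (x : Rn n) :
    ‖cexp (-b * ‖x‖ ^ 2)‖ = Real.exp (-b.re * ‖x‖ ^ 2) := by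
  rw [Complex.norm_exp, ← Complex.ofReal_pow, Complex.re_mul_ofReal, Complex.neg_re]

lemma integrable_exp_neg_mul_norm_sq {β : ℝ} (hβ : 0 < β) :
    Integrable fun x : Rn n => Real.exp (-β * ‖x‖ ^ 2) := by
  have h := (GaussianFourier.integrable_cexp_neg_mul_sq_norm_add (b := (β : ℂ)) (V := Rn n)
    (by simpa using hβ) 0 0).norm
  simp only [zero_mul, add_zero] at h
  simpa only [norm_cexp_neg_mul_norm_sq, Complex.ofReal_re] using h

lemma one_add_sq_mul_exp_le {β : ℝ} (hβ : 0 < β) {u : ℝ} (hu : 0 ≤ u) :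
    (1 + u) ^ 2 * Real.exp (-β * u ^ 2) ≤ Real.exp (2 / β) * Real.exp (-(β / 2) * u ^ 2) := by
  have h1 : (1 + u) ^ 2 ≤ Real.exp (2 * u) := by
    have := Real.add_one_le_exp u
    calc (1 + u) ^ 2 ≤ (Real.exp u) ^ 2 := by gcongr; linarith
      _ = Real.exp (2 * u) := by rw [← Real.exp_nat_mul]; norm_num
  calc _ ≤ Real.exp (2 * u) * Real.exp (-β * u ^ 2) := by gcongr
    _ ≤ _ := by
      rw [← Real.exp_add, ← Real.exp_add, Real.exp_le_exp]
      have h : 0 ≤ (β * u - 2) ^ 2 / (2 * β) := by positivity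
      have h' : (β * u - 2) ^ 2 / (2 * β) = β / 2 * u ^ 2 - 2 * u + 2 / β := by
        field_simp; ring
      linarith

lemma integrable_one_add_sq_mul_exp {β : ℝ} (hβ : 0 < β) :
    Integrable fun x : Rn n => (1 + ‖x‖) ^ 2 * Real.exp (-β * ‖x‖ ^ 2) := by
  refine ((integrable_exp_neg_mul_norm_sq (n := n) (half_pos hβ)).const_mul
    (Real.exp (2 / β))).mono' (by fun_prop) (Filter.Eventually.of_forall fun x => ?_)
  rw [Real.norm_of_nonneg (by positivity)]
  exact one_add_sq_mul_exp_le hβ (norm_nonneg x)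

lemma hasFDerivAt_cexp_neg_mul_norm_sq (b : ℂ) (x : Rn n) :
    HasFDerivAt (fun x : Rn n => cexp (-b * ‖x‖ ^ 2))
      (cexp (-b * ‖x‖ ^ 2) • (-b) • (Complex.ofRealCLM.comp (2 • innerSL ℝ x))) x := by
  have h := Complex.ofRealCLM.hasFDerivAt.comp x (hasStrictFDerivAt_norm_sq x).hasFDerivAt
  have h2 := (h.const_mul (-b)).cexp
  simpa only [Function.comp_def, Complex.ofRealCLM_apply, Complex.ofReal_pow] using h2

lemma contDiff_cexp_neg_mul_norm_sq (b : ℂ) :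
    ContDiff ℝ 1 (fun x : Rn n => cexp (-b * ‖x‖ ^ 2)) := by
  have h : ContDiff ℝ 1 fun x : Rn n => ((‖x‖ ^ 2 : ℝ) : ℂ) :=
    Complex.ofRealCLM.contDiff.comp (contDiff_norm_sq ℝ)
  simp only [Complex.ofReal_pow] at h
  exact (contDiff_const.mul h).cexp

lemma exists_spaceProfile_affine_gaussian {b : ℂ} (hb : 0 < b.re) (α : ℂ) (ℓ : Rn n →L[ℝ] ℂ) :
    Integrable (fderiv ℝ fun x : Rn n => (α + ℓ x) * cexp (-b * ‖x‖ ^ 2)) ∧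
      ∃ C ≠ ⊤, SpaceProfile (fun x : Rn n => (α + ℓ x) * cexp (-b * ‖x‖ ^ 2)) C := by
  set Φ : Rn n → ℂ := fun x => (α + ℓ x) * cexp (-b * ‖x‖ ^ 2) with hΦ
  have hcd : ContDiff ℝ 1 Φ :=
    (contDiff_const.add ℓ.contDiff).mul (contDiff_cexp_neg_mul_norm_sq b)
  set A := ‖α‖ + ‖ℓ‖
  have hA : 0 ≤ A := by positivity
  set G : Rn n → ℝ := fun x => (1 + ‖x‖) ^ 2 * Real.exp (-b.re * ‖x‖ ^ 2) with hG
  have hGi : Integrable G := integrable_one_add_sq_mul_exp hb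
  have hG0 : ∀ x, 0 ≤ G x := fun x => by positivity
  set K := A * (1 + 2 * ‖b‖) with hK
  have hK0 : 0 ≤ K := by positivity
  have haff : ∀ x, ‖α + ℓ x‖ ≤ A * (1 + ‖x‖) := fun x => by
    refine (norm_add_le _ _).trans ?_
    have := ℓ.le_opNorm x
    have h1 : 0 ≤ ‖α‖ * ‖x‖ := by positivity
    have h2 := norm_nonneg ℓ
    simp only [A]; linarith
  have hAK : A ≤ K := by
    have : 0 ≤ A * (2 * ‖b‖) := by positivity
    linarith
  have hval : ∀ x, (1 + ‖x‖) * ‖Φ x‖ ≤ K * G x := fun x => by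
    simp only [hΦ, hG, norm_mul, norm_cexp_neg_mul_norm_sq]
    calc _ ≤ (1 + ‖x‖) * ((A * (1 + ‖x‖)) * Real.exp (-b.re * ‖x‖ ^ 2)) := by
          gcongr; exact haff x
      _ = A * ((1 + ‖x‖) ^ 2 * Real.exp (-b.re * ‖x‖ ^ 2)) := by ring
      _ ≤ _ := by gcongr
  have hfd : ∀ x, ‖fderiv ℝ Φ x‖ ≤ K * G x := fun x => by
    have h := ((ℓ.hasFDerivAt (x := x)).const_add α).mul (hasFDerivAt_cexp_neg_mul_norm_sq b x)
    rw [show fderiv ℝ Φ x = _ from h.fderiv]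
    refine (norm_add_le _ _).trans ?_
    have hin : ‖Complex.ofRealCLM.comp (2 • innerSL ℝ x)‖ ≤ 2 * ‖x‖ := by
      refine (ContinuousLinearMap.opNorm_comp_le _ _).trans ?_
      rw [Complex.ofRealCLM_norm, one_mul, two_smul, two_mul]
      refine (norm_add_le _ _).trans ?_
      rw [innerSL_apply_norm]
    rw [norm_smul, norm_smul, norm_smul, norm_smul, norm_cexp_neg_mul_norm_sq, norm_neg]
    set e := Real.exp (-b.re * ‖x‖ ^ 2)
    have hx := norm_nonneg x
    calc _ ≤ (A * (1 + ‖x‖)) * (e * (‖b‖ * (2 * ‖x‖))) + e * ‖ℓ‖ := by gcongr; exact haff x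
      _ ≤ (A * (1 + ‖x‖)) * (e * (‖b‖ * (2 * (1 + ‖x‖)))) + e * (A * (1 + ‖x‖) ^ 2) := by
          gcongr
          · linarith
          · calc ‖ℓ‖ ≤ A * 1 := by simp only [A]; linarith [norm_nonneg α]
              _ ≤ A * (1 + ‖x‖) ^ 2 := by gcongr; nlinarith
      _ = K * G x := by simp only [hG, hK]; ring
  have hfin : ∫⁻ x, ENNReal.ofReal (K * G x) ≠ ⊤ := by
    have := (hGi.const_mul K).lintegral_lt_top
    exact this.ne
  refine ⟨(hGi.const_mul K).mono' (hcd.continuous_fderiv (by norm_num)).aestronglyMeasurable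
    (Filter.Eventually.of_forall hfd), _, hfin, hcd.continuous.measurable,
    ⟨K * Real.exp (2 / b.re), fun x => ?_⟩, ?_, ?_,
    fun y => ?_⟩
  · have h1 := hval x
    have h2 : ‖Φ x‖ ≤ (1 + ‖x‖) * ‖Φ x‖ :=
      le_mul_of_one_le_left (norm_nonneg _) (by linarith [norm_nonneg x])
    refine h2.trans (h1.trans ?_)
    gcongr
    refine (one_add_sq_mul_exp_le hb (norm_nonneg x)).trans ?_
    refine mul_le_of_le_one_right (by positivity) (Real.exp_le_one_iff.2 ?_)
    have : 0 ≤ b.re / 2 * ‖x‖ ^ 2 := by positivity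
    linarith
  · refine lintegral_mono fun x => ?_
    rw [← ofReal_norm]
    refine ENNReal.ofReal_le_ofReal (le_trans ?_ (hval x))
    exact le_mul_of_one_le_left (norm_nonneg _) (by linarith [norm_nonneg x])
  · refine lintegral_mono fun x => ?_
    rw [← ofReal_norm, ← ofReal_norm, ← ENNReal.ofReal_mul (norm_nonneg _)]
    refine ENNReal.ofReal_le_ofReal (le_trans ?_ (hval x))
    gcongr
    linarith
  · refine (lintegral_enorm_sub_le_fderiv hcd y).trans ?_
    gcongr with x
    rw [← ofReal_norm]
    exact ENNReal.ofReal_le_ofReal (hfd x)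

lemma quarter_inv_re_pos {w : ℂ} (hw : 0 < w.re) : 0 < ((4 * w)⁻¹).re := by
  have h : w ≠ 0 := by rintro rfl; simp at hw
  rw [Complex.inv_re]
  have : 0 < (4 * w).re := by simpa using hw
  exact div_pos this (Complex.normSq_pos.2 (by simpa using h))

lemma fourier_gaussian_quarter {w : ℂ} (hw : 0 < w.re) (ξ : Rn n) :
    𝓕 (fun x : Rn n => cexp (-(4 * w)⁻¹ * ‖x‖ ^ 2)) ξ =
      (π / (4 * w)⁻¹) ^ ((n : ℂ) / 2) * cexp (-(4 * π ^ 2 * w * ‖ξ‖ ^ 2)) := by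
  rw [fourier_gaussian_innerProductSpace (quarter_inv_re_pos hw), finrank_euclideanSpace_fin]
  congr 2
  rw [div_inv_eq_mul]; ring

lemma gaussian_const_ne_zero {w : ℂ} (hw : 0 < w.re) :
    ((π : ℂ) / (4 * w)⁻¹) ^ ((n : ℂ) / 2) ≠ 0 := by
  have h : w ≠ 0 := by rintro rfl; simp at hw
  rw [Complex.cpow_ne_zero_iff]
  left
  rw [div_inv_eq_mul]
  simpa [Real.pi_ne_zero] using h

lemma exists_spaceProfile_gaussian {w : ℂ} (hw : 0 < w.re) :
    ∃ Φ : Rn n → ℂ, ∃ C ≠ ⊤, SpaceProfile Φ C ∧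
      ∀ ξ, 𝓕 Φ ξ = cexp (-(4 * π ^ 2 * w * ‖ξ‖ ^ 2)) := by
  set c := ((π : ℂ) / (4 * w)⁻¹) ^ ((n : ℂ) / 2) with hc
  have hc0 : c ≠ 0 := gaussian_const_ne_zero hw
  obtain ⟨-, C, hC, h⟩ := exists_spaceProfile_affine_gaussian (n := n) (quarter_inv_re_pos hw) c⁻¹ 0
  refine ⟨_, C, hC, h, fun ξ => ?_⟩
  simp only [_root_.zero_apply, add_zero]
  have := fourier_gaussian_quarter (n := n) hw ξ
  rw [Real.fourier_eq] at this ⊢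
  simp only [← smul_eq_mul (c⁻¹), smul_comm _ c⁻¹]
  rw [integral_smul, this, ← hc, smul_eq_mul, inv_mul_cancel_left₀ hc0]

lemma exists_spaceProfile_coord_gaussian {w : ℂ} (hw : 0 < w.re) (k : Fin n) :
    ∃ Φ : Rn n → ℂ, ∃ C ≠ ⊤, SpaceProfile Φ C ∧
      ∀ ξ, 𝓕 Φ ξ = ξ k * cexp (-(4 * π ^ 2 * w * ‖ξ‖ ^ 2)) := by
  set c := ((π : ℂ) / (4 * w)⁻¹) ^ ((n : ℂ) / 2) with hc
  have hc0 : c ≠ 0 := gaussian_const_ne_zero hw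
  set b := (4 * w)⁻¹ with hb
  have hbre : 0 < b.re := quarter_inv_re_pos hw
  set d : ℂ := (2 * π * I * c)⁻¹ with hd
  let ℓ : Rn n →L[ℝ] ℂ := (-(2 * b * d)) • Complex.ofRealCLM.comp (EuclideanSpace.proj k)
  set g : Rn n → ℂ := fun x => cexp (-b * ‖x‖ ^ 2) with hg
  obtain ⟨-, C, hC, h⟩ := exists_spaceProfile_affine_gaussian (n := n) hbre 0 ℓ
  refine ⟨_, C, hC, h, fun ξ => ?_⟩
  have hgi : Integrable g := by
    simpa [hg] using GaussianFourier.integrable_cexp_neg_mul_sq_norm_add (V := Rn n) hbre 0 0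
  have hgd : ∀ x, HasFDerivAt g _ x := hasFDerivAt_cexp_neg_mul_norm_sq b
  have hgf : Integrable (fderiv ℝ g) := by
    simpa [hg] using (exists_spaceProfile_affine_gaussian (n := n) hbre 1 0).1
  have hF := congrFun (Real.fourier_fderiv hgi (fun x => (hgd x).differentiableAt) hgf) ξ
  have hF' := congrArg (fun L : Rn n →L[ℝ] ℂ => L (EuclideanSpace.single k 1)) hF
  rw [Real.fourier_eq] at hF'
  have hint : Integrable fun v : Rn n => Real.fourierChar (-inner ℝ v ξ) • fderiv ℝ g v :=
    (Real.fourierIntegral_convergent_iff ξ).2 hgf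
  simp only [ContinuousLinearMap.integral_apply hint, VectorFourier.fourierSMulRight_apply] at hF'
  rw [fourier_gaussian_quarter hw, ← hc] at hF'
  have hval : ∀ v, (0 + ℓ v) * g v = d * fderiv ℝ g v (EuclideanSpace.single k 1) := fun v => by
    rw [(hgd v).fderiv]
    simp [ℓ, hg, PiLp.inner_apply]
    ring
  rw [Real.fourier_eq]
  calc _ = ∫ v, d * (Real.fourierChar (-inner ℝ v ξ) • fderiv ℝ g v) (EuclideanSpace.single k 1) := by
        refine integral_congr_ae (Filter.Eventually.of_forall fun v => ?_)
        simp only [Circle.smul_def]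
        rw [show (0 + ℓ v) * cexp (-b * ‖v‖ ^ 2) = _ from hval v]
        simp only [_root_.smul_apply, smul_eq_mul]
        ring
    _ = d * _ := integral_const_mul _ _
    _ = _ := by
        have hin : innerSL ℝ ξ (EuclideanSpace.single k 1) = ξ k := by simp [PiLp.inner_apply]
        rw [hF', hd]
        simp only [_root_.neg_apply, hin, neg_smul, smul_eq_mul,
          Complex.real_smul, mul_inv]
        field_simp

end Gaussian

lemma integral_sq_mul_cexp_neg_mul_sq {z : ℂ} (hz : 0 < z.re) :
    ∫ u : ℝ in Set.Ioi 0, (u : ℂ) ^ 2 * cexp (-z * u ^ 2) =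
      (2 * z)⁻¹ * ((π / z) ^ (1 / 2 : ℂ) / 2) := by
  have hz0 : z ≠ 0 := by rintro rfl; simp at hz
  have hi0 : Integrable fun u : ℝ => cexp (-z * u ^ 2) := integrable_cexp_neg_mul_sq hz
  have hi1 : Integrable fun u : ℝ => (u : ℂ) * cexp (-z * u ^ 2) := integrable_mul_cexp_neg_mul_sq hz
  have hi2 : Integrable fun u : ℝ => (u : ℂ) ^ 2 * cexp (-z * u ^ 2) := by
    have h := integrable_rpow_mul_exp_neg_mul_sq hz (s := 2) (by norm_num)
    refine h.mono (by fun_prop) (Filter.Eventually.of_forall fun u => ?_)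
    rw [norm_mul, norm_mul, norm_cexp_neg_mul_sq, Real.norm_eq_abs (Real.exp _), Real.abs_exp,
      Real.rpow_two]
    simp
  have hd : ∀ u : ℝ, HasDerivAt (fun u : ℝ => (u : ℂ) * cexp (-z * u ^ 2))
      (cexp (-z * u ^ 2) - 2 * z * ((u : ℂ) ^ 2 * cexp (-z * u ^ 2))) u := fun u => by
    have h1 : HasDerivAt (fun u : ℝ => (u : ℂ)) 1 u := Complex.ofRealCLM.hasDerivAt
    have h2 := h1.mul (((h1.pow 2).const_mul (-z)).cexp)
    refine h2.congr_deriv ?_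
    simp only [Pi.pow_apply]
    ring
  have hi' := hi0.sub (hi2.const_mul (2 * z))
  have hlim := tendsto_zero_of_hasDerivAt_of_integrableOn_Ioi (a := 0) (fun u _ => hd u)
    hi'.integrableOn hi1.integrableOn
  have h := integral_Ioi_of_hasDerivAt_of_tendsto (a := 0) (hd 0).continuousAt.continuousWithinAt
    (fun u _ => hd u) hi'.integrableOn hlim
  rw [integral_sub hi0.integrableOn (hi2.const_mul (2 * z)).integrableOn, integral_const_mul,
    integral_gaussian_complex_Ioi hz] at h
  simp only [Complex.ofReal_zero, zero_mul, sub_zero] at h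
  rw [eq_comm, inv_mul_eq_iff_eq_mul₀ (by simpa using hz0)]
  linear_combination h

lemma integral_rpow_half_mul_cexp {z : ℂ} (hz : 0 < z.re) :
    ∫ τ : ℝ in Set.Ioi 0, ((τ ^ (1 / 2 : ℝ) : ℝ) : ℂ) * cexp (-z * τ) =
      (2 * π : ℂ)⁻¹ * (z / π) ^ ((-3 / 2 : ℝ) : ℂ) := by
  have hz0 : z ≠ 0 := by rintro rfl; simp at hz
  have hπ : (π : ℂ) ≠ 0 := by exact_mod_cast Real.pi_ne_zero
  have hzp : z / π ≠ 0 := div_ne_zero hz0 hπ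
  have hre : 0 < (z / π).re := by rw [Complex.div_ofReal_re]; positivity
  rw [← integral_comp_rpow_Ioi_of_pos (p := 2) (by norm_num)]
  calc _ = ∫ u : ℝ in Set.Ioi 0, 2 * ((u : ℂ) ^ 2 * cexp (-z * u ^ 2)) := by
        refine setIntegral_congr_fun measurableSet_Ioi fun u hu => ?_
        have hu0 : (0:ℝ) ≤ u := le_of_lt hu
        simp only [Real.rpow_two]
        rw [← Real.sqrt_eq_rpow, Real.sqrt_sq hu0, Complex.real_smul]
        norm_num
        ring
    _ = z⁻¹ * ((z / π)⁻¹ ^ (1 / 2 : ℂ) / 2) := by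
        rw [integral_const_mul, integral_sq_mul_cexp_neg_mul_sq hz, inv_div]
        field_simp
    _ = _ := by
        have harg : (z / π).arg ≠ π := by
          intro h
          rw [Complex.arg_eq_pi_iff] at h
          linarith [h.1]
        rw [Complex.inv_cpow _ _ harg, ← Complex.cpow_neg,
          show ((-3 / 2 : ℝ) : ℂ) = -(1 / 2) + -1 by push_cast; ring, Complex.cpow_add _ _ hzp,
          Complex.cpow_neg_one, inv_div]
        field_simp

lemma TimeProfile.of_contDiff {Ψ : ℝ → ℂ} (hΨ : ContDiff ℝ 1 Ψ) {K : ℝ}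
    (h0 : ∀ t, ‖Ψ t‖ ≤ K * (1 + |t|) ^ (-(3 / 2) : ℝ))
    (h1 : ∀ t, ‖deriv Ψ t‖ ≤ K * (1 + |t|) ^ (-(3 / 2) : ℝ)) :
    ∃ C ≠ ⊤, TimeProfile Ψ C := by
  have hK : 0 ≤ K := by
    have := (norm_nonneg _).trans (h0 0)
    simpa using this
  have hi : Integrable fun t : ℝ => K * (1 + |t|) ^ (-(3 / 2) : ℝ) :=
    (integrable_one_add_norm (E := ℝ) (by norm_num)).const_mul K
  set D := ∫⁻ t : ℝ, ENNReal.ofReal (K * (1 + |t|) ^ (-(3 / 2) : ℝ)) with hD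
  have hDtop : D ≠ ⊤ := hi.lintegral_lt_top.ne
  have hmass : ∫⁻ t, ‖Ψ t‖ₑ ≤ D := lintegral_mono fun t => by
    rw [← ofReal_norm]; exact ENNReal.ofReal_le_ofReal (h0 t)
  have hm : Measurable Ψ := hΨ.continuous.measurable
  refine ⟨2 * D + ENNReal.ofReal (4 * K), by finiteness, hm, ⟨K, fun t => ?_⟩,
    hmass.trans ?_, fun ρ hρ => ?_, fun ρ hρ u hu => ?_⟩
  · refine (h0 t).trans (mul_le_of_le_one_right hK ?_)
    exact Real.rpow_le_one_of_one_le_of_nonpos (by linarith [abs_nonneg t]) (by norm_num)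
  · calc D ≤ 2 * D := le_mul_of_one_le_left zero_le (by norm_num)
      _ ≤ _ := le_self_add
  · have hρ2 : (0:ℝ) < ρ ^ 2 := by positivity
    have hpos : ∫⁻ t in Set.Ioi (ρ ^ 2), ENNReal.ofReal (K * t ^ (-(3 / 2) : ℝ)) =
        ENNReal.ofReal (2 * K * ρ⁻¹) := by
      simp_rw [ENNReal.ofReal_mul hK]
      rw [lintegral_const_mul _ (by fun_prop), lintegral_Ioi_rpow (by norm_num) hρ2,
        ← ENNReal.ofReal_mul hK]
      congr 1
      rw [← Real.rpow_natCast, ← Real.rpow_mul hρ.le]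
      norm_num
      rw [Real.rpow_neg_one]
      ring
    have hbd : ∀ s t : ℝ, ρ ^ 2 < t → |s| = t → ‖Ψ s‖ₑ ≤ ENNReal.ofReal (K * t ^ (-(3 / 2) : ℝ)) := by
      intro s t ht hst
      rw [← ofReal_norm]
      refine ENNReal.ofReal_le_ofReal ((h0 s).trans ?_)
      rw [hst]
      gcongr K * ?_
      exact Real.rpow_le_rpow_of_nonpos (hρ2.trans ht) (by linarith) (by norm_num)
    have hsub : {t : ℝ | |t| ≤ ρ ^ 2}ᶜ ⊆ Set.Ioi (ρ ^ 2) ∪ Set.Iio (-ρ ^ 2) := by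
      intro t ht
      simp only [Set.mem_compl_iff, Set.mem_ofPred_eq, not_le, lt_abs] at ht
      rcases ht with ht | ht
      · exact Or.inl ht
      · exact Or.inr (by simp only [Set.mem_Iio]; linarith)
    calc _ ≤ _ := lintegral_mono_set hsub
      _ ≤ _ := lintegral_union_le _ _ _
      _ ≤ ENNReal.ofReal (2 * K * ρ⁻¹) + ENNReal.ofReal (2 * K * ρ⁻¹) := by
          refine add_le_add ?_ ?_
          · rw [← hpos]
            exact setLIntegral_mono' measurableSet_Ioi fun t ht =>
              hbd t t ht (abs_of_pos (hρ2.trans ht))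
          · rw [← hpos]
            have hneg : ∫⁻ t in Set.Iio (-ρ ^ 2), ‖Ψ t‖ₑ = ∫⁻ t in Set.Ioi (ρ ^ 2), ‖Ψ (-t)‖ₑ := by
              rw [← lintegral_indicator measurableSet_Iio, ← lintegral_indicator measurableSet_Ioi,
                ← lintegral_neg_eq_self]
              refine lintegral_congr fun t => ?_
              by_cases ht : ρ ^ 2 < t
              · rw [Set.indicator_of_mem (by simpa using ht), Set.indicator_of_mem (by simpa using ht)]
              · rw [Set.indicator_of_notMem (by simpa using ht),
                  Set.indicator_of_notMem (by simpa using ht)]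
            rw [hneg]
            exact setLIntegral_mono' measurableSet_Ioi fun t ht =>
              hbd (-t) t ht (by rw [abs_neg, abs_of_pos (hρ2.trans ht)])
      _ = ENNReal.ofReal (4 * K) * ENNReal.ofReal ρ⁻¹ := by
          rw [← ENNReal.ofReal_add (by positivity) (by positivity),
            ← ENNReal.ofReal_mul (by positivity)]
          congr 1; ring
      _ ≤ _ := by gcongr; exact le_add_self
  · suffices H : ∫⁻ t, ‖Ψ (t - u) - Ψ t‖ₑ ≤ 2 * D * ENNReal.ofReal ρ by
      refine H.trans ?_
      gcongr
      exact le_self_add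
    rcases le_total ρ 1 with h | h
    · refine (lintegral_enorm_sub_le_fderiv hΨ u).trans ?_
      calc _ ≤ D * ENNReal.ofReal ρ := by
            gcongr
            · refine lintegral_mono fun t => ?_
              rw [← ofReal_norm, ← norm_deriv_eq_norm_fderiv]
              exact ENNReal.ofReal_le_ofReal (h1 t)
            · rw [← ofReal_norm]
              refine ENNReal.ofReal_le_ofReal (hu.trans ?_)
              nlinarith
        _ ≤ _ := by gcongr; exact le_mul_of_one_le_left zero_le (by norm_num)
    · calc _ ≤ ∫⁻ t, (‖Ψ (t - u)‖ₑ + ‖Ψ t‖ₑ) := lintegral_mono fun t => enorm_sub_le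
        _ = (∫⁻ t, ‖Ψ (t - u)‖ₑ) + ∫⁻ t, ‖Ψ t‖ₑ := lintegral_add_right _ (by fun_prop)
        _ ≤ D + D := by
            rw [lintegral_sub_right_eq_self (fun t => ‖Ψ t‖ₑ)]; gcongr
        _ = 2 * D := by ring
        _ ≤ _ := le_mul_of_one_le_right zero_le (by simpa using h)

/-- The inverse Fourier transform of the half-line symbol `τ₊^{1/2} e^{-vτ}`. -/
def halfKer (v : ℂ) (t : ℝ) : ℂ :=
  (2 * π : ℂ)⁻¹ * ((v - 2 * π * I * t) / π) ^ ((-3 / 2 : ℝ) : ℂ)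

/-- The half-line symbol `τ₊^{1/2} e^{-vτ}`. -/
def halfSym (v : ℂ) (τ : ℝ) : ℂ := ((max τ 0 ^ (1 / 2 : ℝ) : ℝ) : ℂ) * cexp (-v * τ)

lemma halfSym_of_nonpos (v : ℂ) {τ : ℝ} (h : τ ≤ 0) : halfSym v τ = 0 := by
  simp [halfSym, max_eq_right h]

lemma halfSym_of_nonneg (v : ℂ) {τ : ℝ} (h : 0 ≤ τ) :
    halfSym v τ = ((τ ^ (1 / 2 : ℝ) : ℝ) : ℂ) * cexp (-v * τ) := by
  simp [halfSym, max_eq_left h]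

lemma continuous_halfSym (v : ℂ) : Continuous (halfSym v) := by
  unfold halfSym
  refine (continuous_ofReal.comp ((continuous_id.max continuous_const).rpow_const ?_)).mul
    (by fun_prop)
  exact fun _ => Or.inr (by norm_num)

lemma norm_halfSym (v : ℂ) {τ : ℝ} (h : 0 ≤ τ) :
    ‖halfSym v τ‖ = τ ^ (1 / 2 : ℝ) * Real.exp (-v.re * τ) := by
  rw [halfSym_of_nonneg v h, norm_mul, Complex.norm_exp, Complex.norm_of_nonneg (by positivity)]
  simp

lemma integrable_halfSym {v : ℂ} (hv : 0 < v.re) : Integrable (halfSym v) := by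
  have h : IntegrableOn (halfSym v) (Set.Ioi 0) := by
    have h0 := integrableOn_rpow_mul_exp_neg_mul_rpow (p := 1) (s := 1 / 2) (b := v.re)
      (by norm_num) (by norm_num) hv
    refine h0.mono' (continuous_halfSym v).aestronglyMeasurable ?_
    filter_upwards [ae_restrict_mem measurableSet_Ioi] with τ hτ
    rw [norm_halfSym v (le_of_lt hτ), Real.rpow_one]
  rw [← integrableOn_univ, ← Set.Iic_union_Ioi (a := (0:ℝ)), integrableOn_union]
  refine ⟨?_, h⟩
  exact integrableOn_zero.congr_fun (fun τ hτ => (halfSym_of_nonpos v hτ).symm) measurableSet_Iic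

lemma fourierInv_halfSym {v : ℂ} (hv : 0 < v.re) : 𝓕⁻ (halfSym v) = halfKer v := by
  funext t
  have hz : 0 < (v - 2 * π * I * t).re := by simpa using hv
  rw [Real.fourierInv_eq', halfKer, ← integral_rpow_half_mul_cexp hz,
    ← setIntegral_eq_integral_of_forall_compl_eq_zero (s := Set.Ioi (0:ℝ))]
  · refine setIntegral_congr_fun measurableSet_Ioi fun τ hτ => ?_
    simp only [halfSym_of_nonneg v (le_of_lt hτ), smul_eq_mul]
    rw [mul_left_comm, ← Complex.exp_add]
    congr 2
    simp only [RCLike.inner_apply, conj_trivial]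
    push_cast
    ring
  · intro τ hτ
    rw [halfSym_of_nonpos v (by simpa using hτ), smul_zero]

lemma hasDerivAt_halfKer {v : ℂ} (hv : 0 < v.re) (t : ℝ) :
    HasDerivAt (halfKer v) ((3 * I / (2 * π)) *
      ((v - 2 * π * I * t) / π) ^ ((-5 / 2 : ℝ) : ℂ)) t := by
  have hπ : (π : ℂ) ≠ 0 := by exact_mod_cast Real.pi_ne_zero
  have h1 : HasDerivAt (fun s : ℂ => (v - 2 * π * I * s) / π) (-(2 * π * I) / π) (t : ℂ) := by
    simpa using (((hasDerivAt_id (t : ℂ)).const_mul (2 * π * I)).const_sub v).div_const (π : ℂ)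
  have hs : (v - 2 * π * I * (t : ℂ)) / π ∈ slitPlane := by
    left
    rw [Complex.div_ofReal_re]
    have : (v - 2 * π * I * t).re = v.re := by simp
    rw [this]; positivity
  have h2 := ((h1.cpow_const (c := ((-3 / 2 : ℝ) : ℂ)) hs).const_mul (2 * π : ℂ)⁻¹).comp_ofReal
  refine h2.congr_deriv ?_
  rw [show ((-3 / 2 : ℝ) : ℂ) - 1 = ((-5 / 2 : ℝ) : ℂ) by push_cast; ring]
  push_cast
  field_simp

lemma exists_norm_halfKer_le {v : ℂ} (hv : 0 < v.re) : ∃ K : ℝ, ∀ t : ℝ,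
    ‖halfKer v t‖ ≤ K * (1 + |t|) ^ (-(3 / 2) : ℝ) ∧
    ‖deriv (halfKer v) t‖ ≤ K * (1 + |t|) ^ (-(3 / 2) : ℝ) := by
  have hπ := Real.pi_gt_three
  set L := π / v.re + ‖v‖ / (2 * v.re) + 1 / 2 with hL
  have hLpos : 0 < L := by positivity
  refine ⟨(1 + L) * L ^ (3 / 2 : ℝ), fun t => ?_⟩
  set z := (v - 2 * π * I * t) / π with hz
  have hzre : v.re / π ≤ ‖z‖ := by
    refine le_trans (le_of_eq ?_) (Complex.re_le_norm z)
    rw [hz, Complex.div_ofReal_re]; simp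
  have hz0 : 0 < ‖z‖ := lt_of_lt_of_le (by positivity) hzre
  have h1 : 1 ≤ π / v.re * ‖z‖ := by
    calc 1 = π / v.re * (v.re / π) := by field_simp
      _ ≤ _ := by gcongr
  have ht : |t| ≤ (‖v‖ + π * ‖z‖) / (2 * π) := by
    rw [le_div_iff₀ (by positivity)]
    have : (2 * π * I * t : ℂ) = v - π * z := by
      rw [hz]; field_simp; ring
    calc |t| * (2 * π) = ‖(2 * π * I * t : ℂ)‖ := by
          simp [abs_of_pos Real.pi_pos]; ring
      _ ≤ ‖v‖ + ‖(π * z : ℂ)‖ := by rw [this]; exact norm_sub_le _ _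
      _ = _ := by rw [norm_mul, Complex.norm_of_nonneg Real.pi_pos.le]
  have hle : 1 + |t| ≤ L * ‖z‖ := by
    calc 1 + |t| ≤ π / v.re * ‖z‖ + (‖v‖ * (π / v.re * ‖z‖) + π * ‖z‖) / (2 * π) := by
          refine add_le_add h1 (ht.trans ?_)
          gcongr
          exact le_mul_of_one_le_right (norm_nonneg _) h1
      _ = _ := by rw [hL]; field_simp; ring
  have hpow : ‖z‖ ^ (-(3 / 2) : ℝ) ≤ L ^ (3 / 2 : ℝ) * (1 + |t|) ^ (-(3 / 2) : ℝ) := by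
    have h2 : (L * ‖z‖) ^ (-(3 / 2) : ℝ) ≤ (1 + |t|) ^ (-(3 / 2) : ℝ) :=
      Real.rpow_le_rpow_of_nonpos (by positivity) hle (by norm_num)
    calc ‖z‖ ^ (-(3 / 2) : ℝ) = L ^ (3 / 2 : ℝ) * (L * ‖z‖) ^ (-(3 / 2) : ℝ) := by
          rw [Real.mul_rpow hLpos.le hz0.le, ← mul_assoc, ← Real.rpow_add hLpos]
          norm_num
      _ ≤ _ := by gcongr
  have hinv : ‖z‖⁻¹ ≤ L := by
    rw [inv_le_iff_one_le_mul₀ hz0]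
    linarith [abs_nonneg t]
  have hnn : 0 ≤ (1 + |t|) ^ (-(3 / 2) : ℝ) := by positivity
  constructor
  · rw [halfKer, ← hz, norm_mul, Complex.norm_cpow_real, show (-3 / 2 : ℝ) = -(3 / 2) by ring]
    have h3 : ‖(2 * π : ℂ)⁻¹‖ ≤ 1 := by
      rw [norm_inv, norm_mul, Complex.norm_of_nonneg Real.pi_pos.le]
      refine inv_le_one_of_one_le₀ ?_
      norm_num; linarith
    calc _ ≤ (1 + L) * (L ^ (3 / 2 : ℝ) * (1 + |t|) ^ (-(3 / 2) : ℝ)) := by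
          refine mul_le_mul (h3.trans (by linarith)) hpow (by positivity) (by positivity)
      _ = _ := by ring
  · rw [(hasDerivAt_halfKer hv t).deriv, ← hz, norm_mul, Complex.norm_cpow_real,
      show (-5 / 2 : ℝ) = -(3 / 2) + -1 by ring, Real.rpow_add hz0, Real.rpow_neg_one]
    have h3 : ‖(3 * I / (2 * π) : ℂ)‖ ≤ 1 := by
      rw [norm_div, norm_mul, norm_mul, Complex.norm_of_nonneg Real.pi_pos.le]
      rw [div_le_one (by norm_num; linarith)]
      norm_num; linarith
    calc _ ≤ 1 * ((L ^ (3 / 2 : ℝ) * (1 + |t|) ^ (-(3 / 2) : ℝ)) * L) := by gcongr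
      _ = L * (L ^ (3 / 2 : ℝ) * (1 + |t|) ^ (-(3 / 2) : ℝ)) := by ring
      _ ≤ (1 + L) * (L ^ (3 / 2 : ℝ) * (1 + |t|) ^ (-(3 / 2) : ℝ)) := by gcongr; linarith
      _ = _ := by ring

lemma contDiff_halfKer {v : ℂ} (hv : 0 < v.re) : ContDiff ℝ 1 (halfKer v) := by
  rw [contDiff_one_iff_deriv]
  refine ⟨fun t => (hasDerivAt_halfKer hv t).differentiableAt, ?_⟩
  rw [show deriv (halfKer v) = _ from funext fun t => (hasDerivAt_halfKer hv t).deriv]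
  refine continuous_const.mul (Continuous.cpow (by fun_prop) continuous_const fun t => ?_)
  left
  rw [Complex.div_ofReal_re]
  have : (v - 2 * π * I * t).re = v.re := by simp
  rw [this]; positivity

lemma fourier_halfKer {v : ℂ} (hv : 0 < v.re) : 𝓕 (halfKer v) = halfSym v := by
  have hK : Integrable (halfKer v) := by
    obtain ⟨K, hb⟩ := exists_norm_halfKer_le hv
    exact ((integrable_one_add_norm (E := ℝ) (by norm_num)).const_mul K).mono'
      (contDiff_halfKer hv).continuous.aestronglyMeasurable (.of_forall fun t => (hb t).1)
  rw [← fourierInv_halfSym hv]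
  refine (continuous_halfSym v).fourier_fourierInv_eq (integrable_halfSym hv) ?_
  have h : 𝓕 (halfSym v) = fun τ => halfKer v (-τ) := by
    funext τ
    rw [← fourierInv_halfSym hv, Real.fourierInv_eq_fourier_neg, neg_neg]
  rw [h]
  exact hK.comp_neg

lemma exists_timeProfile_halfKer {v : ℂ} (hv : 0 < v.re) :
    ∃ C ≠ ⊤, TimeProfile (halfKer v) C := by
  obtain ⟨K, hb⟩ := exists_norm_halfKer_le hv
  exact TimeProfile.of_contDiff (contDiff_halfKer hv) (fun t => (hb t).1) fun t => (hb t).2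

lemma exists_timeProfile_halfKer_neg {v : ℂ} (hv : 0 < v.re) :
    ∃ C ≠ ⊤, TimeProfile (fun t => halfKer v (-t)) C := by
  obtain ⟨K, hb⟩ := exists_norm_halfKer_le hv
  refine TimeProfile.of_contDiff (K := K) ((contDiff_halfKer hv).comp contDiff_neg)
    (fun t => by simpa using (hb (-t)).1) fun t => ?_
  rw [deriv_comp_neg, norm_neg]
  simpa using (hb (-t)).2

lemma fourier_halfKer_neg {v : ℂ} (hv : 0 < v.re) (τ : ℝ) :
    𝓕 (fun t => halfKer v (-t)) τ = halfSym v (-τ) := by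
  rw [← fourier_halfKer hv]
  exact Real.fourier_comp_linearIsometry (LinearIsometryEquiv.neg ℝ) (halfKer v) τ

/-- The heat symbol `1 + 4π²|ξ|² + iτ`. -/
def heatSym {n : ℕ} (q : Rn1 n) : ℂ := 1 + 4 * (π : ℂ) ^ 2 * (‖q.1‖ : ℂ) ^ 2 + Complex.I * (q.2 : ℂ)

lemma heatSym_re_pos {n : ℕ} (q : Rn1 n) : 0 < (heatSym q).re := by
  have h : (heatSym q).re = 1 + 4 * π ^ 2 * ‖q.1‖ ^ 2 := by
    simp [heatSym, ← Complex.ofReal_pow, Complex.mul_re]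
  rw [h]; positivity

lemma heatSym_ne_zero {n : ℕ} (q : Rn1 n) : heatSym q ≠ 0 := by
  intro h
  simpa [h] using heatSym_re_pos q

lemma continuous_heatSym {n : ℕ} : Continuous (heatSym (n := n)) := by
  unfold heatSym
  fun_prop

lemma norm_fourier_le_integral_norm {V : Type*} [NormedAddCommGroup V] [InnerProductSpace ℝ V]
    [MeasurableSpace V] [BorelSpace V] [FiniteDimensional ℝ V] (f : V → ℂ) (w : V) :
    ‖𝓕 f w‖ ≤ ∫ v, ‖f v‖ :=
  VectorFourier.norm_fourierIntegral_le_integral_norm _ _ _ _ _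

lemma halfSym_sq_mul (v : ℂ) {r : ℝ} (hr : 0 ≤ r) (t : ℝ) :
    halfSym v (r ^ 2 * t) = r * halfSym v t * cexp (v * t) * cexp (-v * (r ^ 2 * t : ℝ)) := by
  rcases le_total t 0 with ht | ht
  · rw [halfSym_of_nonpos v ht, halfSym_of_nonpos v (mul_nonpos_of_nonneg_of_nonpos (by positivity) ht)]
    simp
  · rw [halfSym_of_nonneg v ht, halfSym_of_nonneg v (by positivity),
      Real.mul_rpow (by positivity) ht, ← Real.sqrt_eq_rpow, Real.sqrt_sq hr]
    have : cexp (-v * t) * cexp (v * t) = 1 := by rw [← Complex.exp_add]; simp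
    push_cast
    linear_combination (-(r * ((t ^ (1 / 2 : ℝ) : ℝ) : ℂ) * cexp (-v * (r ^ 2 * t)))) * this

/-- `L²(dr)`-type bound along parabolic dilations for the half-line symbol. -/
lemma integral_norm_halfSym_sq_mul_le {v : ℂ} (hv : 0 < v.re) (t : ℝ) :
    IntegrableOn (fun r : ℝ => r⁻¹ * ‖halfSym v (r ^ 2 * t)‖) (Set.Ioi 0) ∧
    ∫ r in Set.Ioi (0:ℝ), r⁻¹ * ‖halfSym v (r ^ 2 * t)‖ ≤ √(π / v.re) := by
  rcases le_or_gt t 0 with ht | ht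
  · have h : ∀ r : ℝ, r⁻¹ * ‖halfSym v (r ^ 2 * t)‖ = 0 := fun r => by
      rw [halfSym_of_nonpos v (mul_nonpos_of_nonneg_of_nonpos (by positivity) ht)]; simp
    simp_rw [h]
    simp
  · have h : ∀ r ∈ Set.Ioi (0:ℝ), t ^ (1 / 2 : ℝ) * Real.exp (-(v.re * t) * r ^ 2) =
        r⁻¹ * ‖halfSym v (r ^ 2 * t)‖ := fun r hr => by
      have hr : 0 < r := hr
      rw [norm_halfSym v (by positivity), Real.mul_rpow (by positivity) ht.le,
        ← Real.sqrt_eq_rpow (r ^ 2), Real.sqrt_sq hr.le]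
      field_simp
    constructor
    · exact ((integrable_exp_neg_mul_sq (by positivity)).const_mul _).integrableOn.congr_fun h
        measurableSet_Ioi
    · rw [← setIntegral_congr_fun measurableSet_Ioi h, integral_const_mul, integral_gaussian_Ioi,
        ← Real.sqrt_eq_rpow, ← mul_div_assoc, ← Real.sqrt_mul ht.le]
      rw [show t * (π / (v.re * t)) = π / v.re by field_simp]
      linarith [Real.sqrt_nonneg (π / v.re)]

/-- One-sided half-derivative symbols are `Lᵖ` multipliers. -/
lemma exists_eLpNorm_MOp_half_le {n : ℕ} {Φ : Rn n → ℂ} {Ψ : ℝ → ℂ} {D E : ℝ≥0∞}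
    (hΦ : SpaceProfile Φ D) (hD : D ≠ ⊤) (hΨ : TimeProfile Ψ E) (hE : E ≠ ⊤)
    {ω v : ℂ} (hω : 0 < ω.re) (hv : 0 < v.re) {σ : ℝ} (hσ : σ ^ 2 = 1) (hvω : v = σ * I * ω)
    (hΨf : ∀ τ, 𝓕 Ψ τ = halfSym v (σ * τ))
    {c : ℝ → ℂ} (hc : Measurable c) {M : ℝ} (hM : ∀ r, ‖c r‖ ≤ M) {g : Rn n → ℂ}
    (hg : ∀ r : ℝ, 0 < r → ∀ ξ, c r * (r⁻¹ : ℝ) * 𝓕 Φ (r • ξ) =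
      g ξ * (2 * ω * cexp (-(ω * (1 + 4 * π ^ 2 * ‖ξ‖ ^ 2)) * r ^ 2)))
    {p : ℝ} (hp : 1 < p) :
    (∃ A : ℝ, ∀ q : Rn1 n, ‖g q.1 * ((max (σ * q.2) 0 ^ (1 / 2 : ℝ) : ℝ) : ℂ) / heatSym q‖ ≤ A) ∧
    ∃ C ≠ ⊤, ∀ f : SchwartzMap (Rn1 n) ℂ,
      eLpNorm (MOp (fun q => g q.1 * ((max (σ * q.2) 0 ^ (1 / 2 : ℝ) : ℝ) : ℂ) / heatSym q) f)
        (ENNReal.ofReal p) volume ≤ C * eLpNorm f (ENNReal.ofReal p) volume := by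
  set k : Rn1 n → ℂ := fun z => Φ z.1 * Ψ z.2
  have hM0 : 0 ≤ M := (norm_nonneg _).trans (hM 0)
  have hFT : ∀ (q : Rn1 n) (r : ℝ), FT1 k (parDil r⁻¹ q) =
      𝓕 Φ (r • q.1) * halfSym v (r ^ 2 * (σ * q.2)) := fun q r => by
    rw [FT1_tensor, hΨf]
    simp only [parDil, inv_inv, inv_pow]
    rw [mul_left_comm]
  set N := ∫ x, ‖Φ x‖
  have hN : 0 ≤ N := integral_nonneg fun _ => norm_nonneg _
  have hbd : ∀ (q : Rn1 n) (r : ℝ), r ∈ Set.Ioi (0:ℝ) →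
      ‖c r * (r⁻¹ : ℝ) * FT1 k (parDil r⁻¹ q)‖ ≤
        (M * N) * (r⁻¹ * ‖halfSym v (r ^ 2 * (σ * q.2))‖) := fun q r hr => by
    have hr : 0 < r := hr
    rw [hFT, norm_mul, norm_mul, norm_mul, Complex.norm_of_nonneg (inv_nonneg.2 hr.le)]
    calc _ ≤ M * r⁻¹ * (N * ‖halfSym v (r ^ 2 * (σ * q.2))‖) := by
          gcongr
          · exact hM r
          · exact norm_fourier_le_integral_norm _ _
      _ = _ := by ring
  have hcont : Continuous (FT1 k) := by
    refine continuous_FT1 ?_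
    exact (hΦ.integrable hD).mul_prod (hΨ.integrable hE)
  have hi : ∀ q, IntegrableOn (fun r : ℝ => c r * (r⁻¹ : ℝ) * FT1 k (parDil r⁻¹ q)) (Set.Ioi 0) := by
    intro q
    refine ((integral_norm_halfSym_sq_mul_le hv (σ * q.2)).1.const_mul (M * N)).mono' ?_ ?_
    · refine Measurable.aestronglyMeasurable ?_
      refine (hc.mul (by fun_prop)).mul (hcont.measurable.comp ?_)
      unfold parDil
      fun_prop
    · filter_upwards [ae_restrict_mem measurableSet_Ioi] with r hr using hbd q r hr
  have hA : ∀ q, ∫ r in Set.Ioi (0:ℝ), ‖c r * (r⁻¹ : ℝ) * FT1 k (parDil r⁻¹ q)‖ ≤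
      M * N * √(π / v.re) := fun q => by
    refine (setIntegral_mono_on (hi q).norm
      ((integral_norm_halfSym_sq_mul_le hv (σ * q.2)).1.const_mul (M * N)) measurableSet_Ioi
      (hbd q)).trans ?_
    rw [integral_const_mul]
    gcongr
    exact (integral_norm_halfSym_sq_mul_le hv (σ * q.2)).2
  have hsym : ∀ q : Rn1 n, ∫ r in Set.Ioi (0:ℝ), c r * (r⁻¹ : ℝ) * FT1 k (parDil r⁻¹ q) =
      g q.1 * ((max (σ * q.2) 0 ^ (1 / 2 : ℝ) : ℝ) : ℂ) / heatSym q := fun q => by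
    have hω0 : ω ≠ 0 := by rintro rfl; simp at hω
    have h : ∀ r ∈ Set.Ioi (0:ℝ), c r * (r⁻¹ : ℝ) * FT1 k (parDil r⁻¹ q) =
        (g q.1 * (2 * ω) * ((max (σ * q.2) 0 ^ (1 / 2 : ℝ) : ℝ) : ℂ)) *
          (r * cexp (-(ω * heatSym q) * r ^ 2)) := fun r hr => by
      rw [hFT, ← mul_assoc, hg r hr, halfSym_sq_mul v (le_of_lt hr)]
      have he : cexp (-(ω * heatSym q) * r ^ 2) =
          cexp (-(ω * (1 + 4 * π ^ 2 * ‖q.1‖ ^ 2)) * r ^ 2) *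
            cexp (-v * (r ^ 2 * (σ * q.2) : ℝ)) := by
        rw [← Complex.exp_add]
        congr 1
        have hσ' : (σ : ℂ) ^ 2 = 1 := by exact_mod_cast hσ
        rw [hvω, heatSym]
        push_cast
        linear_combination (ω * I * q.2 * r ^ 2) * hσ'
      have h1 : cexp (-v * (σ * q.2 : ℝ)) * cexp (v * (σ * q.2 : ℝ)) = 1 := by
        rw [← Complex.exp_add]; simp
      rw [he, halfSym]
      linear_combination (g q.1 * (2 * ω) * ((max (σ * q.2) 0 ^ (1 / 2 : ℝ) : ℝ) : ℂ) * r *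
        cexp (-(ω * (1 + 4 * π ^ 2 * ‖q.1‖ ^ 2)) * r ^ 2) *
        cexp (-v * (r ^ 2 * (σ * q.2) : ℝ))) * h1
    rw [setIntegral_congr_fun measurableSet_Ioi h, integral_const_mul]
    rcases le_or_gt (σ * q.2) 0 with ht | ht
    · simp [max_eq_right ht]
    · have hre : 0 < (ω * heatSym q).re := by
        have hσ' : (σ : ℂ) ^ 2 = 1 := by exact_mod_cast hσ
        have : ω * heatSym q = ω * ((1 + 4 * π ^ 2 * ‖q.1‖ ^ 2 : ℝ) : ℂ) + v * (σ * q.2 : ℝ) := by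
          rw [hvω, heatSym]
          push_cast
          linear_combination (-(ω * I * q.2)) * hσ'
        rw [this, Complex.add_re, Complex.re_mul_ofReal, Complex.re_mul_ofReal]
        positivity
      rw [integral_mul_cexp_neg_mul_sq hre]
      have := heatSym_ne_zero q
      field_simp
  simp_rw [← hsym]
  refine ⟨⟨_, fun q => (norm_integral_le_integral_norm _).trans (hA q)⟩, ?_⟩
  exact exists_eLpNorm_MOp_le_of_profile (by finiteness) (KernelProfile.of_tensor hΦ hD hΨ hE)
    hc hM hi hA hp

lemma eLpNorm_MOp_add_le {n : ℕ} {m₁ m₂ : Rn1 n → ℂ} (hm₁ : AEStronglyMeasurable m₁)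
    (hm₂ : AEStronglyMeasurable m₂) {A₁ A₂ : ℝ} (hA₁ : ∀ q, ‖m₁ q‖ ≤ A₁) (hA₂ : ∀ q, ‖m₂ q‖ ≤ A₂)
    (f : SchwartzMap (Rn1 n) ℂ) {p : ℝ≥0∞} (hp : 1 ≤ p) :
    eLpNorm (MOp (fun q => m₁ q + m₂ q) f) p volume ≤
      eLpNorm (MOp m₁ f) p volume + eLpNorm (MOp m₂ f) p volume := by
  have h₁ := integrable_bdd_mul_FT1 hm₁ hA₁ f
  have h₂ := integrable_bdd_mul_FT1 hm₂ hA₂ f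
  have h : MOp (fun q => m₁ q + m₂ q) f = MOp m₁ f + MOp m₂ f := by
    funext x
    simp only [MOp, Pi.add_apply, add_mul]
    rw [IFT1_eq, IFT1_eq, IFT1_eq, ← integral_add]
    · simp only [mul_add]
    · exact integrable_eChar_mul h₁ (continuous_dotRn1_comp continuous_id continuous_const)
    · exact integrable_eChar_mul h₂ (continuous_dotRn1_comp continuous_id continuous_const)
  rw [h]
  exact eLpNorm_add_le (continuous_IFT1 h₁).aestronglyMeasurable
    (continuous_IFT1 h₂).aestronglyMeasurable hp

/-- Two-sided half-derivative symbols are `Lᵖ` multipliers. -/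
lemma exists_eLpNorm_MOp_abs_half_le {n : ℕ} {g : Rn n → ℂ} (hgm : Measurable g)
    (H : ∀ ω : ℂ, 0 < ω.re → ∃ Φ : Rn n → ℂ, ∃ D ≠ ⊤, SpaceProfile Φ D ∧
      ∃ (c : ℝ → ℂ) (M : ℝ), Measurable c ∧ (∀ r, ‖c r‖ ≤ M) ∧
        ∀ r : ℝ, 0 < r → ∀ ξ, c r * (r⁻¹ : ℝ) * 𝓕 Φ (r • ξ) =
          g ξ * (2 * ω * cexp (-(ω * (1 + 4 * π ^ 2 * ‖ξ‖ ^ 2)) * r ^ 2)))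
    {p : ℝ} (hp : 1 < p) :
    ∃ C ≠ ⊤, ∀ f : SchwartzMap (Rn1 n) ℂ,
      eLpNorm (MOp (fun q => g q.1 * ((|q.2| ^ (1 / 2 : ℝ) : ℝ) : ℂ) / heatSym q) f)
        (ENNReal.ofReal p) volume ≤ C * eLpNorm f (ENNReal.ofReal p) volume := by
  have hω₁ : 0 < (1 - I).re := by simp
  have hω₂ : 0 < (1 + I).re := by simp
  obtain ⟨Φ₁, D₁, hD₁, hΦ₁, c₁, M₁, hc₁, hM₁, hg₁⟩ := H _ hω₁
  obtain ⟨Φ₂, D₂, hD₂, hΦ₂, c₂, M₂, hc₂, hM₂, hg₂⟩ := H _ hω₂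
  obtain ⟨E₁, hE₁, hΨ₁⟩ := exists_timeProfile_halfKer hω₂
  obtain ⟨E₂, hE₂, hΨ₂⟩ := exists_timeProfile_halfKer_neg hω₁
  obtain ⟨⟨A₁, hA₁⟩, C₁, hC₁, hf₁⟩ := exists_eLpNorm_MOp_half_le hΦ₁ hD₁ hΨ₁ hE₁ hω₁ hω₂
    (σ := 1) (by norm_num) (by push_cast; linear_combination I_mul_I)
    (fun τ => by rw [fourier_halfKer hω₂, one_mul]) hc₁ hM₁ hg₁ hp
  obtain ⟨⟨A₂, hA₂⟩, C₂, hC₂, hf₂⟩ := exists_eLpNorm_MOp_half_le hΦ₂ hD₂ hΨ₂ hE₂ hω₂ hω₁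
    (σ := -1) (by norm_num) (by push_cast; linear_combination I_mul_I)
    (fun τ => by rw [fourier_halfKer_neg hω₁, neg_one_mul]) hc₂ hM₂ hg₂ hp
  have hmeas : ∀ σ : ℝ, AEStronglyMeasurable
      fun q : Rn1 n => g q.1 * ((max (σ * q.2) 0 ^ (1 / 2 : ℝ) : ℝ) : ℂ) / heatSym q := fun σ => by
    refine Measurable.aestronglyMeasurable (Measurable.div ?_ continuous_heatSym.measurable)
    fun_prop
  refine ⟨C₁ + C₂, by finiteness, fun f => ?_⟩
  have hsum : (fun q : Rn1 n => g q.1 * ((|q.2| ^ (1 / 2 : ℝ) : ℝ) : ℂ) / heatSym q) = fun q =>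
      g q.1 * ((max (1 * q.2) 0 ^ (1 / 2 : ℝ) : ℝ) : ℂ) / heatSym q +
        g q.1 * ((max (-1 * q.2) 0 ^ (1 / 2 : ℝ) : ℝ) : ℂ) / heatSym q := by
    funext q
    rw [← add_div, ← mul_add, ← Complex.ofReal_add]
    rcases le_total q.2 0 with h | h
    · rw [max_eq_right (by linarith), max_eq_left (by linarith), abs_of_nonpos h]
      norm_num
    · rw [max_eq_left (by linarith), max_eq_right (by linarith), abs_of_nonneg h]
      norm_num
  rw [hsum, add_mul]
  refine (eLpNorm_MOp_add_le (hmeas 1) (hmeas (-1)) hA₁ hA₂ f ?_).trans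
    (add_le_add (hf₁ f) (hf₂ f))
  rw [← ENNReal.ofReal_one]
  exact ENNReal.ofReal_le_ofReal hp.le

lemma norm_cexp_neg_mul_sq_le_one {ω : ℂ} (hω : 0 < ω.re) (r : ℝ) : ‖cexp (-ω * r ^ 2)‖ ≤ 1 := by
  rw [norm_cexp_neg_mul_sq, Real.exp_le_one_iff]
  nlinarith [mul_nonneg hω.le (sq_nonneg r)]

/-- The symbol `|τ|^{1/2}/(1 + 4π²|ξ|² + iτ)` is an `Lᵖ` multiplier. -/
lemma exists_eLpNorm_MOp_sqrt_le (n : ℕ) {p : ℝ} (hp : 1 < p) :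
    ∃ C ≠ ⊤, ∀ f : SchwartzMap (Rn1 n) ℂ,
      eLpNorm (MOp (fun q => 1 * ((|q.2| ^ (1 / 2 : ℝ) : ℝ) : ℂ) / heatSym q) f)
        (ENNReal.ofReal p) volume ≤ C * eLpNorm f (ENNReal.ofReal p) volume := by
  refine exists_eLpNorm_MOp_abs_half_le (g := fun _ => 1) measurable_const (fun ω hω => ?_) hp
  obtain ⟨Φ, D, hD, hΦ, hf⟩ := exists_spaceProfile_gaussian (n := n) hω
  refine ⟨Φ, D, hD, hΦ, fun r => 2 * ω * (r * cexp (-ω * r ^ 2)), ‖2 * ω‖ * (1 + ω.re⁻¹),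
    by fun_prop, fun r => ?_, fun r hr ξ => ?_⟩
  · rw [norm_mul, norm_mul (r : ℂ), norm_cexp_neg_mul_sq, Complex.norm_real, Real.norm_eq_abs,
      neg_mul, Real.exp_neg, ← div_eq_mul_inv]
    gcongr
    rw [div_le_iff₀ (Real.exp_pos _)]
    have h1 := Real.add_one_le_exp (ω.re * r ^ 2)
    have h2 : |r| ≤ 1 + r ^ 2 := by nlinarith [sq_abs r, sq_nonneg (|r| - 1), abs_nonneg r]
    calc |r| ≤ 1 + r ^ 2 := h2
      _ ≤ 1 + ω.re * r ^ 2 + ω.re⁻¹ * (ω.re * r ^ 2 + 1) := by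
        rw [mul_add, inv_mul_cancel_left₀ hω.ne']
        have : 0 ≤ ω.re * r ^ 2 := by positivity
        have : 0 ≤ ω.re⁻¹ := by positivity
        linarith
      _ ≤ Real.exp (ω.re * r ^ 2) + ω.re⁻¹ * Real.exp (ω.re * r ^ 2) := by gcongr; linarith
      _ = _ := by ring
  · have hr0 : (r : ℂ) ≠ 0 := by exact_mod_cast hr.ne'
    rw [hf, norm_smul, Real.norm_of_nonneg hr.le, one_mul]
    have he : cexp (-(ω * (1 + 4 * π ^ 2 * ‖ξ‖ ^ 2)) * r ^ 2) = cexp (-ω * r ^ 2) *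
        cexp (-(4 * π ^ 2 * ω * (r * ‖ξ‖ : ℝ) ^ 2)) := by
      rw [← Complex.exp_add]; push_cast; ring_nf
    rw [he]
    push_cast
    field_simp

/-- The symbols `ξ_k|τ|^{1/2}/(1 + 4π²|ξ|² + iτ)` are `Lᵖ` multipliers. -/
lemma exists_eLpNorm_MOp_coord_sqrt_le {n : ℕ} (k : Fin n) {p : ℝ} (hp : 1 < p) :
    ∃ C ≠ ⊤, ∀ f : SchwartzMap (Rn1 n) ℂ,
      eLpNorm (MOp (fun q => (q.1 k : ℂ) * ((|q.2| ^ (1 / 2 : ℝ) : ℝ) : ℂ) / heatSym q) f)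
        (ENNReal.ofReal p) volume ≤ C * eLpNorm f (ENNReal.ofReal p) volume := by
  refine exists_eLpNorm_MOp_abs_half_le (g := fun ξ => (ξ k : ℂ)) (by fun_prop) (fun ω hω => ?_) hp
  obtain ⟨Φ, D, hD, hΦ, hf⟩ := exists_spaceProfile_coord_gaussian (n := n) hω k
  refine ⟨Φ, D, hD, hΦ, fun r => 2 * ω * cexp (-ω * r ^ 2), ‖2 * ω‖,
    by fun_prop, fun r => ?_, fun r hr ξ => ?_⟩
  · rw [norm_mul]
    exact mul_le_of_le_one_right (norm_nonneg _) (norm_cexp_neg_mul_sq_le_one hω r)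
  · have hr0 : (r : ℂ) ≠ 0 := by exact_mod_cast hr.ne'
    rw [hf, norm_smul, Real.norm_of_nonneg hr.le]
    have he : cexp (-(ω * (1 + 4 * π ^ 2 * ‖ξ‖ ^ 2)) * r ^ 2) = cexp (-ω * r ^ 2) *
        cexp (-(4 * π ^ 2 * ω * (r * ‖ξ‖ : ℝ) ^ 2)) := by
      rw [← Complex.exp_add]; push_cast; ring_nf
    rw [he, PiLp.smul_apply, smul_eq_mul]
    push_cast
    field_simp

/-- A self-similar evolution `w(t) t^{-n/2} Φ(x/√t)` truncated to times in `(a, b]`. -/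
def evoKer {n : ℕ} (w : ℝ → ℂ) (Φ : Rn n → ℂ) (a b : ℝ) : Rn1 n → ℂ :=
  Set.indicator (Set.univ ×ˢ Set.Ioc a b) fun z =>
    w z.2 * (((√z.2 ^ n)⁻¹ : ℝ) : ℂ) * Φ ((√z.2)⁻¹ • z.1)

section evoKer

variable {n : ℕ} {w : ℝ → ℂ} {Φ : Rn n → ℂ} {a b : ℝ}

lemma measurable_evoKer (hw : Measurable w) (hΦ : Measurable Φ) : Measurable (evoKer w Φ a b) := by
  refine Measurable.indicator ?_ (MeasurableSet.univ.prod measurableSet_Ioc)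
  refine Measurable.mul (by fun_prop) (hΦ.comp (by fun_prop))

lemma norm_evoKer_le (ha : 0 < a) {W M : ℝ} (hW : ∀ t, a < t → ‖w t‖ ≤ W) (hM : ∀ x, ‖Φ x‖ ≤ M)
    (z : Rn1 n) : ‖evoKer w Φ a b z‖ ≤ W * (√a ^ n)⁻¹ * M := by
  have hW0 : 0 ≤ W := (norm_nonneg _).trans (hW (a + 1) (by linarith))
  have hM0 : 0 ≤ M := (norm_nonneg _).trans (hM 0)
  by_cases hz : z ∈ Set.univ ×ˢ Set.Ioc a b
  · have haz : a < z.2 := hz.2.1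
    rw [evoKer, Set.indicator_of_mem hz, norm_mul, norm_mul, Complex.norm_of_nonneg (by positivity)]
    have hs : 0 < √a := Real.sqrt_pos.2 ha
    gcongr
    · exact hW _ haz
    · exact hM _
  · rw [evoKer, Set.indicator_of_notMem hz, norm_zero]
    positivity

lemma integral_norm_comp_inv_smul {s : ℝ} (hs : 0 ≤ s) :
    ∫ x, ‖Φ (s⁻¹ • x)‖ = s ^ n * ∫ x, ‖Φ x‖ := by
  have h := Measure.integral_comp_inv_smul_of_nonneg (volume : Measure (Rn n)) (fun x => ‖Φ x‖) hs
  simpa using h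

lemma restrict_univ_prod (s : Set ℝ) : (volume : Measure (Rn1 n)).restrict (Set.univ ×ˢ s) =
    (volume : Measure (Rn n)).prod (volume.restrict s) := by
  rw [Measure.volume_eq_prod, ← Measure.prod_restrict, Measure.restrict_univ]

lemma integral_norm_evoKer_slice {t : ℝ} (ht : 0 < t) :
    ∫ x, ‖w t * (((√t ^ n)⁻¹ : ℝ) : ℂ) * Φ ((√t)⁻¹ • x)‖ = ‖w t‖ * ∫ x, ‖Φ x‖ := by
  have hs : 0 < √t := Real.sqrt_pos.2 ht
  simp_rw [norm_mul]
  rw [integral_const_mul, integral_norm_comp_inv_smul hs.le,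
    Complex.norm_of_nonneg (by positivity)]
  field_simp

lemma integrable_evoKer_integrand (ha : 0 ≤ a) (hw : Measurable w) (hΦ : Measurable Φ)
    (hwi : IntegrableOn w (Set.Ioi 0)) (hΦi : Integrable Φ) :
    Integrable (fun z : Rn1 n => w z.2 * (((√z.2 ^ n)⁻¹ : ℝ) : ℂ) * Φ ((√z.2)⁻¹ • z.1))
      (volume.prod (volume.restrict (Set.Ioc a b))) := by
  have hm : Measurable fun z : Rn1 n =>
      w z.2 * (((√z.2 ^ n)⁻¹ : ℝ) : ℂ) * Φ ((√z.2)⁻¹ • z.1) :=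
    Measurable.mul (by fun_prop) (hΦ.comp (by fun_prop))
  refine (integrable_prod_iff' hm.aestronglyMeasurable).2 ⟨?_, ?_⟩
  · filter_upwards [ae_restrict_mem measurableSet_Ioc] with t ht
    have hs : 0 < √t := Real.sqrt_pos.2 (ha.trans_lt ht.1)
    exact (hΦi.comp_smul (inv_ne_zero hs.ne')).const_mul _
  · have h : IntegrableOn (fun t => ‖w t‖ * ∫ x, ‖Φ x‖) (Set.Ioc a b) :=
      (IntegrableOn.mono_set hwi.norm fun t ht => ha.trans_lt ht.1).mul_const _
    refine h.congr_fun (fun t ht => ?_) measurableSet_Ioc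
    exact (integral_norm_evoKer_slice (ha.trans_lt ht.1)).symm

lemma integrable_evoKer (ha : 0 ≤ a) (hw : Measurable w) (hΦ : Measurable Φ)
    (hwi : IntegrableOn w (Set.Ioi 0)) (hΦi : Integrable Φ) : Integrable (evoKer w Φ a b) := by
  rw [evoKer, integrable_indicator_iff (MeasurableSet.univ.prod measurableSet_Ioc), IntegrableOn,
    restrict_univ_prod]
  exact integrable_evoKer_integrand ha hw hΦ hwi hΦi

lemma integral_norm_evoKer_le (ha : 0 ≤ a) (hw : Measurable w) (hΦ : Measurable Φ)
    (hwi : IntegrableOn w (Set.Ioi 0)) (hΦi : Integrable Φ) :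
    ∫ z, ‖evoKer w Φ a b z‖ ≤ (∫ t in Set.Ioi (0:ℝ), ‖w t‖) * ∫ x, ‖Φ x‖ := by
  simp_rw [evoKer, norm_indicator_eq_indicator_norm]
  rw [integral_indicator (MeasurableSet.univ.prod measurableSet_Ioc), restrict_univ_prod,
    integral_prod_symm _ (integrable_evoKer_integrand ha hw hΦ hwi hΦi).norm]
  have hsub : Set.Ioc a b ⊆ Set.Ioi 0 := fun t ht => ha.trans_lt ht.1
  calc _ = ∫ t in Set.Ioc a b, ‖w t‖ * ∫ x, ‖Φ x‖ :=
        setIntegral_congr_fun measurableSet_Ioc fun t ht =>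
          integral_norm_evoKer_slice (ha.trans_lt ht.1)
    _ = (∫ t in Set.Ioc a b, ‖w t‖) * ∫ x, ‖Φ x‖ := integral_mul_const _ _
    _ ≤ _ := by
        refine mul_le_mul_of_nonneg_right ?_ (integral_nonneg fun _ => norm_nonneg _)
        exact setIntegral_mono_set hwi.norm (.of_forall fun _ => norm_nonneg _)
          hsub.eventuallyLE

lemma FT1_evoKer (ha : 0 ≤ a) (hw : Measurable w) (hΦ : Measurable Φ)
    (hwi : IntegrableOn w (Set.Ioi 0)) (hΦi : Integrable Φ) (q : Rn1 n) :
    FT1 (evoKer w Φ a b) q =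
      ∫ t in Set.Ioc a b, w t * eChar (-(t * q.2)) * 𝓕 Φ (√t • q.1) := by
  have hi := integrable_evoKer_integrand (b := b) ha hw hΦ hwi hΦi
  have hi' : Integrable (fun z : Rn1 n => eChar (-(dotRn1 z q)) *
      (w z.2 * (((√z.2 ^ n)⁻¹ : ℝ) : ℂ) * Φ ((√z.2)⁻¹ • z.1)))
      (volume.prod (volume.restrict (Set.Ioc a b))) := by
    refine hi.bdd_mul (c := 1) ?_ (.of_forall fun x => by simp)
    exact (continuous_eChar.comp
      (continuous_dotRn1_comp continuous_id continuous_const).neg).aestronglyMeasurable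
  rw [FT1_eq]
  simp only [evoKer, ← Set.indicator_mul_right (Set.univ ×ˢ Set.Ioc a b)
    (fun z : Rn1 n => eChar (-(dotRn1 z q)))]
  rw [integral_indicator (MeasurableSet.univ.prod measurableSet_Ioc), restrict_univ_prod,
    integral_prod_symm _ hi']
  refine setIntegral_congr_fun measurableSet_Ioc fun t ht => ?_
  have hs : 0 < √t := Real.sqrt_pos.2 (ha.trans_lt ht.1)
  have h := Measure.integral_comp_inv_smul_of_nonneg (volume : Measure (Rn n))
    (fun y => cexp (↑(-2 * π * inner ℝ y (√t • q.1)) * I) • Φ y) hs.le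
  rw [← Real.fourier_eq', finrank_euclideanSpace_fin] at h
  have hpt : ∀ x : Rn n, eChar (-(dotRn1 (x, t) q)) *
      (w t * (((√t ^ n)⁻¹ : ℝ) : ℂ) * Φ ((√t)⁻¹ • x)) =
      (w t * eChar (-(t * q.2)) * (((√t ^ n)⁻¹ : ℝ) : ℂ)) *
        (cexp (↑(-2 * π * inner ℝ ((√t)⁻¹ • x) (√t • q.1)) * I) • Φ ((√t)⁻¹ • x)) := fun x => by
    have he : eChar (-(dotRn1 (x, t) q)) = eChar (-(t * q.2)) *
        cexp (↑(-2 * π * inner ℝ ((√t)⁻¹ • x) (√t • q.1)) * I) := by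
      rw [real_inner_smul_left, real_inner_smul_right, inv_mul_cancel_left₀ hs.ne', eChar, eChar,
        ← Complex.exp_add]
      congr 1
      simp only [dotRn1, PiLp.inner_apply, RCLike.inner_apply, conj_trivial]
      push_cast
      simp only [mul_comm (Complex.ofReal (x.ofLp _))]
      ring
    rw [he, smul_eq_mul]
    ring
  simp only [hpt]
  rw [integral_const_mul, h, Complex.real_smul]
  have : ((√t ^ n : ℝ) : ℂ) ≠ 0 := by exact_mod_cast (pow_pos hs n).ne'
  rw [Complex.ofReal_inv]
  field_simp

end evoKer

lemma hormanderBound_of_integrable {n : ℕ} {K : Rn1 n → ℂ} (hK : Integrable K) {A : ℝ}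
    (hA : ∫ z, ‖K z‖ ≤ A) (hm : Measurable K) : HormanderBound K (2 * ENNReal.ofReal A) := by
  intro R _ w _ _
  have h : ∫⁻ z, ‖K z‖ₑ ≤ ENNReal.ofReal A := by
    rw [← ofReal_integral_norm_eq_lintegral_enorm hK]
    exact ENNReal.ofReal_le_ofReal hA
  calc _ ≤ ∫⁻ z, ‖K (z - w) - K z‖ₑ := setLIntegral_le_lintegral _ _
    _ ≤ ∫⁻ z, (‖K (z - w)‖ₑ + ‖K z‖ₑ) := lintegral_mono fun z => enorm_sub_le
    _ = (∫⁻ z, ‖K (z - w)‖ₑ) + ∫⁻ z, ‖K z‖ₑ := lintegral_add_right _ (by fun_prop)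
    _ ≤ ENNReal.ofReal A + ENNReal.ofReal A := by
        rw [lintegral_sub_right_eq_self (fun z => ‖K z‖ₑ)]; gcongr
    _ = _ := by ring

/-- The time weight of the kernel of `ξ_k / (1 + 4π²|ξ|² + iτ)`. -/
def evoWeight (t : ℝ) : ℂ := ((2 * π * (t ^ (-(1 / 2) : ℝ) * Real.exp (-(2 * π) * t)) : ℝ) : ℂ)

lemma integrableOn_evoWeight : IntegrableOn evoWeight (Set.Ioi 0) := by
  have h := integrableOn_rpow_mul_exp_neg_mul_rpow (p := 1) (s := -(1 / 2)) (b := 2 * π)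
    (by norm_num) (by norm_num) (by positivity)
  simp only [Real.rpow_one] at h
  exact (h.const_mul (2 * π)).ofReal

lemma norm_evoWeight_le {a t : ℝ} (ha : 0 < a) (h : a < t) :
    ‖evoWeight t‖ ≤ 2 * π * a ^ (-(1 / 2) : ℝ) := by
  have ht : 0 < t := ha.trans h
  rw [evoWeight, Complex.norm_of_nonneg (by positivity)]
  gcongr
  refine (mul_le_of_le_one_right (by positivity) ?_).trans
    (Real.rpow_le_rpow_of_nonpos ha h.le (by norm_num))
  rw [Real.exp_le_one_iff]
  have : 0 < 2 * π * t := by positivity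
  linarith

lemma measurable_evoWeight : Measurable evoWeight := by
  unfold evoWeight; fun_prop

lemma integral_evoWeight_mul {n : ℕ} {Φ : Rn n → ℂ} {k : Fin n}
    (hf : ∀ ξ, 𝓕 Φ ξ = ξ k * cexp (-(4 * π ^ 2 * (2 * π : ℝ) * ‖ξ‖ ^ 2))) (q : Rn1 n) {a b : ℝ}
    (ha : 0 < a) (hab : a ≤ b) :
    ∫ t in Set.Ioc a b, evoWeight t * eChar (-(t * q.2)) * 𝓕 Φ (√t • q.1) =
      q.1 k / heatSym q *
        (cexp (-(2 * π * heatSym q) * a) - cexp (-(2 * π * heatSym q) * b)) := by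
  have hz := heatSym_ne_zero q
  have hπ : (π : ℂ) ≠ 0 := by exact_mod_cast Real.pi_ne_zero
  have h : ∀ t ∈ Set.Ioc a b, evoWeight t * eChar (-(t * q.2)) * 𝓕 Φ (√t • q.1) =
      (2 * π * q.1 k) * cexp (-(2 * π * heatSym q) * t) := fun t ht => by
    have ht0 : 0 < t := ha.trans ht.1
    have hsq : ((t ^ (-(1 / 2) : ℝ) : ℝ) : ℂ) * (√t : ℝ) = 1 := by
      rw [← Complex.ofReal_mul, Real.sqrt_eq_rpow, ← Real.rpow_add ht0]
      norm_num
    have hs2 : ((√t : ℝ) : ℂ) ^ 2 = t := by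
      rw [← Complex.ofReal_pow, Real.sq_sqrt ht0.le]
    have he : cexp (-(2 * π * heatSym q) * t) = cexp (-(2 * π) * t) * eChar (-(t * q.2)) *
        cexp (-(4 * π ^ 2 * (2 * π : ℝ) * (√t * ‖q.1‖ : ℝ) ^ 2)) := by
      rw [eChar, ← Complex.exp_add, ← Complex.exp_add, heatSym]
      congr 1
      push_cast
      rw [mul_pow, hs2]
      ring
    rw [hf, norm_smul, Real.norm_of_nonneg (Real.sqrt_nonneg t), he, PiLp.smul_apply, smul_eq_mul,
      evoWeight]
    push_cast
    linear_combination (2 * π * q.1 k * cexp (-(2 * π) * t) * eChar (-(t * q.2)) *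
      cexp (-(4 * π ^ 2 * (2 * π) * (√t * ‖q.1‖) ^ 2))) * hsq
  rw [setIntegral_congr_fun measurableSet_Ioc h, integral_const_mul,
    ← intervalIntegral.integral_of_le hab, integral_exp_mul_complex (by simp [hz, hπ])]
  field_simp
  ring

/-- The symbols `ξ_k/(1 + 4π²|ξ|² + iτ)` are `Lᵖ` multipliers. -/
lemma exists_eLpNorm_MOp_coord_le {n : ℕ} (k : Fin n) {p : ℝ} (hp : 1 < p) :
    ∃ C ≠ ⊤, ∀ f : SchwartzMap (Rn1 n) ℂ,
      eLpNorm (MOp (fun q => (q.1 k : ℂ) / heatSym q) f) (ENNReal.ofReal p) volume ≤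
        C * eLpNorm f (ENNReal.ofReal p) volume := by
  obtain ⟨Φ, D, hD, hΦ, hf⟩ := exists_spaceProfile_coord_gaussian (n := n) (w := (2 * π : ℝ))
    (by rw [Complex.ofReal_re]; positivity) k
  have hΦm := hΦ.measurable
  have hΦi := hΦ.integrable hD
  obtain ⟨M, hM⟩ := hΦ.bounded
  set A := (∫ t in Set.Ioi (0:ℝ), ‖evoWeight t‖) * ∫ x, ‖Φ x‖
  have hA : 0 ≤ A := by positivity
  obtain ⟨C, hC, H⟩ := exists_eLpNorm_conv1_le n hA (B := 2 * ENNReal.ofReal A) (by finiteness) hp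
  refine ⟨C, hC, fun f => ?_⟩
  set a : ℕ → ℝ := fun j => 1 / ((j : ℝ) + 1)
  have ha : ∀ j, 0 < a j := fun j => by positivity
  set K : ℕ → Rn1 n → ℂ := fun j => evoKer evoWeight Φ (a j) ((j : ℝ) + 1)
  have hK : ∀ j, Integrable (K j) := fun j =>
    integrable_evoKer (ha j).le measurable_evoWeight hΦm integrableOn_evoWeight hΦi
  have hKA : ∀ j, ∫ z, ‖K j z‖ ≤ A := fun j =>
    integral_norm_evoKer_le (ha j).le measurable_evoWeight hΦm integrableOn_evoWeight hΦi
  have hKm : ∀ j, Measurable (K j) := fun j => measurable_evoKer measurable_evoWeight hΦm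
  have hFA : ∀ j q, ‖FT1 (K j) q‖ ≤ A := fun j q => (norm_FT1_le _ _).trans (hKA j)
  refine eLpNorm_MOp_le_of_tendsto hK hFA (fun q => ?_) f fun j => H (K j) (hKm j) (hK j) ?_
    (hFA j) (hormanderBound_of_integrable (hK j) (hKA j) (hKm j)) f
  · have hFT : ∀ j, FT1 (K j) q = q.1 k / heatSym q * (cexp (-(2 * π * heatSym q) * a j) -
        cexp (-(2 * π * heatSym q) * ((j : ℝ) + 1 : ℝ))) := fun j => by
      rw [FT1_evoKer (ha j).le measurable_evoWeight hΦm integrableOn_evoWeight hΦi]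
      refine integral_evoWeight_mul hf q (ha j) ?_
      have hj : (0:ℝ) ≤ j := j.cast_nonneg
      exact (div_le_one (by positivity)).2 (by linarith) |>.trans (by linarith)
    simp_rw [hFT]
    have h1 : Filter.Tendsto (fun j => cexp (-(2 * π * heatSym q) * a j)) Filter.atTop (nhds 1) := by
      have h := tendsto_one_div_add_atTop_nhds_zero_nat (𝕜 := ℝ)
      have hc : Continuous fun s : ℝ => cexp (-(2 * π * heatSym q) * s) := by fun_prop
      simpa [a, Function.comp_def] using (hc.tendsto 0).comp h
    have h2 : Filter.Tendsto (fun j : ℕ => cexp (-(2 * π * heatSym q) * ((j : ℝ) + 1 : ℝ)))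
        Filter.atTop (nhds 0) := by
      rw [tendsto_zero_iff_norm_tendsto_zero]
      simp_rw [Complex.norm_exp, Complex.re_mul_ofReal]
      refine Real.tendsto_exp_atBot.comp ?_
      have hre : (-(2 * π * heatSym q)).re < 0 := by
        have : (-(2 * π * heatSym q)).re = -(2 * π * (heatSym q).re) := by simp
        rw [this]
        have := heatSym_re_pos q
        simp only [Left.neg_neg_iff]; positivity
      exact (Filter.tendsto_atTop_add_const_right _ 1
        tendsto_natCast_atTop_atTop).const_mul_atTop_of_neg hre
    simpa using (h1.sub h2).const_mul (q.1 k / heatSym q : ℂ)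
  · exact (memLp_two_iff_integrable_sq_norm (hK j).1).2 (integrable_norm_sq_of_bdd (hK j)
      (norm_evoKer_le (ha j) (fun t ht => norm_evoWeight_le (ha j) ht) hM))

end FourierSymbols

/-- The symbols `ν_1 = |τ|^{1/2}/(1+4π²|ξ|²+iτ)`,
`ν_{2,k} = ξ_k/(1+4π²|ξ|²+iτ)` and `ν_{3,k} = ξ_k|τ|^{1/2}/(1+4π²|ξ|²+iτ)` are
`Lᵖ(ℝ^{n+1})`-multipliers, `1 < p < ∞`. -/
theorem stmt5 (n : ℕ) (hn : 1 ≤ n) (p : ℝ) (hp : 1 < p) :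
    ∃ M : ℝ, 0 < M ∧
      ∀ f : SchwartzMap (Rn1 n) ℂ,
        (pNorm p (MOp (fun q => ((|q.2| ^ ((1 : ℝ) / 2) : ℝ) : ℂ) /
            (1 + 4 * (π : ℂ) ^ 2 * (‖q.1‖ : ℂ) ^ 2 + Complex.I * (q.2 : ℂ))) ⇑f)
          ≤ ENNReal.ofReal M * pNorm p ⇑f)
        ∧ (∀ k : Fin n,
          pNorm p (MOp (fun q => (q.1 k : ℂ) /
              (1 + 4 * (π : ℂ) ^ 2 * (‖q.1‖ : ℂ) ^ 2 + Complex.I * (q.2 : ℂ))) ⇑f)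
            ≤ ENNReal.ofReal M * pNorm p ⇑f)
        ∧ (∀ k : Fin n,
          pNorm p (MOp (fun q => (q.1 k : ℂ) * ((|q.2| ^ ((1 : ℝ) / 2) : ℝ) : ℂ) /
              (1 + 4 * (π : ℂ) ^ 2 * (‖q.1‖ : ℂ) ^ 2 + Complex.I * (q.2 : ℂ))) ⇑f)
            ≤ ENNReal.ofReal M * pNorm p ⇑f) := by
  obtain ⟨C₁, hC₁, h₁⟩ := exists_eLpNorm_MOp_sqrt_le n hp
  choose C₂ hC₂ h₂ using fun k : Fin n => exists_eLpNorm_MOp_coord_le k hp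
  choose C₃ hC₃ h₃ using fun k : Fin n => exists_eLpNorm_MOp_coord_sqrt_le k hp
  simp only [one_mul] at h₁
  have hS₂ : ∑ k, C₂ k ≠ ⊤ := ENNReal.sum_ne_top.2 fun k _ => hC₂ k
  have hS₃ : ∑ k, C₃ k ≠ ⊤ := ENNReal.sum_ne_top.2 fun k _ => hC₃ k
  set S := C₁ + ∑ k, C₂ k + ∑ k, C₃ k + 1
  have hS : S ≠ ⊤ := by finiteness
  have hle₁ : C₁ ≤ S := by simp only [S, add_assoc]; exact le_self_add
  have hle₂ : ∀ k, C₂ k ≤ S := fun k =>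
    (Finset.single_le_sum (fun _ _ => zero_le) (Finset.mem_univ k)).trans
      (le_add_self.trans (le_self_add.trans le_self_add))
  have hle₃ : ∀ k, C₃ k ≤ S := fun k =>
    (Finset.single_le_sum (fun _ _ => zero_le) (Finset.mem_univ k)).trans
      (le_add_self.trans le_self_add)
  refine ⟨S.toReal, ENNReal.toReal_pos (by simp [S]) hS, fun f => ?_⟩
  rw [ENNReal.ofReal_toReal hS]
  exact ⟨(h₁ f).trans (mul_le_mul_left hle₁ _), fun k => (h₂ k f).trans (mul_le_mul_left (hle₂ k) _),
    fun k => (h₃ k f).trans (mul_le_mul_left (hle₃ k) _)⟩
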